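/- (KAM theorem for b-Poisson manifolds, Theorem 5.1, stated in action-angle coordinates.) Let n ≥ 2, c ≠ 0, k, k' ∈ ℝ, r > 0. Let h : B_r → ℝ be real-analytic on the open ball B_r ⊆ ℝⁿ, let f₁ : ℝ^{n-1} × B_r → ℝ be real-analytic and ℤ^{n-1}-periodic in its first argument, let f₂ : ℝⁿ × B_r → ℝ be smooth and ℤⁿ-periodic in φ, let f₃ : ℝ × (−r,r) → ℝ be smooth and 1-periodic in its first argument, and set f(φ,y) = f₁(φ̃,y) + y₁·f₂(φ,y) + f₃(φ₁,y₁), where φ̃ = (φ₂,…,φₙ). Let y₀ ∈ B_r with (y₀)₁ = 0, write ỹ₀ = ((y₀)₂,…,(y₀)ₙ), assume the frequency vector ω̃ := (∂h/∂y₂(y₀),…,∂h/∂yₙ(y₀)) ∈ ℝ^{n-1} is Diophantine, and assume the (n−1)×(n−1) matrix (∂²h/∂yᵢ∂yⱼ(y₀))_{2≤i,j≤n} is invertible. Then there exist ε₀ > 0 and C > 0 such that for every ε with 0 < ε < ε₀ there exist smooth ℤⁿ-periodic maps u : ℝⁿ → ℝⁿ and w : ℝⁿ → ℝ^{n-1}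 with sup_x ‖u(x)‖ ≤ Cε and sup_x ‖w(x) − ỹ₀‖ ≤ Cε, such that, setting Ω := ((k+εk')/c, ω̃) ∈ ℝⁿ, for every x ∈ ℝⁿ the curve t ↦ (φ(t), y(t)) := ( x + tΩ + u(x+tΩ), (0, w(x+tΩ)) ) is a solution of the perturbed b-Hamiltonian system, and the map x ↦ x + u(x) is a diffeomorphism of ℝⁿ. In particular the set 𝒯 = {(x + u(x), (0, w(x))) : x ∈ ℝⁿ} is invariant under the perturbed flow, lies inside the exceptional hypersurface Z = {y₁ = 0}, and the flow on 𝒯 is conjugate to the linear flow with frequency vector Ω. -/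

import Mathlib

/- We model `ℝⁿ × ℝⁿ` with `n = m + 1 ≥ 2` as `Pt m`, splitting the coordinates as
`(φ, y) = ((φ₁, φ̃), (y₁, ỹ))` with `φ̃ = (φ₂, …, φₙ)`, `ỹ = (y₂, …, yₙ)`. -/
abbrev Pt (m : ℕ) := (ℝ × (Fin m → ℝ)) × (ℝ × (Fin m → ℝ))

/-- `∂F/∂φ₁`. -/
noncomputable def pdPhi1 {m : ℕ} (F : Pt m → ℝ) (p : Pt m) : ℝ :=
  fderiv ℝ F p ((1, 0), (0, 0))

/-- `∂F/∂φᵢ₊₁` for `i : Fin m`. -/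
noncomputable def pdPhi {m : ℕ} (F : Pt m → ℝ) (p : Pt m) (i : Fin m) : ℝ :=
  fderiv ℝ F p ((0, Pi.single i 1), (0, 0))

/-- `∂F/∂y₁`. -/
noncomputable def pdY1 {m : ℕ} (F : Pt m → ℝ) (p : Pt m) : ℝ :=
  fderiv ℝ F p ((0, 0), (1, 0))

/-- `∂F/∂yᵢ₊₁` for `i : Fin m`. -/
noncomputable def pdY {m : ℕ} (F : Pt m → ℝ) (p : Pt m) (i : Fin m) : ℝ :=
  fderiv ℝ F p ((0, 0), (0, Pi.single i 1))


section PartA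
open Real

namespace KAM

abbrev E (m : ℕ) := EuclideanSpace ℝ (Fin m)

/-- `ℓ¹` norm of an integer vector. -/
noncomputable def kn {m : ℕ} (k : Fin m → ℤ) : ℝ := ∑ i, |(k i : ℝ)|

/-- The linear form `x ↦ 2π k·x`. -/
noncomputable def kd {m : ℕ} (k : Fin m → ℤ) : E m →L[ℝ] ℝ :=
  ∑ i, (2 * π * (k i : ℝ)) • (EuclideanSpace.proj i : E m →L[ℝ] ℝ)

lemma kd_apply {m : ℕ} (k : Fin m → ℤ) (x : E m) : kd k x = ∑ i, 2 * π * (k i : ℝ) * x i := by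
  simp [kd]

lemma kn_nonneg {m : ℕ} (k : Fin m → ℤ) : 0 ≤ kn k := Finset.sum_nonneg fun _ _ => abs_nonneg _

lemma kd_add {m : ℕ} (k l : Fin m → ℤ) : kd (k + l) = kd k + kd l := by
  ext x; simp only [kd_apply, add_apply, ← Finset.sum_add_distrib]
  refine Finset.sum_congr rfl fun i _ => ?_
  simp; ring

lemma kd_sub {m : ℕ} (k l : Fin m → ℤ) : kd (k - l) = kd k - kd l := by
  ext x; simp only [kd_apply, sub_apply, ← Finset.sum_sub_distrib]
  refine Finset.sum_congr rfl fun i _ => ?_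
  simp; ring

lemma kn_add_le {m : ℕ} (k l : Fin m → ℤ) : kn (k + l) ≤ kn k + kn l := by
  simp only [kn, ← Finset.sum_add_distrib]
  refine Finset.sum_le_sum fun i _ => ?_
  simpa using abs_add_le (k i : ℝ) (l i)

lemma kn_sub_le {m : ℕ} (k l : Fin m → ℤ) : kn (k - l) ≤ kn k + kn l := by
  simp only [kn, ← Finset.sum_add_distrib]
  refine Finset.sum_le_sum fun i _ => ?_
  simpa using abs_sub (k i : ℝ) (l i)

lemma norm_kd_le {m : ℕ} (k : Fin m → ℤ) : ‖kd k‖ ≤ 2 * π * kn k := by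
  refine ContinuousLinearMap.opNorm_le_bound _ (by have := kn_nonneg k; positivity) fun x => ?_
  rw [kd_apply, kn, Finset.mul_sum, Finset.sum_mul]
  refine (norm_sum_le _ _).trans (Finset.sum_le_sum fun i _ => ?_)
  rw [norm_mul, norm_mul, norm_mul]
  have h1 : ‖x i‖ ≤ ‖x‖ := PiLp.norm_apply_le x i
  simp only [Real.norm_eq_abs] at *
  rw [abs_of_pos pi_pos, abs_of_pos (by norm_num : (0:ℝ) < 2)]
  gcongr

lemma kd_period {m : ℕ} (k : Fin m → ℤ) (l : Fin m → ℤ) :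
    ∃ N : ℤ, kd k (WithLp.toLp 2 fun i => (l i : ℝ)) = N * (2 * π) := by
  refine ⟨∑ i, k i * l i, ?_⟩
  rw [kd_apply]; push_cast; rw [Finset.sum_mul]
  refine Finset.sum_congr rfl fun i _ => ?_
  ring

section W

variable {m : ℕ} {V V₁ V₂ V₃ : Type*} [NormedAddCommGroup V] [NormedSpace ℝ V]
  [NormedAddCommGroup V₁] [NormedSpace ℝ V₁] [NormedAddCommGroup V₂] [NormedSpace ℝ V₂]
  [NormedAddCommGroup V₃] [NormedSpace ℝ V₃]

/-- `g` is a sum of trigonometric atoms, with weighted `ℓ¹` norm at most `M`. -/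
def W (ρ M : ℝ) (g : E m → V) : Prop :=
  ∃ (I : Type) (a : I → V) (k : I → Fin m → ℤ) (φ : I → ℝ) (S : ℝ),
    HasSum (fun i => ‖a i‖ * exp (ρ * kn (k i))) S ∧ S ≤ M ∧
    ∀ x, HasSum (fun i => cos (kd (k i) x + φ i) • a i) (g x)

lemma W.mono {ρ ρ' M M' : ℝ} {g : E m → V} (h : W ρ M g) (hρ : ρ' ≤ ρ) (hM : M ≤ M') :
    W ρ' M' g := by
  obtain ⟨I, a, k, φ, S, h1, h2, h3⟩ := h
  have hle : ∀ i, ‖a i‖ * exp (ρ' * kn (k i)) ≤ ‖a i‖ * exp (ρ * kn (k i)) := fun i => by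
    have := kn_nonneg (k i); gcongr
  have hs : Summable (fun i => ‖a i‖ * exp (ρ' * kn (k i))) :=
    Summable.of_nonneg_of_le (fun i => by positivity) hle h1.summable
  exact ⟨I, a, k, φ, _, hs.hasSum, (hasSum_le hle hs.hasSum h1).trans (h2.trans hM), h3⟩

lemma W.nonneg {ρ M : ℝ} {g : E m → V} (h : W ρ M g) : 0 ≤ M := by
  obtain ⟨I, a, k, φ, S, h1, h2, h3⟩ := h
  exact (h1.nonneg fun i => by positivity).trans h2

lemma W.norm_le {ρ M : ℝ} {g : E m → V} (h : W ρ M g) (hρ : 0 ≤ ρ) (x : E m) : ‖g x‖ ≤ M := by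
  obtain ⟨I, a, k, φ, S, h1, h2, h3⟩ := h
  refine le_trans ?_ h2
  rw [← (h3 x).tsum_eq, ← h1.tsum_eq]
  have hle : ∀ i, ‖cos (kd (k i) x + φ i) • a i‖ ≤ ‖a i‖ * exp (ρ * kn (k i)) := fun i => by
    rw [norm_smul]
    have h4 : ‖cos (kd (k i) x + φ i)‖ ≤ 1 := abs_cos_le_one _
    have h5 : 1 ≤ exp (ρ * kn (k i)) := one_le_exp (mul_nonneg hρ (kn_nonneg _))
    have := norm_nonneg (a i)
    nlinarith
  exact tsum_of_norm_bounded h1 hle |>.trans h1.tsum_eq.ge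

lemma W.periodic {ρ M : ℝ} {g : E m → V} (h : W ρ M g) (x : E m) (l : Fin m → ℤ) :
    g (x + WithLp.toLp 2 fun i => (l i : ℝ)) = g x := by
  obtain ⟨I, a, k, φ, S, h1, h2, h3⟩ := h
  refine (h3 _).unique ?_
  convert h3 x using 2 with i
  obtain ⟨N, hN⟩ := kd_period (k i) l
  rw [map_add, hN, add_right_comm, cos_add_int_mul_two_pi]

lemma W.atom (ρ : ℝ) (k : Fin m → ℤ) (φ : ℝ) (a : V) :
    W ρ (‖a‖ * exp (ρ * kn k)) (fun x => cos (kd k x + φ) • a) :=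
  ⟨Unit, fun _ => a, fun _ => k, fun _ => φ, _, hasSum_unique _, le_rfl, fun _ => hasSum_unique _⟩

lemma W.hasSum [CompleteSpace V] {ι : Type} {ρ S : ℝ} {M : ι → ℝ} {g : ι → E m → V} {G : E m → V}
    (h : ∀ i, W ρ (M i) (g i)) (hρ : 0 ≤ ρ) (hM : HasSum M S)
    (hG : ∀ x, HasSum (fun i => g i x) (G x)) : W ρ S G := by
  classical
  choose I a k φ s h1 h2 h3 using h
  have hs0 : ∀ i, 0 ≤ s i := fun i => (h1 i).nonneg fun j => by positivity
  have hs : Summable s := Summable.of_nonneg_of_le hs0 h2 hM.summable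
  have hsig : Summable (fun p : Σ i, I i => ‖a p.1 p.2‖ * exp (ρ * kn (k p.1 p.2))) := by
    rw [summable_sigma_of_nonneg (fun p => by positivity)]
    refine ⟨fun i => (h1 i).summable, ?_⟩
    simpa only [(h1 _).tsum_eq] using hs
  refine ⟨Σ i, I i, fun p => a p.1 p.2, fun p => k p.1 p.2, fun p => φ p.1 p.2, _,
    hsig.hasSum, ?_, fun x => ?_⟩
  · have := hsig.hasSum.sigma h1
    exact hasSum_le h2 this hM
  · refine (hG x).sigma_of_hasSum (fun i => h3 i x) ?_
    refine Summable.of_norm_bounded hsig fun p => ?_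
    rw [norm_smul]
    have h4 : ‖cos (kd (k p.1 p.2) x + φ p.1 p.2)‖ ≤ 1 := abs_cos_le_one _
    have h5 : 1 ≤ exp (ρ * kn (k p.1 p.2)) := one_le_exp (mul_nonneg hρ (kn_nonneg _))
    have := norm_nonneg (a p.1 p.2)
    nlinarith

lemma W.add [CompleteSpace V] {ρ M N : ℝ} {f g : E m → V} (hρ : 0 ≤ ρ) (hf : W ρ M f)
    (hg : W ρ N g) : W ρ (M + N) (fun x => f x + g x) := by
  refine W.hasSum (ι := Bool) (M := fun b => cond b M N) (g := fun b => cond b f g)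
    (fun b => by cases b <;> simpa) hρ ?_ fun x => ?_
  · simpa using hasSum_fintype (fun b => cond b M N)
  · simpa using hasSum_fintype (fun b : Bool => (cond b f g) x)

lemma W.clm {ρ M : ℝ} {f : E m → V} (hf : W ρ M f) (L : V →L[ℝ] V₁) :
    W ρ (‖L‖ * M) (fun x => L (f x)) := by
  obtain ⟨I, a, k, φ, S, h1, h2, h3⟩ := hf
  have h4 := h1.mul_left ‖L‖
  have hle : ∀ i, ‖L (a i)‖ * exp (ρ * kn (k i)) ≤ ‖L‖ * (‖a i‖ * exp (ρ * kn (k i))) := fun i => by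
    rw [← mul_assoc]; gcongr; exact L.le_opNorm _
  have hs : Summable (fun i => ‖L (a i)‖ * exp (ρ * kn (k i))) :=
    Summable.of_nonneg_of_le (fun i => by positivity) hle h4.summable
  refine ⟨I, fun i => L (a i), k, φ, _, hs.hasSum, (hasSum_le hle hs.hasSum h4).trans (by gcongr), ?_⟩
  intro x
  simpa using L.hasSum (h3 x)

lemma W.clm_le {ρ M c : ℝ} {f : E m → V} (hf : W ρ M f) (L : V →L[ℝ] V₁) (hL : ‖L‖ ≤ c) :
    W ρ (c * M) (fun x => L (f x)) :=
  (hf.clm L).mono le_rfl (mul_le_mul_of_nonneg_right hL hf.nonneg)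

lemma W.neg {ρ M : ℝ} {f : E m → V} (hf : W ρ M f) : W ρ M (fun x => -f x) := by
  have := hf.clm_le (c := 1) (-(ContinuousLinearMap.id ℝ V)) (by
    rw [norm_neg]; exact ContinuousLinearMap.norm_id_le)
  simpa using this

lemma W.sub [CompleteSpace V] {ρ M N : ℝ} {f g : E m → V} (hρ : 0 ≤ ρ) (hf : W ρ M f)
    (hg : W ρ N g) : W ρ (M + N) (fun x => f x - g x) := by
  simpa [sub_eq_add_neg] using hf.add hρ hg.neg

lemma W.smul {ρ M : ℝ} {f : E m → V} (hf : W ρ M f) (c : ℝ) : W ρ (|c| * M) (fun x => c • f x) := by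
  have := hf.clm_le (c := |c|) (c • (ContinuousLinearMap.id ℝ V)) (by
    rw [norm_smul]; exact mul_le_of_le_one_right (norm_nonneg _) ContinuousLinearMap.norm_id_le)
  simpa using this

lemma W.const (ρ : ℝ) (a : V) : W ρ ‖a‖ (fun _ : E m => a) := by
  have := W.atom (m := m) ρ 0 0 a
  simpa [kn, kd] using this

lemma W.zero (ρ : ℝ) : W ρ 0 (fun _ : E m => (0 : V)) := by
  simpa using W.const (m := m) ρ (0 : V)

lemma W.atom_mul [CompleteSpace V₃] {ρ : ℝ} (hρ : 0 ≤ ρ) (k l : Fin m → ℤ) (φ ψ : ℝ) (a : V₃) :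
    W ρ (‖a‖ * (exp (ρ * kn k) * exp (ρ * kn l)))
      (fun x => (cos (kd k x + φ) * cos (kd l x + ψ)) • a) := by
  have h1 := W.atom (m := m) ρ (k + l) (φ + ψ) ((1 / 2 : ℝ) • a)
  have h2 := W.atom (m := m) ρ (k - l) (φ - ψ) ((1 / 2 : ℝ) • a)
  have h3 := W.add hρ h1 h2
  have e : (fun x => (cos (kd k x + φ) * cos (kd l x + ψ)) • a) = fun x =>
      cos (kd (k + l) x + (φ + ψ)) • (1 / 2 : ℝ) • a + cos (kd (k - l) x + (φ - ψ)) • (1 / 2 : ℝ) • a := by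
    funext x
    rw [← add_smul, smul_smul]
    congr 1
    rw [kd_add, kd_sub, add_apply, sub_apply,
      show kd k x + kd l x + (φ + ψ) = (kd k x + φ) + (kd l x + ψ) by ring,
      show kd k x - kd l x + (φ - ψ) = (kd k x + φ) - (kd l x + ψ) by ring, cos_add (kd k x + φ) (kd l x + ψ), cos_sub (kd k x + φ) (kd l x + ψ)]
    ring
  rw [e]
  refine h3.mono le_rfl ?_
  rw [norm_smul]
  have e1 : exp (ρ * kn (k + l)) ≤ exp (ρ * kn k) * exp (ρ * kn l) := by
    rw [← exp_add, ← mul_add]; gcongr; exact kn_add_le _ _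
  have e2 : exp (ρ * kn (k - l)) ≤ exp (ρ * kn k) * exp (ρ * kn l) := by
    rw [← exp_add, ← mul_add]; gcongr; exact kn_sub_le _ _
  have := norm_nonneg a
  norm_num
  nlinarith

lemma W.bilin [CompleteSpace V₃] {ρ M N : ℝ} {f : E m → V₁} {g : E m → V₂} (hρ : 0 ≤ ρ)
    (hf : W ρ M f) (hg : W ρ N g) (B : V₁ →L[ℝ] V₂ →L[ℝ] V₃) :
    W ρ (‖B‖ * M * N) (fun x => B (f x) (g x)) := by
  obtain ⟨I, a, k, φ, S, h1, h2, h3⟩ := hf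
  obtain ⟨J, b, l, ψ, T, t1, t2, t3⟩ := hg
  have key : ∀ i, W ρ (‖B‖ * (‖a i‖ * exp (ρ * kn (k i))) * T)
      (fun x => B (cos (kd (k i) x + φ i) • a i) (g x)) := by
    intro i
    refine W.hasSum (ι := J) (M := fun j => ‖B‖ * (‖a i‖ * exp (ρ * kn (k i))) *
      (‖b j‖ * exp (ρ * kn (l j)))) (g := fun j x =>
      B (cos (kd (k i) x + φ i) • a i) (cos (kd (l j) x + ψ j) • b j)) ?_ hρ (t1.mul_left _) ?_
    · intro j
      have := W.atom_mul hρ (k i) (l j) (φ i) (ψ j) (B (a i) (b j))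
      have e : (fun x => B (cos (kd (k i) x + φ i) • a i) (cos (kd (l j) x + ψ j) • b j)) =
        fun x => (cos (kd (k i) x + φ i) * cos (kd (l j) x + ψ j)) • B (a i) (b j) := by
        funext x; simp [smul_smul, mul_comm]
      rw [e]
      refine this.mono le_rfl ?_
      have := B.le_opNorm₂ (a i) (b j)
      calc _ ≤ (‖B‖ * ‖a i‖ * ‖b j‖) * (exp (ρ * kn (k i)) * exp (ρ * kn (l j))) := by gcongr
        _ = _ := by ring
    · intro x
      exact (B (cos (kd (k i) x + φ i) • a i)).hasSum (t3 x)
  have hT : 0 ≤ T := t1.nonneg fun j => by positivity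
  have hS : 0 ≤ S := h1.nonneg fun j => by positivity
  have := W.hasSum (M := fun i => ‖B‖ * (‖a i‖ * exp (ρ * kn (k i))) * T) key hρ
    ((h1.mul_left _).mul_right _) (G := fun x => B (f x) (g x)) (fun x => by
      exact (B.flip (g x)).hasSum (h3 x))
  have hM := hS.trans h2
  exact this.mono le_rfl (by gcongr)

lemma W.bilin_le [CompleteSpace V₃] {ρ M N c : ℝ} {f : E m → V₁} {g : E m → V₂} (hρ : 0 ≤ ρ)
    (hf : W ρ M f) (hg : W ρ N g) (B : V₁ →L[ℝ] V₂ →L[ℝ] V₃) (hB : ‖B‖ ≤ c) :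
    W ρ (c * M * N) (fun x => B (f x) (g x)) :=
  (hf.bilin hρ hg B).mono le_rfl (by have := hf.nonneg; have := hg.nonneg; gcongr)

/-- Evaluation of an operator-valued function on a vector-valued one. -/
lemma W.app [CompleteSpace V₂] {ρ M N : ℝ} {f : E m → (V₁ →L[ℝ] V₂)} {g : E m → V₁} (hρ : 0 ≤ ρ)
    (hf : W ρ M f) (hg : W ρ N g) : W ρ (M * N) (fun x => f x (g x)) := by
  simpa using hf.bilin_le hρ hg (ContinuousLinearMap.id ℝ (V₁ →L[ℝ] V₂)) ContinuousLinearMap.norm_id_le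

lemma W.comp [CompleteSpace V₃] {ρ M N : ℝ} {f : E m → (V₂ →L[ℝ] V₃)} {g : E m → (V₁ →L[ℝ] V₂)}
    (hρ : 0 ≤ ρ) (hf : W ρ M f) (hg : W ρ N g) : W ρ (M * N) (fun x => (f x).comp (g x)) := by
  simpa using hf.bilin_le hρ hg (ContinuousLinearMap.compL ℝ V₁ V₂ V₃)
    (ContinuousLinearMap.norm_compL_le ℝ V₁ V₂ V₃)

lemma W.prodMk [CompleteSpace V₁] [CompleteSpace V₂] {ρ M N : ℝ} {f : E m → V₁} {g : E m → V₂} (hρ : 0 ≤ ρ)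
    (hf : W ρ M f) (hg : W ρ N g) : W ρ (M + N) (fun x => (f x, g x)) := by
  have h1 := hf.clm_le (c := 1) (ContinuousLinearMap.inl ℝ V₁ V₂) (by
    exact ContinuousLinearMap.norm_inl_le_one ..)
  have h2 := hg.clm_le (c := 1) (ContinuousLinearMap.inr ℝ V₁ V₂) (by
    exact ContinuousLinearMap.norm_inr_le_one ..)
  simpa using h1.add hρ h2

end W
end KAM
end PartA

section PartB
open Real
namespace KAM
section W2
variable {m : ℕ} {V V₁ V₂ V₃ : Type*} [NormedAddCommGroup V] [NormedSpace ℝ V]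
  [NormedAddCommGroup V₁] [NormedSpace ℝ V₁] [NormedAddCommGroup V₂] [NormedSpace ℝ V₂]
  [NormedAddCommGroup V₃] [NormedSpace ℝ V₃]

lemma hasFDerivAt_atom (k : Fin m → ℤ) (φ : ℝ) (a : V) (x : E m) :
    HasFDerivAt (fun x => cos (kd k x + φ) • a)
      (cos (kd k x + (φ + π / 2)) • (kd k).smulRight a) x := by
  have h1 : HasFDerivAt (fun x => kd k x + φ) (kd k) x := (kd k).hasFDerivAt.add_const φ
  have h2 := (h1.cos).smul_const a
  refine h2.congr_fderiv (ContinuousLinearMap.ext fun y => ?_)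
  rw [← add_assoc, cos_add_pi_div_two]
  simp [smul_smul]

lemma W.hasFDerivAt [CompleteSpace V] {ρ M δ : ℝ} {g : E m → V} (h : W ρ M g) (hδ : 0 < δ)
    (hρ : δ ≤ ρ) :
    ∃ g' : E m → (E m →L[ℝ] V), (∀ x, HasFDerivAt g (g' x) x) ∧ W (ρ - δ) (2 * π / δ * M) g' := by
  obtain ⟨I, a, k, φ, S, h1, h2, h3⟩ := h
  have hk : ∀ i, ‖kd (k i)‖ ≤ 2 * π / δ * exp (δ * kn (k i)) := by
    intro i
    refine (norm_kd_le _).trans ?_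
    have : δ * kn (k i) ≤ exp (δ * kn (k i)) := (by linarith [add_one_le_exp (δ * kn (k i))])
    calc 2 * π * kn (k i) = 2 * π / δ * (δ * kn (k i)) := by field_simp
      _ ≤ _ := by gcongr
  have hb : ∀ i, ‖(kd (k i)).smulRight (a i)‖ * exp ((ρ - δ) * kn (k i)) ≤
      2 * π / δ * (‖a i‖ * exp (ρ * kn (k i))) := by
    intro i
    rw [ContinuousLinearMap.norm_smulRight_apply]
    calc _ ≤ (2 * π / δ * exp (δ * kn (k i))) * ‖a i‖ * exp ((ρ - δ) * kn (k i)) := by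
          gcongr; exact hk i
      _ = 2 * π / δ * (‖a i‖ * (exp (δ * kn (k i)) * exp ((ρ - δ) * kn (k i)))) := by ring
      _ = _ := by rw [← exp_add]; congr 3; ring_nf
  have hs : Summable fun i => ‖(kd (k i)).smulRight (a i)‖ * exp ((ρ - δ) * kn (k i)) :=
    Summable.of_nonneg_of_le (fun i => by positivity) hb (h1.mul_left _).summable
  have hb2 : ∀ i (x : E m), ‖cos (kd (k i) x + (φ i + π / 2)) • (kd (k i)).smulRight (a i)‖ ≤
      ‖(kd (k i)).smulRight (a i)‖ * exp ((ρ - δ) * kn (k i)) := by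
    intro i x
    rw [norm_smul]
    have h4 : ‖cos (kd (k i) x + (φ i + π / 2))‖ ≤ 1 := abs_cos_le_one _
    have h5 : 1 ≤ exp ((ρ - δ) * kn (k i)) := one_le_exp (mul_nonneg (by linarith) (kn_nonneg _))
    have := norm_nonneg ((kd (k i)).smulRight (a i))
    nlinarith
  have hsx : ∀ x, Summable fun i => cos (kd (k i) x + (φ i + π / 2)) • (kd (k i)).smulRight (a i) :=
    fun x => Summable.of_norm_bounded hs fun i => hb2 i x
  refine ⟨fun x => ∑' i, cos (kd (k i) x + (φ i + π / 2)) • (kd (k i)).smulRight (a i), ?_, ?_⟩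
  · intro x
    have := hasFDerivAt_tsum hs (fun i x => hasFDerivAt_atom (k i) (φ i) (a i) x) hb2
      (h3 x).summable x
    have e : g = fun y => ∑' i, cos (kd (k i) y + φ i) • a i := funext fun y => (h3 y).tsum_eq.symm
    rw [e]
    exact this
  · exact ⟨I, _, k, fun i => φ i + π / 2, _, hs.hasSum,
      (hasSum_le hb hs.hasSum (h1.mul_left _)).trans (by gcongr), fun x => (hsx x).hasSum⟩

lemma W.fderivW [CompleteSpace V] {ρ M δ : ℝ} {g : E m → V} (h : W ρ M g) (hδ : 0 < δ)
    (hρ : δ ≤ ρ) : W (ρ - δ) (2 * π / δ * M) (fderiv ℝ g) := by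
  obtain ⟨g', h1, h2⟩ := h.hasFDerivAt hδ hρ
  have : fderiv ℝ g = g' := funext fun x => (h1 x).fderiv
  rwa [this]

lemma W.differentiable [CompleteSpace V] {ρ M : ℝ} {g : E m → V} (h : W ρ M g) (hρ : 0 < ρ) :
    Differentiable ℝ g := by
  obtain ⟨g', h1, h2⟩ := h.hasFDerivAt hρ le_rfl
  exact fun x => (h1 x).differentiableAt

lemma W.contDiff_nat : ∀ (n : ℕ) {V : Type _} [NormedAddCommGroup V] [NormedSpace ℝ V]
    [CompleteSpace V] {ρ M : ℝ} {g : E m → V}, W ρ M g → 0 < ρ → ContDiff ℝ n g := by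
  intro n
  induction n with
  | zero =>
    intro V _ _ _ ρ M g h hρ
    exact contDiff_zero.2 (h.differentiable hρ).continuous
  | succ n ih =>
    intro V _ _ _ ρ M g h hρ
    have := (contDiff_succ_iff_fderiv (𝕜 := ℝ) (f := g) (n := n)).2
    push_cast
    refine this ⟨h.differentiable hρ, by simp, ih (h.fderivW (half_pos hρ) (by linarith)) (by linarith)⟩

lemma W.contDiff [CompleteSpace V] {ρ M : ℝ} {g : E m → V} (h : W ρ M g) (hρ : 0 < ρ) :
    ContDiff ℝ (⊤ : ℕ∞) g := contDiff_infty.2 fun n => W.contDiff_nat n h hρ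


/-- Neumann series. -/
lemma W.neumann_ring {R : Type*} [NormedRing R] [NormedAlgebra ℝ R] [CompleteSpace R]
    (h1n : ‖(1 : R)‖ ≤ 1) {ρ M : ℝ} {g : E m → R} (hρ : 0 ≤ ρ) (h : W ρ M g)
    (hM : M ≤ 1 / 2) :
    ∃ g' : E m → R, W ρ 2 g' ∧ W ρ (2 * M) (fun x => g' x - 1) ∧
      (∀ x, (1 + g x) * g' x = 1) ∧ (∀ x, g' x * (1 + g x) = 1) := by
  have h0 := h.nonneg
  have hn : W ρ M (fun x => -g x) := h.neg
  have hp : ∀ n : ℕ, W ρ (M ^ (n + 1)) (fun x => (-g x) ^ (n + 1)) := by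
    intro n
    induction n with
    | zero => simpa using hn
    | succ n ih =>
      have := W.bilin_le (c := 1) hρ ih hn (ContinuousLinearMap.mul ℝ R)
        (ContinuousLinearMap.opNorm_mul_le ℝ R)
      simp only [pow_succ _ (n + 1)]
      simpa using this
  have hlt : ∀ x, ‖-g x‖ < 1 := fun x => (hn.norm_le hρ x).trans_lt (by linarith)
  have hgeo := (hasSum_geometric_of_lt_one h0 (by linarith : M < 1)).mul_right M
  have hsum : ∀ x, HasSum (fun n => (-g x) ^ (n + 1)) (∑' n : ℕ, (-g x) ^ (n + 1)) := fun x =>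
    ((summable_nat_add_iff (f := fun n => (-g x) ^ n) 1).2
      (summable_geometric_of_norm_lt_one (hlt x))).hasSum
  have hW : W ρ ((1 - M)⁻¹ * M) (fun x => ∑' n : ℕ, (-g x) ^ (n + 1)) :=
    W.hasSum (M := fun n : ℕ => M ^ (n + 1)) (g := fun n x => (-g x) ^ (n + 1)) hp hρ
      (by simpa [pow_succ] using hgeo) hsum
  have hW2 : W ρ (2 * M) (fun x => ∑' n : ℕ, (-g x) ^ (n + 1)) := by
    refine hW.mono le_rfl (mul_le_mul_of_nonneg_right ?_ h0)
    rw [inv_le_comm₀ (by linarith) (by norm_num)]; linarith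
  have e : ∀ x, (∑' n : ℕ, (-g x) ^ n) = 1 + ∑' n : ℕ, (-g x) ^ (n + 1) := fun x => by
    rw [(summable_geometric_of_norm_lt_one (hlt x)).tsum_eq_zero_add]; simp
  refine ⟨fun x => ∑' n : ℕ, (-g x) ^ n, ?_, ?_, ?_, ?_⟩
  · have h1 : W ρ 1 (fun _ : E m => (1 : R)) := (W.const ρ (1 : R)).mono le_rfl h1n
    have h := (W.add hρ h1 hW2).mono le_rfl (by linarith : 1 + 2 * M ≤ 2)
    simpa only [e] using h
  · simpa [e] using hW2
  · intro x
    have := mul_neg_geom_series (-g x) (hlt x)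
    simpa using this
  · intro x
    have := geom_series_mul_neg (-g x) (hlt x)
    simpa using this

lemma W.neumann [CompleteSpace V] {ρ M : ℝ} {g : E m → (V →L[ℝ] V)} (hρ : 0 ≤ ρ) (h : W ρ M g)
    (hM : M ≤ 1 / 2) :
    ∃ g' : E m → (V →L[ℝ] V), W ρ 2 g' ∧ W ρ (2 * M) (fun x => g' x - 1) ∧
      (∀ x, (1 + g x) * g' x = 1) ∧ (∀ x, g' x * (1 + g x) = 1) :=
  W.neumann_ring ContinuousLinearMap.norm_id_le hρ h hM

end W2
end KAM
end PartB

section PartC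
open Real
namespace KAM
section W3
variable {m : ℕ} {V V₁ V₂ V₃ : Type*} [NormedAddCommGroup V] [NormedSpace ℝ V]
  [NormedAddCommGroup V₁] [NormedSpace ℝ V₁] [NormedAddCommGroup V₂] [NormedSpace ℝ V₂]
  [NormedAddCommGroup V₃] [NormedSpace ℝ V₃]

lemma atoms_hasFDerivAt [CompleteSpace V] {I : Type} {a : I → V} {k : I → Fin m → ℤ} {φ : I → ℝ}
    {ρ : ℝ} (hρ : 0 < ρ) {g : E m → V} (h1 : Summable (fun i => ‖a i‖ * exp (ρ * kn (k i))))
    (h3 : ∀ x, HasSum (fun i => cos (kd (k i) x + φ i) • a i) (g x)) (x : E m) :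
    ∃ L : E m →L[ℝ] V, HasFDerivAt g L x ∧
      ∀ v, HasSum (fun i => (cos (kd (k i) x + (φ i + π / 2)) * kd (k i) v) • a i) (L v) := by
  have hk : ∀ i, ‖kd (k i)‖ ≤ 2 * π / ρ * exp (ρ * kn (k i)) := by
    intro i
    refine (norm_kd_le _).trans ?_
    have : ρ * kn (k i) ≤ exp (ρ * kn (k i)) := (by linarith [add_one_le_exp (ρ * kn (k i))])
    calc 2 * π * kn (k i) = 2 * π / ρ * (ρ * kn (k i)) := by field_simp
      _ ≤ _ := by gcongr
  have hs : Summable fun i => ‖(kd (k i)).smulRight (a i)‖ := by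
    refine Summable.of_nonneg_of_le (fun i => by positivity) (fun i => ?_) (h1.mul_left (2 * π / ρ))
    rw [ContinuousLinearMap.norm_smulRight_apply]
    calc _ ≤ (2 * π / ρ * exp (ρ * kn (k i))) * ‖a i‖ := by gcongr; exact hk i
      _ = _ := by ring
  have hb2 : ∀ i (x : E m), ‖cos (kd (k i) x + (φ i + π / 2)) • (kd (k i)).smulRight (a i)‖ ≤
      ‖(kd (k i)).smulRight (a i)‖ := by
    intro i x
    rw [norm_smul]
    exact mul_le_of_le_one_left (norm_nonneg _) (abs_cos_le_one _)
  have hsx : Summable fun i => cos (kd (k i) x + (φ i + π / 2)) • (kd (k i)).smulRight (a i) :=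
    Summable.of_norm_bounded hs fun i => hb2 i x
  refine ⟨∑' i, cos (kd (k i) x + (φ i + π / 2)) • (kd (k i)).smulRight (a i), ?_, ?_⟩
  · have := hasFDerivAt_tsum hs (fun i x => hasFDerivAt_atom (k i) (φ i) (a i) x) hb2
      (h3 x).summable x
    have e : g = fun y => ∑' i, cos (kd (k i) y + φ i) • a i := funext fun y => (h3 y).tsum_eq.symm
    rw [e]
    exact this
  · intro v
    have := (ContinuousLinearMap.apply ℝ V v).hasSum hsx.hasSum
    simpa [mul_smul] using this

/-- Diophantine condition, with the constants we use. -/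
def Dio (ω : E m) (Λ : ℝ) (N : ℕ) : Prop :=
  0 < Λ ∧ ∀ k : Fin m → ℤ, k ≠ 0 → 1 ≤ Λ * kn k ^ N * |kd k ω|

lemma Dio.inv_le {ω : E m} {Λ : ℝ} {N : ℕ} (h : Dio ω Λ N) {k : Fin m → ℤ} (hk : k ≠ 0) {δ : ℝ}
    (hδ : 0 < δ) : |kd k ω|⁻¹ ≤ Λ * N.factorial / δ ^ N * exp (δ * kn k) := by
  have h1 := h.2 k hk
  have h0 := h.1
  have hpos : 0 < |kd k ω| := by
    rcases (abs_nonneg (kd k ω)).eq_or_lt with h | h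
    · rw [← h] at h1; norm_num at h1
    · exact h
  have h2 : |kd k ω|⁻¹ ≤ Λ * kn k ^ N := by
    rw [inv_le_iff_one_le_mul₀ hpos]; exact h1
  have h3 := Real.pow_div_factorial_le_exp (δ * kn k) (mul_nonneg hδ.le (kn_nonneg k)) N
  rw [div_le_iff₀ (by positivity)] at h3
  refine h2.trans ?_
  calc Λ * kn k ^ N = Λ / δ ^ N * (δ * kn k) ^ N := by rw [mul_pow]; field_simp
    _ ≤ Λ / δ ^ N * (exp (δ * kn k) * N.factorial) := by gcongr
    _ = _ := by ring

open Classical in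
lemma solve_core [CompleteSpace V] {ω : E m} {Λ : ℝ} {N : ℕ} (hω : Dio ω Λ N)
    {I : Type} {a : I → V} {k : I → Fin m → ℤ} {φ : I → ℝ} {S : ℝ}
    {ρ δ : ℝ} (hδ : 0 < δ) (hρ : δ < ρ) {g : E m → V}
    (h1 : HasSum (fun i => ‖a i‖ * exp (ρ * kn (k i))) S)
    (h3 : ∀ x, HasSum (fun i => cos (kd (k i) x + φ i) • a i) (g x)) :
    ∃ (a' : I → V) (S' c0 : _) (G : E m → V), (∀ i, k i = 0 → a' i = 0) ∧
      HasSum (fun i => ‖a' i‖ * exp ((ρ - δ) * kn (k i))) S' ∧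
      S' ≤ Λ * N.factorial / δ ^ N * S ∧
      (∀ x, HasSum (fun i => cos (kd (k i) x + (φ i - π / 2)) • a' i) (G x)) ∧
      HasSum (fun i => if k i = 0 then cos (φ i) • a i else 0) c0 ∧
      ∀ x, HasFDerivAt G (fderiv ℝ G x) x ∧ fderiv ℝ G x ω = g x - c0 := by
  have hΛ := hω.1
  set a' : I → V := fun i => if k i = 0 then 0 else (kd (k i) ω)⁻¹ • a i with ha'
  have hle : ∀ i, ‖a' i‖ * exp ((ρ - δ) * kn (k i)) ≤
      Λ * N.factorial / δ ^ N * (‖a i‖ * exp (ρ * kn (k i))) := by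
    intro i
    by_cases hi : k i = 0
    · simp only [ha', hi, if_true, norm_zero, zero_mul]; positivity
    · simp only [ha', hi, if_false, norm_smul, norm_inv, Real.norm_eq_abs]
      calc _ ≤ (Λ * N.factorial / δ ^ N * exp (δ * kn (k i))) * ‖a i‖ * exp ((ρ - δ) * kn (k i)) := by
            gcongr; exact hω.inv_le hi hδ
        _ = Λ * N.factorial / δ ^ N * (‖a i‖ * (exp (δ * kn (k i)) * exp ((ρ - δ) * kn (k i)))) := by
            ring
        _ = _ := by rw [← exp_add]; congr 3; ring_nf
  have hs : Summable fun i => ‖a' i‖ * exp ((ρ - δ) * kn (k i)) :=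
    Summable.of_nonneg_of_le (fun i => by positivity) hle (h1.mul_left _).summable
  have hsx : ∀ x, Summable fun i => cos (kd (k i) x + (φ i - π / 2)) • a' i := fun x => by
    refine Summable.of_norm_bounded hs fun i => ?_
    rw [norm_smul]
    have h4 : ‖cos (kd (k i) x + (φ i - π / 2))‖ ≤ 1 := abs_cos_le_one _
    have h5 : 1 ≤ exp ((ρ - δ) * kn (k i)) := one_le_exp (mul_nonneg (by linarith) (kn_nonneg _))
    have := norm_nonneg (a' i)
    nlinarith
  have hc : Summable fun i => if k i = 0 then cos (φ i) • a i else 0 := by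
    refine Summable.of_norm_bounded h1.summable fun i => ?_
    by_cases hi : k i = 0
    · simp only [hi, if_true, norm_smul]
      have h4 : ‖cos (φ i)‖ ≤ 1 := abs_cos_le_one _
      have : kn (0 : Fin m → ℤ) = 0 := by simp [kn]
      rw [this]
      have := norm_nonneg (a i)
      norm_num
      nlinarith [h4, Real.norm_eq_abs (cos (φ i))]
    · simp only [hi, if_false, norm_zero]; positivity
  refine ⟨a', _, _, fun x => ∑' i, cos (kd (k i) x + (φ i - π / 2)) • a' i,
    fun i hi => by simp [ha', hi], hs.hasSum, hasSum_le hle hs.hasSum (h1.mul_left _),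
    fun x => (hsx x).hasSum, hc.hasSum, fun x => ?_⟩
  obtain ⟨L, hL, hL2⟩ := atoms_hasFDerivAt (by linarith : 0 < ρ - δ) hs (fun x => (hsx x).hasSum) x
  rw [hL.fderiv]
  refine ⟨hL, (hL2 ω).unique ?_⟩
  convert! (h3 x).sub hc.hasSum using 2 with i
  by_cases hi : k i = 0
  · have : kd (0 : Fin m → ℤ) = 0 := by simp [kd]
    simp [ha', hi, this]
  · have hpos : kd (k i) ω ≠ 0 := by
      intro h; have := hω.2 _ hi; rw [h] at this; norm_num at this
    simp only [ha', hi, if_false, sub_zero, smul_smul]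
    rw [mul_assoc, mul_inv_cancel₀ hpos, mul_one]
    congr 2; ring

def IsMean (ω : E m) (g : E m → V) (c : V) : Prop :=
  ∃ G : E m → V, Differentiable ℝ G ∧ (∃ B, ∀ x, ‖G x‖ ≤ B) ∧ ∀ x, fderiv ℝ G x ω = g x - c

lemma orbit_deriv {G : E m → V} (hG : Differentiable ℝ G) (x ω : E m) (t : ℝ) :
    HasDerivAt (fun t : ℝ => G (x + t • ω)) (fderiv ℝ G (x + t • ω) ω) t := by
  have h2 : HasDerivAt (fun t : ℝ => x + t • ω) ω t := by
    simpa using ((hasDerivAt_id t).smul_const ω).const_add x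
  exact (hG (x + t • ω)).hasFDerivAt.comp_hasDerivAt t h2

lemma orbit_bound {G : E m → V} (hG : Differentiable ℝ G) {B : ℝ} (hB : ∀ x, ‖G x‖ ≤ B)
    {ω x : E m} {g : ℝ → V} {c : V} {μ : ℝ}
    (h : ∀ t, fderiv ℝ G (x + t • ω) ω = g t - c) (hg : ∀ t, ‖g t‖ ≤ μ) : ‖c‖ ≤ μ := by
  have hd : ∀ t : ℝ, HasDerivAt (fun t : ℝ => G (x + t • ω) + t • c) (g t) t := fun t => by
    have := (orbit_deriv hG x ω t).add ((hasDerivAt_id t).smul_const c)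
    rw [h] at this
    have e : g t = g t - c + (1 : ℝ) • c := by simp
    rw [e]
    exact this
  have key : ∀ t : ℝ, 0 < t → t * ‖c‖ ≤ t * μ + 2 * B := by
    intro t ht
    have h1 := norm_image_sub_le_of_norm_deriv_le_segment' (f := fun t : ℝ => G (x + t • ω) + t • c)
      (f' := g) (a := 0) (b := t) (C := μ) (fun s _ => (hd s).hasDerivWithinAt) (fun s _ => hg s) t
      ⟨ht.le, le_rfl⟩
    simp only [zero_smul, add_zero, sub_zero] at h1
    have h2 : ‖t • c‖ ≤ ‖G (x + t • ω) + t • c - G x‖ + ‖G (x + t • ω)‖ + ‖G x‖ := by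
      calc ‖t • c‖ = ‖(G (x + t • ω) + t • c - G x) - G (x + t • ω) + G x‖ := by congr 1; abel
        _ ≤ _ := (norm_add_le _ _).trans (by gcongr; exact norm_sub_le _ _)
    rw [norm_smul, Real.norm_eq_abs, abs_of_pos ht] at h2
    linarith [hB (x + t • ω), hB x]
  by_contra hlt
  push Not at hlt
  have hd : 0 < ‖c‖ - μ := by linarith
  have hB0 : 0 ≤ B := (norm_nonneg _).trans (hB x)
  have := key ((2 * B + 1) / (‖c‖ - μ)) (by positivity)
  have h2 : (2 * B + 1) / (‖c‖ - μ) * (‖c‖ - μ) = 2 * B + 1 := div_mul_cancel₀ _ hd.ne'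
  nlinarith

lemma IsMean.norm_le {ω : E m} {g : E m → V} {c : V} {μ : ℝ} (h : IsMean ω g c)
    (hg : ∀ x, ‖g x‖ ≤ μ) : ‖c‖ ≤ μ := by
  obtain ⟨G, h1, ⟨B, h2⟩, h3⟩ := h
  exact orbit_bound (x := 0) (g := fun t : ℝ => g (0 + t • ω)) h1 h2 (fun t => h3 _) (fun t => hg _)

lemma IsMean.add {ω : E m} {f g : E m → V} {c d : V} (h : IsMean ω f c) (h' : IsMean ω g d) :
    IsMean ω (fun x => f x + g x) (c + d) := by
  obtain ⟨G, h1, ⟨B, h2⟩, h3⟩ := h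
  obtain ⟨G', h1', ⟨B', h2'⟩, h3'⟩ := h'
  refine ⟨fun x => G x + G' x, h1.add h1', ⟨B + B', fun x => (norm_add_le _ _).trans (add_le_add (h2 x) (h2' x))⟩, ?_⟩
  intro x
  rw [fderiv_fun_add (h1 x) (h1' x), add_apply, h3, h3']; exact (add_sub_add_comm _ _ _ _).symm

lemma IsMean.clm {ω : E m} {f : E m → V} {c : V} (h : IsMean ω f c) (L : V →L[ℝ] V₁) :
    IsMean ω (fun x => L (f x)) (L c) := by
  obtain ⟨G, h1, ⟨B, h2⟩, h3⟩ := h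
  refine ⟨fun x => L (G x), L.differentiable.comp h1, ⟨‖L‖ * B, fun x => (L.le_opNorm _).trans (by gcongr; exact h2 x)⟩, ?_⟩
  intro x
  have : HasFDerivAt (fun x => L (G x)) (L.comp (fderiv ℝ G x)) x :=
    L.hasFDerivAt.comp x (h1 x).hasFDerivAt
  rw [this.fderiv, ContinuousLinearMap.comp_apply, h3, map_sub]

lemma IsMean.neg {ω : E m} {f : E m → V} {c : V} (h : IsMean ω f c) :
    IsMean ω (fun x => -f x) (-c) := by
  simpa using h.clm (-(ContinuousLinearMap.id ℝ V))

lemma IsMean.sub {ω : E m} {f g : E m → V} {c d : V} (h : IsMean ω f c) (h' : IsMean ω g d) :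
    IsMean ω (fun x => f x - g x) (c - d) := by
  simpa [sub_eq_add_neg] using h.add h'.neg

lemma IsMean.unique {ω : E m} {g : E m → V} {c d : V} (h : IsMean ω g c) (h' : IsMean ω g d) :
    c = d := by
  have := (h.sub h').norm_le (μ := 0) (fun x => by simp)
  rwa [norm_le_zero_iff, sub_eq_zero] at this

lemma IsMean.const (ω : E m) (c : V) : IsMean ω (fun _ => c) c :=
  ⟨fun _ => 0, differentiable_const _, ⟨0, by simp⟩, by simp⟩

lemma isMean_D {ω : E m} {F : E m → V} (h : Differentiable ℝ F) {B : ℝ} (hB : ∀ x, ‖F x‖ ≤ B) :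
    IsMean ω (fun x => fderiv ℝ F x ω) 0 := ⟨F, h, ⟨B, hB⟩, by simp⟩

lemma eq_zero_of_D {ω : E m} {A : E m → V} (h : Differentiable ℝ A) (hD : ∀ x, fderiv ℝ A x ω = 0)
    (hA : IsMean ω A 0) (x : E m) : A x = 0 := by
  obtain ⟨G, h1, ⟨B, h2⟩, h3⟩ := hA
  have hc : ∀ t : ℝ, A (x + t • ω) = A x := by
    intro t
    have := is_const_of_deriv_eq_zero (f := fun t : ℝ => A (x + t • ω))
      (fun t => (orbit_deriv h x ω t).differentiableAt)
      (fun t => by rw [(orbit_deriv h x ω t).deriv, hD]) t 0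
    simpa using this
  have := orbit_bound (x := x) (ω := ω) (g := fun _ : ℝ => (0 : V)) (c := -A x) (μ := 0) h1 h2
    (fun t => by rw [h3, hc]; simp) (by simp)
  simpa using this

lemma W.solve [CompleteSpace V] {ω : E m} {Λ : ℝ} {N : ℕ} (hω : Dio ω Λ N) {ρ δ μ : ℝ}
    (hδ : 0 < δ) (hρ : δ < ρ) {g : E m → V} (h : W ρ μ g) :
    ∃ c : V, ∃ G : E m → V, W (ρ - δ) (Λ * N.factorial / δ ^ N * μ) G ∧ IsMean ω g c ∧
      ‖c‖ ≤ μ ∧ IsMean ω G 0 ∧ ∀ x, fderiv ℝ G x ω = g x - c := by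
  have hb := h.norm_le (by linarith : 0 ≤ ρ)
  obtain ⟨I, a, k, φ, S, h1, h2, h3⟩ := h
  have hΛ := hω.1
  obtain ⟨a', S', c0, G, k1, k2, k3, k4, k5, k6⟩ := solve_core hω hδ hρ h1 h3
  have hG : W (ρ - δ) (Λ * N.factorial / δ ^ N * μ) G :=
    ⟨I, a', k, fun i => φ i - π / 2, S', k2, k3.trans (by gcongr), k4⟩
  have hm : IsMean ω g c0 := ⟨G, fun x => (k6 x).1.differentiableAt,
    ⟨_, hG.norm_le (by linarith)⟩, fun x => (k6 x).2⟩
  refine ⟨c0, G, hG, hm, hm.norm_le hb, ?_, fun x => (k6 x).2⟩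
  have hd2 : 0 < (ρ - δ) / 2 := by linarith
  obtain ⟨a2, S2, c2, G2, l1, l2, l3, l4, l5, l6⟩ := solve_core hω hd2 (by linarith) k2 k4
  have hc2 : c2 = 0 := by
    refine l5.unique ?_
    convert! hasSum_zero using 2 with i
    by_cases hi : k i = 0
    · simp [hi, k1 i hi]
    · simp [hi]
  have hG2 : W (ρ - δ - (ρ - δ) / 2) S2 G2 := ⟨I, a2, k, _, S2, l2, le_rfl, l4⟩
  refine ⟨G2, fun x => (l6 x).1.differentiableAt, ⟨_, hG2.norm_le (by linarith)⟩, fun x => ?_⟩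
  rw [(l6 x).2, hc2]

/-- Mean zero functions: a version giving only the primitive. -/
lemma W.solve0 [CompleteSpace V] {ω : E m} {Λ : ℝ} {N : ℕ} (hω : Dio ω Λ N) {ρ δ μ : ℝ}
    (hδ : 0 < δ) (hρ : δ < ρ) {g : E m → V} (h : W ρ μ g) (h0 : IsMean ω g 0) :
    ∃ G : E m → V, W (ρ - δ) (Λ * N.factorial / δ ^ N * μ) G ∧ IsMean ω G 0 ∧
      ∀ x, fderiv ℝ G x ω = g x := by
  obtain ⟨c, G, h1, h2, h3, h4, h5⟩ := h.solve hω hδ hρ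
  have := h2.unique h0
  subst this
  exact ⟨G, h1, h4, by simpa using h5⟩

/-- A priori bound for a mean zero function through its `D` derivative. -/
lemma W.of_D [CompleteSpace V] {ω : E m} {Λ : ℝ} {N : ℕ} (hω : Dio ω Λ N) {ρ δ μ : ℝ}
    (hδ : 0 < δ) (hρ : δ < ρ) {A B : E m → V} {ρ' μ' : ℝ} (hρ' : 0 < ρ') (hA : W ρ' μ' A)
    (hA0 : IsMean ω A 0) (hD : ∀ x, fderiv ℝ A x ω = B x) (hB : W ρ μ B) :
    W (ρ - δ) (Λ * N.factorial / δ ^ N * μ) A := by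
  have hAd := hA.differentiable hρ'
  have hB0 : IsMean ω B 0 := by
    have := isMean_D (ω := ω) hAd (hA.norm_le hρ'.le)
    simpa only [hD] using this
  obtain ⟨G, h1, h2, h3⟩ := hB.solve0 hω hδ hρ hB0
  have hGd := h1.differentiable (by linarith)
  have : A = G := by
    funext x
    have h4 : IsMean ω (fun x => A x - G x) 0 := by simpa using hA0.sub h2
    have := eq_zero_of_D (A := fun x => A x - G x) (ω := ω) (hAd.sub hGd) (fun y => by
      rw [fderiv_fun_sub (hAd y) (hGd y), sub_apply, hD, h3, sub_self]) h4 x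
    exact sub_eq_zero.1 this
  rw [this]; exact h1

lemma fderiv_comm {G : E m → V} (hG : ContDiff ℝ 2 G) (x e e' : E m) :
    fderiv ℝ (fun y => fderiv ℝ G y e) x e' = fderiv ℝ (fun y => fderiv ℝ G y e') x e := by
  have hd : DifferentiableAt ℝ (fderiv ℝ G) x :=
    ((hG.fderiv_right (m := 1) (by norm_num)).differentiable (by norm_num)) x
  have hs := (hG.contDiffAt (x := x)).isSymmSndFDerivAt (by simp)
  have k : ∀ v : E m, fderiv ℝ (fun y => fderiv ℝ G y v) x = (fderiv ℝ (fderiv ℝ G) x).flip v := by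
    intro v
    have := hd.hasFDerivAt.clm_apply (hasFDerivAt_const v x)
    refine this.fderiv.trans (ContinuousLinearMap.ext fun w => ?_)
    simp
  rw [k, k]
  exact hs e' e

lemma isMean_fderiv [CompleteSpace V] {ω : E m} {Λ : ℝ} {N : ℕ} (hω : Dio ω Λ N) {ρ μ : ℝ}
    (hρ : 0 < ρ) {Ψ : E m → V} (h : W ρ μ Ψ) (e : E m) : IsMean ω (fun x => fderiv ℝ Ψ x e) 0 := by
  obtain ⟨c, G, h1, h2, h3, h4, h5⟩ := h.solve hω (half_pos hρ) (by linarith)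
  have hG := h1.contDiff (by linarith)
  have h6 := h1.fderivW (δ := ρ / 4) (by linarith) (by linarith)
  have h7 := h6.clm (ContinuousLinearMap.apply ℝ V e)
  refine ⟨fun x => fderiv ℝ G x e, h7.differentiable (by linarith), ⟨_, h7.norm_le (by linarith)⟩, fun x => ?_⟩
  rw [fderiv_comm (contDiff_infty.1 hG 2) x e ω]
  simp only [h5, fderiv_sub_const, sub_zero]

end W3
end KAM
end PartC

section PartD
open Real
open scoped InnerProductSpace
namespace KAM
section alg
variable {m : ℕ}

abbrev Ph (m : ℕ) := E m × E m

/-- The adjoint as a real continuous linear map. -/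
noncomputable def adjL (m : ℕ) : (E m →L[ℝ] E m) →L[ℝ] (E m →L[ℝ] E m) :=
  LinearMap.mkContinuous
    { toFun := fun A => ContinuousLinearMap.adjoint A
      map_add' := fun A B => map_add _ A B
      map_smul' := fun c A => by
        refine ContinuousLinearMap.ext fun x => ext_inner_left ℝ fun y => ?_
        simp [ContinuousLinearMap.adjoint_inner_right, inner_smul_left, inner_smul_right] } 1
    (fun A => by
      show ‖ContinuousLinearMap.adjoint A‖ ≤ 1 * ‖A‖
      rw [one_mul]
      exact (LinearIsometryEquiv.norm_map ContinuousLinearMap.adjoint A).le)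

lemma adjL_inner (A : E m →L[ℝ] E m) (x y : E m) : ⟪x, adjL m A y⟫_ℝ = ⟪A x, y⟫_ℝ :=
  ContinuousLinearMap.adjoint_inner_right A x y

lemma norm_adjL_le : ‖adjL m‖ ≤ 1 := LinearMap.mkContinuous_norm_le _ zero_le_one _

lemma W.adj {ρ M : ℝ} {f : E m → (E m →L[ℝ] E m)} (h : W ρ M f) : W ρ M (fun x => adjL m (f x)) := by
  simpa using h.clm_le (adjL m) norm_adjL_le

/-- Pointwise algebra of the Newton step, first component. -/
lemma alg1 {U P E1' DU : E m →L[ℝ] E m} {Yy' : Ph m →L[ℝ] E m} {E1v w dw z : E m}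
    (h1 : ∀ e, DU e = E1' e + Yy' (U e, P e)) (h3 : U dw = Yy' (0, z) - E1v) :
    E1v + (DU w + U dw) - Yy' (U w, P w + z) = E1' w := by
  have : ((U w, P w + z) : Ph m) = (U w, P w) + (0, z) := by simp
  rw [this, map_add, h1, h3]; abel

lemma alg2 {U V P E1' E2' DU DP : E m →L[ℝ] E m} {Yx' Yy' : Ph m →L[ℝ] E m}
    {E1v E2v w dw z dz : E m} (hUV : U * V = 1) (hVU : V * U = 1)
    (hs : ∀ a b : Ph m, ⟪Yx' a, b.1⟫_ℝ + ⟪Yy' a, b.2⟫_ℝ = ⟪Yx' b, a.1⟫_ℝ + ⟪Yy' b, a.2⟫_ℝ)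
    (h1 : ∀ e, DU e = E1' e + Yy' (U e, P e)) (h2 : ∀ e, DP e = E2' e - Yx' (U e, P e))
    (h3 : U dw = Yy' (0, z) - E1v)
    (h4 : ∀ e, ⟪DU e, z⟫_ℝ + ⟪U e, dz⟫_ℝ = -⟪U e, E2v⟫_ℝ + ⟪P e, E1v⟫_ℝ) :
    E2v + (DP w + P dw + dz) + Yx' (U w, P w + z) =
      E2' w + adjL m V ((adjL m U (P dw) - adjL m P (U dw)) - adjL m E1' z) := by
  have hUV' : ∀ x, U (V x) = x := fun x => by
    have := congrArg (fun T : E m →L[ℝ] E m => T x) hUV; simpa using this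
  have hVU' : ∀ x, V (U x) = x := fun x => by
    have := congrArg (fun T : E m →L[ℝ] E m => T x) hVU; simpa using this
  refine ext_inner_left ℝ fun x => ?_
  rw [← hUV' x]
  generalize V x = e
  have h5 : ((U w, P w + z) : Ph m) = (U w, P w) + (0, z) := by simp
  rw [h5, map_add, h2]
  simp only [inner_add_right, inner_sub_right, adjL_inner, hVU']
  have h4' := h4 e
  rw [h1, inner_add_left] at h4'
  have h6 := hs (U e, P e) (0, z)
  simp only [inner_zero_right, zero_add] at h6
  have h7 : ⟪P e, U dw⟫_ℝ = ⟪P e, Yy' (0, z)⟫_ℝ - ⟪P e, E1v⟫_ℝ := by rw [h3, inner_sub_right]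
  rw [h7]
  have h8 := real_inner_comm (U e) (Yx' (0, z))
  have h9 := real_inner_comm (P e) (Yy' (0, z))
  linarith

lemma algA {U P E1' E2' DU DP : E m →L[ℝ] E m} {Yx' Yy' : Ph m →L[ℝ] E m}
    (hs : ∀ a b : Ph m, ⟪Yx' a, b.1⟫_ℝ + ⟪Yy' a, b.2⟫_ℝ = ⟪Yx' b, a.1⟫_ℝ + ⟪Yy' b, a.2⟫_ℝ)
    (h1 : ∀ e, DU e = E1' e + Yy' (U e, P e)) (h2 : ∀ e, DP e = E2' e - Yx' (U e, P e)) (e e' : E m) :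
    ⟪DU e, P e'⟫_ℝ + ⟪U e, DP e'⟫_ℝ - (⟪DP e, U e'⟫_ℝ + ⟪P e, DU e'⟫_ℝ) =
    ⟪E1' e, P e'⟫_ℝ + ⟪U e, E2' e'⟫_ℝ - (⟪E2' e, U e'⟫_ℝ + ⟪P e, E1' e'⟫_ℝ) := by
  simp only [h1, h2, inner_add_left, inner_add_right, inner_sub_left, inner_sub_right]
  have := hs (U e, P e) (U e', P e')
  simp only at this
  have h8 := real_inner_comm (U e) (Yx' (U e', P e'))
  have h9 := real_inner_comm (P e) (Yy' (U e', P e'))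
  linarith

end alg
end KAM
end PartD

section PartE
open Real
open scoped InnerProductSpace
namespace KAM
section step
variable {m : ℕ} {V : Type*} [NormedAddCommGroup V] [NormedSpace ℝ V]

/-- Composition estimates near the torus `{y = y0}`. -/
def CompG (G : Ph m → V) (y0 : E m) (ρ0 C a0 : ℝ) : Prop :=
  ∀ (ρ a d : ℝ) (X Δ : E m → Ph m), 0 < ρ → ρ ≤ ρ0 → W ρ a X → W ρ d Δ → a ≤ a0 → d ≤ a0 →
    W ρ C (fun θ => G ((θ, y0) + X θ)) ∧
    W ρ (C * d) (fun θ => G ((θ, y0) + X θ + Δ θ) - G ((θ, y0) + X θ)) ∧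
    W ρ (C * d ^ 2) (fun θ => G ((θ, y0) + X θ + Δ θ) - G ((θ, y0) + X θ) -
      fderiv ℝ G ((θ, y0) + X θ) (Δ θ))

structure Sys (H : Ph m → ℝ) (Yx Yy : Ph m → E m) (y0 : E m) (ρ0 C a0 : ℝ) : Prop where
  hC : 0 ≤ C
  hH : ∀ p : Ph m, ‖p.2 - y0‖ ≤ a0 → DifferentiableAt ℝ H p
  hH' : ∀ p : Ph m, ‖p.2 - y0‖ ≤ a0 → ∀ v : Ph m, fderiv ℝ H p v = ⟪Yx p, v.1⟫_ℝ + ⟪Yy p, v.2⟫_ℝ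
  hYx : ∀ p : Ph m, ‖p.2 - y0‖ ≤ a0 → DifferentiableAt ℝ Yx p
  hYy : ∀ p : Ph m, ‖p.2 - y0‖ ≤ a0 → DifferentiableAt ℝ Yy p
  hsym : ∀ p : Ph m, ‖p.2 - y0‖ ≤ a0 → ∀ a b : Ph m,
    ⟪fderiv ℝ Yx p a, b.1⟫_ℝ + ⟪fderiv ℝ Yy p a, b.2⟫_ℝ =
      ⟪fderiv ℝ Yx p b, a.1⟫_ℝ + ⟪fderiv ℝ Yy p b, a.2⟫_ℝ
  cH : CompG H y0 ρ0 C a0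
  cYx : CompG Yx y0 ρ0 C a0
  cYy : CompG Yy y0 ρ0 C a0
  cYyy : CompG (fun p => (fderiv ℝ Yy p).comp (ContinuousLinearMap.inr ℝ (E m) (E m))) y0 ρ0 C a0

/-- Error of the first invariance equation. -/
noncomputable def Er1 (ω : E m) (Yy : Ph m → E m) (u p : E m → E m) (θ : E m) : E m :=
  ω + fderiv ℝ u θ ω - Yy (θ + u θ, p θ)

/-- Error of the second invariance equation. -/
noncomputable def Er2 (ω : E m) (Yx : Ph m → E m) (u p : E m → E m) (θ : E m) : E m :=
  fderiv ℝ p θ ω + Yx (θ + u θ, p θ)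

structure Inv (ω y0 : E m) (Yx Yy : Ph m → E m) (ρ κ μ : ℝ) (u p : E m → E m) : Prop where
  wu : W ρ κ u
  wp : W ρ κ (fun θ => p θ - y0)
  wu' : W ρ κ (fderiv ℝ u)
  wp' : W ρ κ (fderiv ℝ p)
  w1 : W ρ μ (Er1 ω Yy u p)
  w2 : W ρ μ (Er2 ω Yx u p)

/-- Pointwise differential identities. -/
lemma geom {H : Ph m → ℝ} {Yx Yy : Ph m → E m} {ω y0 : E m} {ρ0 C a0 : ℝ}
    (S : Sys H Yx Yy y0 ρ0 C a0) {u p : E m → E m} (hu : ContDiff ℝ 2 u) (hp : ContDiff ℝ 2 p)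
    (hK : ∀ θ, ‖p θ - y0‖ ≤ a0) (θ : E m) :
    (∀ e, fderiv ℝ (fderiv ℝ u) θ ω e = fderiv ℝ (Er1 ω Yy u p) θ e +
      fderiv ℝ Yy (θ + u θ, p θ) (e + fderiv ℝ u θ e, fderiv ℝ p θ e)) ∧
    (∀ e, fderiv ℝ (fderiv ℝ p) θ ω e = fderiv ℝ (Er2 ω Yx u p) θ e -
      fderiv ℝ Yx (θ + u θ, p θ) (e + fderiv ℝ u θ e, fderiv ℝ p θ e)) ∧
    (∀ e, fderiv ℝ (fun θ => H (θ + u θ, p θ)) θ e =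
      ⟪Yx (θ + u θ, p θ), e + fderiv ℝ u θ e⟫_ℝ + ⟪Yy (θ + u θ, p θ), fderiv ℝ p θ e⟫_ℝ) := by
  have du : HasFDerivAt u (fderiv ℝ u θ) θ := (hu.differentiable (by norm_num) θ).hasFDerivAt
  have dp : HasFDerivAt p (fderiv ℝ p θ) θ := (hp.differentiable (by norm_num) θ).hasFDerivAt
  have du2 : HasFDerivAt (fderiv ℝ u) (fderiv ℝ (fderiv ℝ u) θ) θ :=
    ((hu.fderiv_right (m := 1) (by norm_num)).differentiable (by norm_num) θ).hasFDerivAt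
  have dp2 : HasFDerivAt (fderiv ℝ p) (fderiv ℝ (fderiv ℝ p) θ) θ :=
    ((hp.fderiv_right (m := 1) (by norm_num)).differentiable (by norm_num) θ).hasFDerivAt
  have su := (hu.contDiffAt (x := θ)).isSymmSndFDerivAt (by simp)
  have sp := (hp.contDiffAt (x := θ)).isSymmSndFDerivAt (by simp)
  have dK : HasFDerivAt (fun θ : E m => ((θ + u θ, p θ) : Ph m))
      ((ContinuousLinearMap.id ℝ (E m) + fderiv ℝ u θ).prod (fderiv ℝ p θ)) θ :=
    ((hasFDerivAt_id θ).add du).prodMk dp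
  have k1 := hK θ
  refine ⟨fun e => ?_, fun e => ?_, fun e => ?_⟩
  · have h1 := (du2.clm_apply (hasFDerivAt_const ω θ)).const_add ω
    have h2 := h1.sub ((S.hYy (θ + u θ, p θ) k1).hasFDerivAt.comp θ dK)
    have h3 : fderiv ℝ (Er1 ω Yy u p) θ = _ := HasFDerivAt.fderiv h2
    rw [h3, su ω e]
    simp
  · have h1 := (dp2.clm_apply (hasFDerivAt_const ω θ))
    have h2 := h1.add ((S.hYx (θ + u θ, p θ) k1).hasFDerivAt.comp θ dK)
    have h3 : fderiv ℝ (Er2 ω Yx u p) θ = _ := HasFDerivAt.fderiv h2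
    rw [h3, sp ω e]
    simp
  · have h2 : HasFDerivAt (fun θ => H (θ + u θ, p θ)) _ θ :=
      (S.hH (θ + u θ, p θ) k1).hasFDerivAt.comp θ dK
    rw [h2.fderiv, ContinuousLinearMap.comp_apply, S.hH' (θ + u θ, p θ) k1]
    simp

lemma fderiv_inner_app {F G : E m → (E m →L[ℝ] E m)} {θ : E m} (hF : DifferentiableAt ℝ F θ)
    (hG : DifferentiableAt ℝ G θ) (e e' a : E m) :
    fderiv ℝ (fun θ => ⟪F θ e, G θ e'⟫_ℝ) θ a = ⟪fderiv ℝ F θ a e, G θ e'⟫_ℝ + ⟪F θ e, fderiv ℝ G θ a e'⟫_ℝ := by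
  have h1 := (hF.hasFDerivAt.clm_apply (hasFDerivAt_const e θ))
  have h2 := (hG.hasFDerivAt.clm_apply (hasFDerivAt_const e' θ))
  have h3 := (h1.inner ℝ h2).fderiv
  rw [h3]
  simp [add_comm]

lemma fderiv_inner_app' {F : E m → (E m →L[ℝ] E m)} {G : E m → E m} {θ : E m} (hF : DifferentiableAt ℝ F θ)
    (hG : DifferentiableAt ℝ G θ) (e a : E m) :
    fderiv ℝ (fun θ => ⟪F θ e, G θ⟫_ℝ) θ a = ⟪fderiv ℝ F θ a e, G θ⟫_ℝ + ⟪F θ e, fderiv ℝ G θ a⟫_ℝ := by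
  have h1 := (hF.hasFDerivAt.clm_apply (hasFDerivAt_const e θ))
  have h3 := (h1.inner ℝ hG.hasFDerivAt).fderiv
  rw [h3]
  simp [add_comm]

lemma solve_lin {Q T : E m →L[ℝ] E m} {β η : ℝ} (hβ : 0 ≤ β) (hQ : ∀ x, ‖x‖ ≤ β * ‖Q x‖)
    (hT : ‖T - Q‖ ≤ η) (hs : β * η ≤ 1 / 2) (b : E m) : ∃ c, T c = b ∧ ‖c‖ ≤ 2 * β * ‖b‖ := by
  have key : ∀ x, ‖x‖ ≤ 2 * β * ‖T x‖ := by
    intro x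
    have h1 : ‖Q x‖ ≤ ‖T x‖ + η * ‖x‖ := by
      have : Q x = T x - (T - Q) x := by simp
      rw [this]
      exact (norm_sub_le _ _).trans (by gcongr; exact (T - Q).le_of_opNorm_le hT x)
    have h2 := hQ x
    have h3 : β * ‖Q x‖ ≤ β * (‖T x‖ + η * ‖x‖) := by gcongr
    have := norm_nonneg x
    nlinarith
  have hinj : Function.Injective (T : E m →ₗ[ℝ] E m) := by
    rw [← LinearMap.ker_eq_bot, LinearMap.ker_eq_bot']
    intro x hx
    have := key x
    have hx' : T x = 0 := hx
    rw [hx', norm_zero, mul_zero] at this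
    exact norm_le_zero_iff.1 this
  obtain ⟨c, hc⟩ := (LinearMap.injective_iff_surjective.1 hinj) b
  have hc' : T c = b := hc
  exact ⟨c, hc', hc' ▸ key c⟩

end step
end KAM
end PartE

section PartF
open Real
open scoped InnerProductSpace
namespace KAM
section newton
variable {m : ℕ}

lemma IsMean.of_inner {ω : E m} {R : E m → E m} {c : E m} (h : IsMean ω R c)
    (h' : ∀ e, IsMean ω (fun θ => ⟪e, R θ⟫_ℝ) 0) : c = 0 := by
  refine ext_inner_left ℝ fun e => ?_
  have := (h.clm (innerSL ℝ e)).unique (h' e)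
  simpa using this

lemma IsMean.of_inner₂ {ω : E m} {R : E m → (E m →L[ℝ] E m)} {c : E m →L[ℝ] E m} (h : IsMean ω R c)
    (h' : ∀ e e', IsMean ω (fun θ => ⟪e, R θ e'⟫_ℝ) 0) : c = 0 := by
  refine ContinuousLinearMap.ext fun e' => ?_
  exact (h.clm (ContinuousLinearMap.apply ℝ (E m) e')).of_inner fun e => h' e e'

lemma W.inner {ρ M N : ℝ} {f g : E m → E m} (hρ : 0 ≤ ρ) (hf : W ρ M f) (hg : W ρ N g) :
    W ρ (M * N) (fun x => ⟪f x, g x⟫_ℝ) := by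
  have := hf.bilin_le (c := 1) hρ hg (innerSL ℝ) (norm_innerSL_le ℝ)
  rw [one_mul] at this
  exact this

/-- Means of the two special quantities vanish. -/
lemma means {H : Ph m → ℝ} {Yx Yy : Ph m → E m} {ω y0 : E m} {ρ0 C a0 Λ : ℝ} {N : ℕ}
    (hω : Dio ω Λ N)
    (S : Sys H Yx Yy y0 ρ0 C a0) {u p : E m → E m} {ρ κ μ : ℝ} (hρ : 0 < ρ) (hρ0 : ρ ≤ ρ0)
    (hκa : 2 * κ ≤ a0)
    (I : Inv ω y0 Yx Yy ρ κ μ u p) {U : E m → (E m →L[ℝ] E m)} (hU : ∀ θ, U θ = 1 + fderiv ℝ u θ) :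
    (∀ e, IsMean ω (fun θ => -⟪U θ e, Er2 ω Yx u p θ⟫_ℝ + ⟪fderiv ℝ p θ e, Er1 ω Yy u p θ⟫_ℝ) 0) ∧
    (∀ e e', IsMean ω (fun θ => ⟪U θ e, fderiv ℝ p θ e'⟫_ℝ - ⟪fderiv ℝ p θ e, U θ e'⟫_ℝ) 0) := by
  have hκ0 := I.wu.nonneg
  have hu := contDiff_infty.1 (I.wu.contDiff hρ) 2
  have wpp : W ρ (κ + ‖y0‖) p := by
    simpa using I.wp.add hρ.le (W.const ρ y0)
  have hp := contDiff_infty.1 (wpp.contDiff hρ) 2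
  have hK : ∀ θ, ‖p θ - y0‖ ≤ a0 := fun θ => (I.wp.norm_le hρ.le θ).trans (by linarith)
  have G := geom (ω := ω) S hu hp hK
  have wU : W ρ (‖(1 : E m →L[ℝ] E m)‖ + κ) U := by
    have := (W.const ρ (1 : E m →L[ℝ] E m)).add hρ.le I.wu'
    rw [show U = fun θ => 1 + fderiv ℝ u θ from funext hU]; exact this
  have dU : Differentiable ℝ U := wU.differentiable hρ
  have dp : Differentiable ℝ p := wpp.differentiable hρ
  have dUf : ∀ θ, fderiv ℝ U θ = fderiv ℝ (fderiv ℝ u) θ := fun θ => by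
    rw [show U = fun θ => 1 + fderiv ℝ u θ from funext hU, fderiv_const_add]
  have su := fun θ => (hu.contDiffAt (x := θ)).isSymmSndFDerivAt (by simp)
  have hF : ∀ e a θ, fderiv ℝ (fun θ => ⟪U θ e, p θ⟫_ℝ) θ a =
      ⟪fderiv ℝ (fderiv ℝ u) θ a e, p θ⟫_ℝ + ⟪U θ e, fderiv ℝ p θ a⟫_ℝ := fun e a θ => by
    rw [fderiv_inner_app' (dU θ) (dp θ), dUf]
  have wF : ∀ e, W ρ ((‖ContinuousLinearMap.apply ℝ (E m) e‖ * (‖(1 : E m →L[ℝ] E m)‖ + κ)) * (κ + ‖y0‖))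
      (fun θ => ⟪U θ e, p θ⟫_ℝ) := fun e =>
    (wU.clm (ContinuousLinearMap.apply ℝ (E m) e)).inner hρ.le wpp
  have mF : ∀ e a, IsMean ω (fun θ => fderiv ℝ (fun θ => ⟪U θ e, p θ⟫_ℝ) θ a) 0 := fun e a =>
    isMean_fderiv hω hρ (wF e) a
  have wX : W ρ (κ + κ) (fun θ => (u θ, p θ - y0)) := I.wu.prodMk hρ.le I.wp
  have wH : W ρ C (fun θ => H (θ + u θ, p θ)) := by
    have := (S.cH ρ (κ + κ) 0 _ _ hρ hρ0 wX (W.zero ρ) (by linarith) (by linarith)).1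
    simpa using this
  have mH : ∀ e, IsMean ω (fun θ => fderiv ℝ (fun θ => H (θ + u θ, p θ)) θ e) 0 := fun e =>
    isMean_fderiv hω hρ wH e
  constructor
  · intro e
    have h := ((mF e ω).neg.add (mF ω e)).sub (mH e)
    simp only [neg_zero, add_zero, sub_zero] at h
    convert! h using 2 with θ
    rw [hF, hF, (G θ).2.2 e, su θ e ω]
    have e1 : Er1 ω Yy u p θ = U θ ω - Yy (θ + u θ, p θ) := by simp [Er1, hU]
    have e2 : Er2 ω Yx u p θ = fderiv ℝ p θ ω + Yx (θ + u θ, p θ) := rfl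
    have e3 : e + fderiv ℝ u θ e = U θ e := by simp [hU]
    rw [e1, e2, e3, inner_add_right, inner_sub_right]
    have h8 := real_inner_comm (U θ e) (Yx (θ + u θ, p θ))
    have h9 := real_inner_comm (fderiv ℝ p θ e) (Yy (θ + u θ, p θ))
    have h10 := real_inner_comm (fderiv ℝ p θ e) (U θ ω)
    linarith
  · intro e e'
    have h := (mF e e').sub (mF e' e)
    simp only [sub_zero] at h
    convert! h using 2 with θ
    rw [hF, hF, su θ e e']
    have h10 := real_inner_comm (fderiv ℝ p θ e) (U θ e')
    linarith

end newton
end KAM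
end PartF

section PartG
open Real
open scoped InnerProductSpace
namespace KAM
section newton
variable {m : ℕ}

set_option maxHeartbeats 4000000 in
lemma newton {H : Ph m → ℝ} {Yx Yy : Ph m → E m} {ω y0 : E m} {ρ0 C a0 Λ : ℝ} {N : ℕ}
    (hω : Dio ω Λ N) (S : Sys H Yx Yy y0 ρ0 C a0) {Q : E m →L[ℝ] E m} {β : ℝ} (hβ : 0 ≤ β)
    (hQ : ∀ x, ‖x‖ ≤ β * ‖Q x‖) {u p : E m → E m} {ρ δ κ μ η B : ℝ} (hδ : 0 < δ) (hρ : 4 * δ ≤ ρ)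
    (hρ0 : ρ ≤ ρ0) (hκ : κ ≤ 1 / 4) (hκa : 2 * κ ≤ a0)
    (hη : ∀ θ, ‖(fderiv ℝ Yy (θ + u θ, p θ)).comp (ContinuousLinearMap.inr ℝ (E m) (E m)) - Q‖ ≤ η)
    (hsm : β * (6 * C * κ + η) ≤ 1 / 2)
    (I : Inv ω y0 Yx Yy ρ κ μ u p) (hB8 : 8 ≤ B) (hBs : Λ * N.factorial / δ ^ N ≤ B)
    (hBd : 2 * π / δ ≤ B) (hBC : C ≤ B) (hBβ : 2 * β ≤ B) (hsmall : B ^ 13 * μ ≤ a0) :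
    ∃ v q : E m → E m, W (ρ - 3 * δ) (B ^ 13 * μ) v ∧ W (ρ - 3 * δ) (B ^ 13 * μ) q ∧
      W (ρ - 3 * δ) (B ^ 13 * μ) (fderiv ℝ v) ∧ W (ρ - 3 * δ) (B ^ 13 * μ) (fderiv ℝ q) ∧
      W (ρ - 3 * δ) (B ^ 28 * μ ^ 2) (Er1 ω Yy (fun θ => u θ + v θ) (fun θ => p θ + q θ)) ∧
      W (ρ - 3 * δ) (B ^ 28 * μ ^ 2) (Er2 ω Yx (fun θ => u θ + v θ) (fun θ => p θ + q θ)) := by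
  have hρp : 0 < ρ := by linarith
  have hρn : 0 ≤ ρ := hρp.le
  have hκ0 := I.wu.nonneg
  have hμ0 := I.w1.nonneg
  have hC := S.hC
  have hB0 : 0 < B := by linarith
  have hB1 : 1 ≤ B := by linarith
  have bpow : ∀ i j : ℕ, i ≤ j → B ^ i ≤ B ^ j := fun i j h => pow_le_pow_right₀ hB1 h
  have hu := contDiff_infty.1 (I.wu.contDiff hρp) 2
  have wpp : W ρ (κ + ‖y0‖) p := by
    simpa using I.wp.add hρn (W.const ρ y0)
  have hp := contDiff_infty.1 (wpp.contDiff hρp) 2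
  have hK : ∀ θ, ‖p θ - y0‖ ≤ a0 := fun θ => (I.wp.norm_le hρn θ).trans (by linarith)
  have G := geom (ω := ω) S hu hp hK
  obtain ⟨U, hU⟩ : ∃ U : E m → (E m →L[ℝ] E m), ∀ θ, U θ = 1 + fderiv ℝ u θ := ⟨_, fun _ => rfl⟩
  obtain ⟨P, hP⟩ : ∃ P : E m → (E m →L[ℝ] E m), ∀ θ, P θ = fderiv ℝ p θ := ⟨_, fun _ => rfl⟩
  obtain ⟨e1, he1⟩ : ∃ e1 : E m → E m, e1 = Er1 ω Yy u p := ⟨_, rfl⟩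
  obtain ⟨e2, he2⟩ : ∃ e2 : E m → E m, e2 = Er2 ω Yx u p := ⟨_, rfl⟩
  have hUe : U = fun θ => 1 + fderiv ℝ u θ := funext hU
  have hPe : P = fderiv ℝ p := funext hP
  have wU : W ρ 2 U := by
    have := ((W.const ρ (1 : E m →L[ℝ] E m)).mono le_rfl ContinuousLinearMap.norm_id_le).add hρn I.wu'
    rw [hUe]; exact this.mono le_rfl (by linarith)
  have wP : W ρ 1 P := by rw [hPe]; exact I.wp'.mono le_rfl (by linarith)
  have we1 : W ρ μ e1 := he1 ▸ I.w1
  have we2 : W ρ μ e2 := he2 ▸ I.w2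
  obtain ⟨V, wV, wV1, hUV, hVU⟩ := W.neumann hρn I.wu' (by linarith : κ ≤ 1 / 2)
  simp only [← hU] at hUV hVU
  obtain ⟨meanR, meanA⟩ := means hω S hρp hρ0 hκa I hU
  simp only [← hP, ← he1, ← he2] at meanR meanA
  have dU : Differentiable ℝ U := wU.differentiable hρp
  have dP : Differentiable ℝ P := wP.differentiable hρp
  have dUf : ∀ θ, fderiv ℝ U θ = fderiv ℝ (fderiv ℝ u) θ := fun θ => by
    rw [hUe, fderiv_const_add]
  have dPf : ∀ θ, fderiv ℝ P θ = fderiv ℝ (fderiv ℝ p) θ := fun θ => by rw [hPe]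
  have G1 : ∀ θ e, fderiv ℝ U θ ω e = fderiv ℝ e1 θ e + fderiv ℝ Yy (θ + u θ, p θ) (U θ e, P θ e) := by
    intro θ e
    rw [dUf, (G θ).1 e, he1, hP, hU]; simp
  have G2 : ∀ θ e, fderiv ℝ P θ ω e = fderiv ℝ e2 θ e - fderiv ℝ Yx (θ + u θ, p θ) (U θ e, P θ e) := by
    intro θ e
    rw [dPf, (G θ).2.1 e, he2, hP, hU]; simp
  have hsym := fun θ => S.hsym (θ + u θ, p θ) (hK θ)
  -- the second derivative in y
  obtain ⟨h2, hh2⟩ : ∃ h2 : E m → (E m →L[ℝ] E m), ∀ θ, h2 θ =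
      (fderiv ℝ Yy (θ + u θ, p θ)).comp (ContinuousLinearMap.inr ℝ (E m) (E m)) := ⟨_, fun _ => rfl⟩
  have wX : W ρ (κ + κ) (fun θ => (u θ, p θ - y0)) := I.wu.prodMk hρn I.wp
  have wh2 : W ρ C h2 := by
    have := (S.cYyy ρ (κ + κ) 0 _ _ hρp hρ0 wX (W.zero ρ) (by linarith) (by linarith)).1
    rw [funext hh2]
    simpa using this
  simp only [← hh2] at hη
  have h2z : ∀ θ z, fderiv ℝ Yy (θ + u θ, p θ) (0, z) = h2 θ z := fun θ z => by simp [hh2]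
  -- R and g
  have wR : W ρ (B * μ) (fun θ => adjL m (P θ) (e1 θ) - adjL m (U θ) (e2 θ)) :=
    ((wP.adj.app hρn we1).sub hρn (wU.adj.app hρn we2)).mono le_rfl (by nlinarith)
  have mR : IsMean ω (fun θ => adjL m (P θ) (e1 θ) - adjL m (U θ) (e2 θ)) 0 := by
    obtain ⟨c, -, -, hc, -⟩ := wR.solve hω hδ (by linarith)
    have : c = 0 := hc.of_inner fun e => by
      convert! meanR e using 2 with θ
      rw [inner_sub_right, adjL_inner, adjL_inner]; ring
    rwa [this] at hc
  obtain ⟨g, wg, -, hg⟩ := wR.solve0 hω hδ (by linarith) mR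
  have hρ1 : 0 ≤ ρ - δ := by linarith
  have wg : W (ρ - δ) (B ^ 2 * μ) g := wg.mono le_rfl (by
    calc _ ≤ B * (B * μ) := by gcongr
      _ = _ := by ring)
  -- S
  obtain ⟨T, hT⟩ : ∃ T : E m → (E m →L[ℝ] E m), ∀ θ, T θ = (V θ).comp ((h2 θ).comp (adjL m (V θ))) :=
    ⟨_, fun _ => rfl⟩
  have wT : W ρ (2 * (C * 2)) T := by
    rw [funext hT]; exact wV.comp hρn (wh2.comp hρn wV.adj)
  obtain ⟨Tm, -, -, mT, -⟩ := wT.solve hω hδ (by linarith)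
  have hTm : ‖Tm - Q‖ ≤ 6 * C * κ + η := by
    refine (mT.sub (IsMean.const ω Q)).norm_le fun θ => ?_
    have d1 : T θ - Q = (V θ - 1).comp ((h2 θ).comp (adjL m (V θ))) +
        (h2 θ).comp (adjL m (V θ - 1)) + (h2 θ - Q) := by
      rw [hT]
      refine ContinuousLinearMap.ext fun x => ?_
      have : adjL m 1 x = x := ext_inner_left ℝ fun y => by rw [adjL_inner]; simp
      simp [this]
    rw [d1]
    have n1 := wV.norm_le hρn θ
    have n2 := wV1.norm_le hρn θ
    have n3 := wh2.norm_le hρn θ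
    have n4 := wV.adj.norm_le hρn θ
    have n5 := wV1.adj.norm_le hρn θ
    calc _ ≤ ‖V θ - 1‖ * (‖h2 θ‖ * ‖adjL m (V θ)‖) + ‖h2 θ‖ * ‖adjL m (V θ - 1)‖ + ‖h2 θ - Q‖ := by
          refine (norm_add₃_le).trans ?_
          gcongr
          · refine (ContinuousLinearMap.opNorm_comp_le _ _).trans ?_
            gcongr
            exact ContinuousLinearMap.opNorm_comp_le _ _
          · exact ContinuousLinearMap.opNorm_comp_le _ _
      _ ≤ (2 * κ) * (C * 2) + C * (2 * κ) + η := by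
          gcongr
          exact hη θ
      _ = _ := by ring
  -- c
  have wr : W (ρ - δ) (B ^ 5 * μ) (fun θ => T θ (g θ) - V θ (e1 θ)) := by
    refine (((wT.mono (by linarith : ρ - δ ≤ ρ) le_rfl).app hρ1 wg).sub hρ1
      ((wV.app hρn we1).mono (by linarith) le_rfl)).mono le_rfl ?_
    have t1 : 2 * (C * 2) ≤ B ^ 2 := by nlinarith
    have t2 : (2 : ℝ) ≤ B ^ 4 := by linarith [bpow 1 4 (by norm_num)]
    calc _ ≤ B ^ 2 * (B ^ 2 * μ) + B ^ 4 * μ := by gcongr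
      _ = 2 * (B ^ 4 * μ) := by ring
      _ ≤ B * (B ^ 4 * μ) := by gcongr; linarith
      _ = _ := by ring
  obtain ⟨ct, -, -, mr, hct, -⟩ := wr.solve hω hδ (by linarith)
  obtain ⟨c, hc, hcn⟩ := solve_lin hβ hQ hTm hsm (-ct)
  have hcn : ‖c‖ ≤ B ^ 6 * μ := by
    rw [norm_neg] at hcn
    calc _ ≤ 2 * β * ‖ct‖ := hcn
      _ ≤ B * (B ^ 5 * μ) := by gcongr
      _ = _ := by ring
  have wcg : W (ρ - δ) (B ^ 7 * μ) (fun θ => c + g θ) := by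
    refine (((W.const (ρ - δ) c).mono le_rfl hcn).add hρ1 wg).mono le_rfl ?_
    calc _ ≤ B ^ 6 * μ + B ^ 6 * μ := by gcongr <;> first | exact hB1 | norm_num
      _ = 2 * (B ^ 6 * μ) := by ring
      _ ≤ B * (B ^ 6 * μ) := by gcongr; linarith
      _ = _ := by ring
  have wV1δ : W (ρ - δ) 2 V := wV.mono (by linarith) le_rfl
  obtain ⟨z, hz⟩ : ∃ z : E m → E m, ∀ θ, z θ = adjL m (V θ) (c + g θ) := ⟨_, fun _ => rfl⟩
  have wz : W (ρ - δ) (B ^ 8 * μ) z := by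
    rw [funext hz]
    refine (wV1δ.adj.app hρ1 wcg).mono le_rfl ?_
    calc _ ≤ B * (B ^ 7 * μ) := by gcongr; linarith
      _ = _ := by ring
  -- w
  have wdw : W (ρ - δ) (B ^ 10 * μ) (fun θ => T θ (c + g θ) - V θ (e1 θ)) := by
    refine (((wT.mono (by linarith : ρ - δ ≤ ρ) le_rfl).app hρ1 wcg).sub hρ1
      ((wV.app hρn we1).mono (by linarith) le_rfl)).mono le_rfl ?_
    have t1 : 2 * (C * 2) ≤ B ^ 2 := by nlinarith
    have t2 : (2 : ℝ) ≤ B ^ 9 := by linarith [bpow 1 9 (by norm_num)]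
    calc _ ≤ B ^ 2 * (B ^ 7 * μ) + B ^ 9 * μ := by gcongr
      _ = 2 * (B ^ 9 * μ) := by ring
      _ ≤ B * (B ^ 9 * μ) := by gcongr; linarith
      _ = _ := by ring
  have mdw : IsMean ω (fun θ => T θ (c + g θ) - V θ (e1 θ)) 0 := by
    have := (mT.clm (ContinuousLinearMap.apply ℝ (E m) c)).add mr
    simp only [ContinuousLinearMap.apply_apply, hc, neg_add_cancel] at this
    convert! this using 2 with θ
    rw [map_add]; abel
  obtain ⟨w, ww, -, hw⟩ := wdw.solve0 hω hδ (by linarith) mdw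
  have e12 : ρ - δ - δ = ρ - 2 * δ := by ring
  rw [e12] at ww
  have hρ2 : 0 ≤ ρ - 2 * δ := by linarith
  have ww : W (ρ - 2 * δ) (B ^ 11 * μ) w := ww.mono le_rfl (by
    calc _ ≤ B * (B ^ 10 * μ) := by gcongr
      _ = _ := by ring)
  -- A
  have we1' : W (ρ - δ) (B * μ) (fderiv ℝ e1) :=
    (we1.fderivW hδ (by linarith)).mono le_rfl (by gcongr)
  have we2' : W (ρ - δ) (B * μ) (fderiv ℝ e2) :=
    (we2.fderivW hδ (by linarith)).mono le_rfl (by gcongr)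
  have wU1 : W (ρ - δ) 2 U := wU.mono (by linarith) le_rfl
  have wP1 : W (ρ - δ) 1 P := wP.mono (by linarith) le_rfl
  obtain ⟨A, hA⟩ : ∃ A : E m → (E m →L[ℝ] E m), ∀ θ, A θ =
    (adjL m (U θ)).comp (P θ) - (adjL m (P θ)).comp (U θ) := ⟨_, fun _ => rfl⟩
  have wA0 : W ρ (2 * 1 + 1 * 2) A := by
    rw [funext hA]; exact (wU.adj.comp hρn wP).sub hρn (wP.adj.comp hρn wU)
  have hAi : ∀ θ e e', ⟪e, A θ e'⟫_ℝ = ⟪U θ e, P θ e'⟫_ℝ - ⟪P θ e, U θ e'⟫_ℝ := fun θ e e' => by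
    simp only [hA, sub_apply, ContinuousLinearMap.comp_apply, inner_sub_right, adjL_inner]
  have mA : IsMean ω A 0 := by
    obtain ⟨c, -, -, hc, -⟩ := wA0.solve hω hδ (by linarith)
    have : c = 0 := hc.of_inner₂ fun e e' => by
      simp only [hAi]; exact meanA e e'
    rwa [this] at hc
  have dA := wA0.differentiable hρp
  have hDA : ∀ θ, fderiv ℝ A θ ω = ((adjL m (fderiv ℝ e1 θ)).comp (P θ) +
      (adjL m (U θ)).comp (fderiv ℝ e2 θ)) - ((adjL m (fderiv ℝ e2 θ)).comp (U θ) +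
      (adjL m (P θ)).comp (fderiv ℝ e1 θ)) := by
    intro θ
    refine ContinuousLinearMap.ext fun e' => ext_inner_left ℝ fun e => ?_
    have q1 := algA (hsym θ) (G1 θ) (G2 θ) e e'
    have q2 : fderiv ℝ (fun θ => ⟪e, A θ e'⟫_ℝ) θ ω = ⟪e, fderiv ℝ A θ ω e'⟫_ℝ := by
      have := fderiv_inner_app (F := fun _ => (1 : E m →L[ℝ] E m)) (differentiableAt_const _) (dA θ) e e' ω
      simpa using this
    rw [← q2]
    simp only [hAi]
    have q3 : DifferentiableAt ℝ (fun θ => ⟪U θ e, P θ e'⟫_ℝ) θ :=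
      ((dU θ).clm_apply (differentiableAt_const e)).inner ℝ ((dP θ).clm_apply (differentiableAt_const e'))
    have q4 : DifferentiableAt ℝ (fun θ => ⟪P θ e, U θ e'⟫_ℝ) θ :=
      ((dP θ).clm_apply (differentiableAt_const e)).inner ℝ ((dU θ).clm_apply (differentiableAt_const e'))
    rw [fderiv_fun_sub q3 q4, sub_apply, fderiv_inner_app (dU θ) (dP θ), fderiv_inner_app (dP θ) (dU θ), q1]
    simp only [sub_apply, add_apply, ContinuousLinearMap.comp_apply, inner_sub_right, inner_add_right,
      adjL_inner]
  have wA : W (ρ - 2 * δ) (B ^ 4 * μ) A := by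
    have := W.of_D hω hδ (by linarith) hρp wA0 mA hDA
      (((we1'.adj.comp hρ1 wP1).add hρ1 (wU1.adj.comp hρ1 we2')).sub hρ1
        ((we2'.adj.comp hρ1 wU1).add hρ1 (wP1.adj.comp hρ1 we1')))
    rw [e12] at this
    refine this.mono le_rfl ?_
    calc _ ≤ B * (B * μ * 1 + 2 * (B * μ) + (B * μ * 2 + 1 * (B * μ))) := by
          gcongr
      _ = 6 * (B ^ 2 * μ) := by ring
      _ ≤ B ^ 2 * (B ^ 2 * μ) := by gcongr; nlinarith
      _ = _ := by ring
  -- v and q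
  have wU2 : W (ρ - 2 * δ) 2 U := wU.mono (by linarith) le_rfl
  have wP2 : W (ρ - 2 * δ) 1 P := wP.mono (by linarith) le_rfl
  have wV2 : W (ρ - 2 * δ) 2 V := wV.mono (by linarith) le_rfl
  have wz2 : W (ρ - 2 * δ) (B ^ 8 * μ) z := wz.mono (by linarith) le_rfl
  obtain ⟨v, hv⟩ : ∃ v : E m → E m, ∀ θ, v θ = U θ (w θ) := ⟨_, fun _ => rfl⟩
  obtain ⟨q, hq⟩ : ∃ q : E m → E m, ∀ θ, q θ = P θ (w θ) + z θ := ⟨_, fun _ => rfl⟩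
  have wv : W (ρ - 2 * δ) (B ^ 12 * μ) v := by
    rw [funext hv]
    refine (wU2.app hρ2 ww).mono le_rfl ?_
    calc _ ≤ B * (B ^ 11 * μ) := by gcongr; linarith
      _ = _ := by ring
  have wq : W (ρ - 2 * δ) (B ^ 12 * μ) q := by
    rw [funext hq]
    refine ((wP2.app hρ2 ww).add hρ2 wz2).mono le_rfl ?_
    calc _ ≤ 1 * (B ^ 11 * μ) + B ^ 11 * μ := by gcongr <;> first | exact hB1 | norm_num
      _ = 2 * (B ^ 11 * μ) := by ring
      _ ≤ B * (B ^ 11 * μ) := by gcongr; linarith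
      _ = _ := by ring
  have e23 : ρ - 2 * δ - δ = ρ - 3 * δ := by ring
  have hρ3 : 0 ≤ ρ - 3 * δ := by linarith
  have hb : B ^ 12 * μ ≤ B ^ 13 * μ := mul_le_mul_of_nonneg_right (bpow _ _ (by norm_num)) hμ0
  have hb' : 2 * π / δ * (B ^ 12 * μ) ≤ B ^ 13 * μ := by
    calc _ ≤ B * (B ^ 12 * μ) := by gcongr
      _ = _ := by ring
  have wv' := (wv.fderivW hδ (by linarith)).mono le_rfl hb'
  have wq' := (wq.fderivW hδ (by linarith)).mono le_rfl hb'
  rw [e23] at wv' wq'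
  have dw := ww.differentiable (by linarith)
  have dz := wz.differentiable (by linarith)
  have dg := wg.differentiable (by linarith)
  have dv := wv.differentiable (by linarith)
  have dq := wq.differentiable (by linarith)
  have Dv : ∀ θ, fderiv ℝ v θ ω = fderiv ℝ U θ ω (w θ) + U θ (fderiv ℝ w θ ω) := fun θ => by
    rw [show v = fun θ => U θ (w θ) from funext hv,
      ((dU θ).hasFDerivAt.clm_apply (dw θ).hasFDerivAt).fderiv]
    simp [add_comm]
  have Dq : ∀ θ, fderiv ℝ q θ ω = fderiv ℝ P θ ω (w θ) + P θ (fderiv ℝ w θ ω) + fderiv ℝ z θ ω := fun θ => by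
    rw [show q = fun θ => P θ (w θ) + z θ from funext hq,
      (((dP θ).hasFDerivAt.clm_apply (dw θ).hasFDerivAt).fun_add (dz θ).hasFDerivAt).fderiv]
    simp [add_comm]
  have hUV' : ∀ θ x, U θ (V θ x) = x := fun θ x => by
    have := congrArg (fun T : E m →L[ℝ] E m => T x) (hUV θ); simpa using this
  have hVU' : ∀ θ x, V θ (U θ x) = x := fun θ x => by
    have := congrArg (fun T : E m →L[ℝ] E m => T x) (hVU θ); simpa using this
  have A3 : ∀ θ, U θ (fderiv ℝ w θ ω) = fderiv ℝ Yy (θ + u θ, p θ) (0, z θ) - e1 θ := fun θ => by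
    rw [hw, map_sub, hUV', h2z, hT, hz]
    simp only [ContinuousLinearMap.comp_apply, hUV']
  have A4 : ∀ θ e, ⟪fderiv ℝ U θ ω e, z θ⟫_ℝ + ⟪U θ e, fderiv ℝ z θ ω⟫_ℝ =
      -⟪U θ e, e2 θ⟫_ℝ + ⟪P θ e, e1 θ⟫_ℝ := fun θ e => by
    rw [← fderiv_inner_app' (dU θ) (dz θ)]
    have q1 : (fun θ => ⟪U θ e, z θ⟫_ℝ) = fun θ => ⟪(1 : E m →L[ℝ] E m) e, c + g θ⟫_ℝ := by
      funext θ
      rw [hz, adjL_inner, hVU']; rfl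
    rw [q1, fderiv_inner_app' (F := fun _ => (1 : E m →L[ℝ] E m)) (differentiableAt_const _)
      ((dg θ).const_add c) e ω]
    simp only [fderiv_fun_const, Pi.zero_apply, zero_apply, inner_zero_left, zero_add,
      fderiv_const_add, hg, inner_sub_right, ContinuousLinearMap.one_apply, adjL_inner]
    ring
  have wX2 : W (ρ - 2 * δ) (κ + κ) (fun θ => (u θ, p θ - y0)) := wX.mono (by linarith) le_rfl
  have wΔ : W (ρ - 2 * δ) (B ^ 13 * μ) (fun θ => (v θ, q θ)) := by
    refine (wv.prodMk hρ2 wq).mono le_rfl ?_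
    calc _ = 2 * (B ^ 12 * μ) := by ring
      _ ≤ B * (B ^ 12 * μ) := by gcongr; linarith
      _ = _ := by ring
  have r1 := (S.cYy _ _ _ _ _ (by linarith) (by linarith) wX2 wΔ (by linarith) hsmall).2.2
  have r2 := (S.cYx _ _ _ _ _ (by linarith) (by linarith) wX2 wΔ (by linarith) hsmall).2.2
  have eK : ∀ θ, ((θ, y0) : Ph m) + (u θ, p θ - y0) = (θ + u θ, p θ) := fun θ => by simp
  simp only [eK, Prod.mk_add_mk] at r1 r2
  have fin : ∀ θ, Er1 ω Yy (fun θ => u θ + v θ) (fun θ => p θ + q θ) θ =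
      fderiv ℝ e1 θ (w θ) - (Yy (θ + u θ + v θ, p θ + q θ) - Yy (θ + u θ, p θ) -
        fderiv ℝ Yy (θ + u θ, p θ) (v θ, q θ)) := fun θ => by
    have := alg1 (w := w θ) (G1 θ) (A3 θ)
    rw [← Dv, ← hv, ← hq] at this
    rw [← this, he1, Er1, Er1, fderiv_fun_add (hu.differentiable (by norm_num) θ) (dv θ), add_apply, add_assoc θ]
    abel
  have fin2 : ∀ θ, Er2 ω Yx (fun θ => u θ + v θ) (fun θ => p θ + q θ) θ =
      (fderiv ℝ e2 θ (w θ) + adjL m (V θ) (A θ (fderiv ℝ w θ ω) - adjL m (fderiv ℝ e1 θ) (z θ))) +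
        (Yx (θ + u θ + v θ, p θ + q θ) - Yx (θ + u θ, p θ) -
        fderiv ℝ Yx (θ + u θ, p θ) (v θ, q θ)) := fun θ => by
    have := alg2 (w := w θ) (hUV θ) (hVU θ) (hsym θ) (G1 θ) (G2 θ) (A3 θ) (A4 θ)
    rw [← Dq, ← hv, ← hq] at this
    have eA : A θ (fderiv ℝ w θ ω) = adjL m (U θ) (P θ (fderiv ℝ w θ ω)) -
      adjL m (P θ) (U θ (fderiv ℝ w θ ω)) := by rw [hA]; rfl
    rw [eA, ← this, he2, Er2, Er2, fderiv_fun_add (hp.differentiable (by norm_num) θ) (dq θ), add_apply, add_assoc θ]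
    abel
  have bQ : C * (B ^ 13 * μ) ^ 2 ≤ B ^ 27 * μ ^ 2 := by
    calc _ ≤ B * (B ^ 13 * μ) ^ 2 := by gcongr
      _ = _ := by ring
  have we1'' : W (ρ - 2 * δ) (B * μ) (fderiv ℝ e1) := we1'.mono (by linarith) le_rfl
  have we2'' : W (ρ - 2 * δ) (B * μ) (fderiv ℝ e2) := we2'.mono (by linarith) le_rfl
  have hμ2 : 0 ≤ μ ^ 2 := sq_nonneg μ
  have b12 : B * μ * (B ^ 11 * μ) ≤ B ^ 27 * μ ^ 2 := by
    calc _ = B ^ 12 * μ ^ 2 := by ring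
      _ ≤ _ := by gcongr <;> first | exact hB1 | norm_num
  have wdw2 : W (ρ - 2 * δ) (B ^ 10 * μ) (fun θ => fderiv ℝ w θ ω) := by
    rw [funext hw]; exact wdw.mono (by linarith) le_rfl
  refine ⟨v, q, wv.mono (by linarith) hb, wq.mono (by linarith) hb, wv', wq', ?_, ?_⟩
  · rw [funext fin]
    refine ((we1''.app hρ2 ww).sub hρ2 r1).mono (by linarith) ?_
    calc _ ≤ B ^ 27 * μ ^ 2 + B ^ 27 * μ ^ 2 := add_le_add b12 bQ
      _ = 2 * (B ^ 27 * μ ^ 2) := by ring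
      _ ≤ B * (B ^ 27 * μ ^ 2) := by gcongr; linarith
      _ = _ := by ring
  · rw [funext fin2]
    refine (((we2''.app hρ2 ww).add hρ2 (wV2.adj.app hρ2 ((wA.app hρ2 wdw2).sub hρ2
      (we1''.adj.app hρ2 wz2)))).add hρ2 r2).mono (by linarith) ?_
    have b3 : 2 * (B ^ 4 * μ * (B ^ 10 * μ) + B * μ * (B ^ 8 * μ)) ≤ B ^ 27 * μ ^ 2 := by
      calc _ = 2 * (B ^ 14 * μ ^ 2 + B ^ 9 * μ ^ 2) := by ring
        _ ≤ 2 * (B ^ 14 * μ ^ 2 + B ^ 14 * μ ^ 2) := by gcongr <;> first | exact hB1 | norm_num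
        _ = 4 * (B ^ 14 * μ ^ 2) := by ring
        _ ≤ B ^ 13 * (B ^ 14 * μ ^ 2) := by
            gcongr; linarith [bpow 1 13 (by norm_num)]
        _ = _ := by ring
    calc _ ≤ B ^ 27 * μ ^ 2 + B ^ 27 * μ ^ 2 + B ^ 27 * μ ^ 2 := add_le_add (add_le_add b12 b3) bQ
      _ = 3 * (B ^ 27 * μ ^ 2) := by ring
      _ ≤ B * (B ^ 27 * μ ^ 2) := by gcongr; linarith
      _ = _ := by ring

end newton
end KAM
end PartG

section PartH
open Real Filter Topology
open scoped InnerProductSpace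
namespace KAM
section iter
variable {m : ℕ}

set_option maxHeartbeats 4000000 in
lemma iter_step {H : Ph m → ℝ} {Yx Yy : Ph m → E m} {ω y0 : E m} {ρ0 C a0 Λ : ℝ} {N : ℕ}
    (hω : Dio ω Λ N) (hρ0 : 0 < ρ0) (S : Sys H Yx Yy y0 ρ0 C a0) {Q : E m →L[ℝ] E m} {β : ℝ} (hβ : 0 ≤ β)
    (hQ : ∀ x, ‖x‖ ≤ β * ‖Q x‖) {η0 : ℝ}
    (hη0 : ∀ θ, ‖(fderiv ℝ Yy (θ, y0)).comp (ContinuousLinearMap.inr ℝ (E m) (E m)) - Q‖ ≤ η0)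
    (hβη : β * η0 ≤ 1 / 4) {B0 μ : ℝ} (hB8 : 8 ≤ B0) (hBs : Λ * N.factorial * (12 / ρ0) ^ N ≤ B0)
    (hBd : 24 * π / ρ0 ≤ B0) (hBC : C ≤ B0) (hBβ : 2 * β ≤ B0) (hμ : 0 ≤ μ)
    (h1 : B0 ^ 13 * μ ≤ 1 / 8) (h2 : 4 * (B0 ^ 13 * μ) ≤ a0) (h3 : β * (16 * C * (B0 ^ 13 * μ)) ≤ 1 / 4)
    (h4 : B0 ^ 28 * μ ≤ (1 / 2 ^ (N + 1)) ^ 28) (n : ℕ) {u p : E m → E m}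
    (I : Inv ω y0 Yx Yy (ρ0 / 2 * (1 + (1 / 2) ^ n)) (2 * (B0 ^ 13 * μ) * (1 - (1 / 2) ^ n))
      (μ * ((1 / 2 ^ (N + 1)) ^ 28) ^ n) u p) :
    ∃ v q : E m → E m, W (ρ0 / 2) (B0 ^ 13 * μ * (1 / 2) ^ n) v ∧ W (ρ0 / 2) (B0 ^ 13 * μ * (1 / 2) ^ n) q ∧
      Inv ω y0 Yx Yy (ρ0 / 2 * (1 + (1 / 2) ^ (n + 1))) (2 * (B0 ^ 13 * μ) * (1 - (1 / 2) ^ (n + 1)))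
      (μ * ((1 / 2 ^ (N + 1)) ^ 28) ^ (n + 1)) (fun θ => u θ + v θ) (fun θ => p θ + q θ) := by
  obtain ⟨x, hx⟩ : ∃ x : ℝ, x = (1 / 2) ^ n := ⟨_, rfl⟩
  obtain ⟨b, hb⟩ : ∃ b : ℝ, b = 2 ^ (N + 1) := ⟨_, rfl⟩
  obtain ⟨D, hD⟩ : ∃ D : ℝ, D = B0 ^ 13 * μ := ⟨_, rfl⟩
  have hx0 : 0 < x := by rw [hx]; positivity
  have hx1 : x ≤ 1 := by rw [hx]; exact pow_le_one₀ (by norm_num) (by norm_num)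
  have hb0 : 0 < b := by rw [hb]; positivity
  have hb2 : 2 ≤ b := by
    rw [hb]; calc (2 : ℝ) = 2 ^ 1 := by norm_num
      _ ≤ _ := pow_le_pow_right₀ (by norm_num) (by omega)
  have hD0 : 0 ≤ D := by rw [hD]; positivity
  have hxb : 1 ≤ x * b ^ n := by
    rw [hx, ← mul_pow]; exact one_le_pow₀ (by linarith)
  have hxb' : 1 ≤ x ^ N * b ^ n := by
    rw [hx, hb, pow_right_comm, ← mul_pow]
    refine one_le_pow₀ ?_
    rw [pow_succ, ← mul_assoc, ← mul_pow]; norm_num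
  have hbn : 1 ≤ b ^ n := one_le_pow₀ (by linarith)
  have hB0 : 0 < B0 := by linarith
  have hle : B0 ≤ B0 * b ^ n := by nlinarith
  rw [← hD] at h1 h2 h3
  rw [← hb] at h4
  rw [← hx, ← hb, ← hD] at I
  have hκ : 2 * D * (1 - x) ≤ 2 * D := by nlinarith
  have hC := S.hC
  have hpow : (B0 * b ^ n) ^ 13 * (μ * ((1 / b) ^ 28) ^ n) ≤ D * x := by
    have : (B0 * b ^ n) ^ 13 * (μ * ((1 / b) ^ 28) ^ n) = D * ((1 / b) ^ 15) ^ n := by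
      rw [hD]
      have e : (b ^ n) ^ 13 * ((1 / b) ^ 28) ^ n = ((1 / b) ^ 15) ^ n := by
        rw [pow_right_comm, ← mul_pow]; congr 1; field_simp
      rw [← e]; ring
    rw [this, hx]
    gcongr
    calc (1 / b) ^ 15 ≤ (1 / b) ^ 1 := pow_le_pow_of_le_one (by positivity)
          (by rw [div_le_one hb0]; linarith) (by norm_num)
      _ = 1 / b := pow_one _
      _ ≤ 1 / 2 := by gcongr
  have hpow2 : (B0 * b ^ n) ^ 28 * (μ * ((1 / b) ^ 28) ^ n) ^ 2 ≤ μ * ((1 / b) ^ 28) ^ (n + 1) := by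
    have e : (b ^ n) ^ 28 * ((1 / b) ^ 28) ^ n = 1 := by
      rw [pow_right_comm, ← mul_pow, ← mul_pow, mul_one_div_cancel hb0.ne', one_pow, one_pow]
    calc _ = B0 ^ 28 * μ * (μ * ((1 / b) ^ 28) ^ n) * ((b ^ n) ^ 28 * ((1 / b) ^ 28) ^ n) := by ring
      _ = B0 ^ 28 * μ * (μ * ((1 / b) ^ 28) ^ n) := by rw [e, mul_one]
      _ ≤ (1 / b) ^ 28 * (μ * ((1 / b) ^ 28) ^ n) := by gcongr
      _ = _ := by ring
  have hρp : 0 < ρ0 / 2 * (1 + x) := by positivity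
  have hη : ∀ θ, ‖(fderiv ℝ Yy (θ + u θ, p θ)).comp (ContinuousLinearMap.inr ℝ (E m) (E m)) - Q‖ ≤
      C * (2 * (2 * D * (1 - x))) + η0 := by
    intro θ
    have wX := I.wu.prodMk hρp.le I.wp
    have := (S.cYyy _ 0 _ _ _ hρp (by linarith [mul_le_mul_of_nonneg_left hx1 hρ0.le]) (W.zero _) wX (by linarith) (by linarith)).2.1.norm_le hρp.le θ
    simp only [add_zero, Prod.mk_add_mk, add_sub_cancel] at this
    have h0 := hη0 θ
    calc _ = ‖((fderiv ℝ Yy (θ + u θ, p θ)).comp (ContinuousLinearMap.inr ℝ (E m) (E m)) -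
        (fderiv ℝ Yy (θ, y0)).comp (ContinuousLinearMap.inr ℝ (E m) (E m))) +
        ((fderiv ℝ Yy (θ, y0)).comp (ContinuousLinearMap.inr ℝ (E m) (E m)) - Q)‖ := by
          congr 1; abel
      _ ≤ _ := (norm_add_le _ _).trans (add_le_add (by rw [two_mul]; exact this) h0)
  obtain ⟨v, q, wv, wq, wv', wq', w1, w2⟩ := newton (δ := ρ0 / 12 * x) (B := B0 * b ^ n) hω S hβ hQ
    (by positivity) (by linarith [mul_le_mul_of_nonneg_left hx1 hρ0.le]) (by linarith [mul_le_mul_of_nonneg_left hx1 hρ0.le]) (by linarith) (by linarith) hη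
    (by
      have : β * (C * (2 * D * (1 - x))) ≤ β * (C * (2 * D)) := by gcongr
      nlinarith) I (by linarith)
    (by
      calc Λ * N.factorial / (ρ0 / 12 * x) ^ N = Λ * N.factorial * (12 / ρ0) ^ N * (1 / x ^ N) := by
            rw [mul_pow, div_pow, div_pow]; field_simp
        _ ≤ B0 * b ^ n := by
            gcongr
            rw [div_le_iff₀ (by positivity), mul_comm]; exact hxb')
    (by
      calc 2 * π / (ρ0 / 12 * x) = 24 * π / ρ0 * (1 / x) := by field_simp; ring
        _ ≤ B0 * b ^ n := by
            gcongr
            rw [div_le_iff₀ (by positivity), mul_comm]; exact hxb)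
    (by linarith) (by linarith) (hpow.trans (by linarith [mul_le_mul_of_nonneg_left hx1 hD0]))
  have eρ : ρ0 / 2 * (1 + x) - 3 * (ρ0 / 12 * x) = ρ0 / 2 * (1 + (1 / 2) ^ (n + 1)) := by
    rw [pow_succ, ← hx]; ring
  rw [eρ] at wv wq wv' wq' w1 w2
  have hρ' : ρ0 / 2 * (1 + (1 / 2) ^ (n + 1)) ≤ ρ0 / 2 * (1 + x) := by
    rw [pow_succ, ← hx]; linarith [mul_pos hρ0 hx0]
  have hρ'' : ρ0 / 2 ≤ ρ0 / 2 * (1 + (1 / 2) ^ (n + 1)) := by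
    rw [pow_succ, ← hx]; linarith [mul_pos hρ0 hx0]
  have hρ3 : 0 ≤ ρ0 / 2 * (1 + (1 / 2) ^ (n + 1)) := by linarith
  have hρ3p : 0 < ρ0 / 2 * (1 + (1 / 2) ^ (n + 1)) := by linarith
  have hκ' : 2 * D * (1 - x) + D * x ≤ 2 * D * (1 - (1 / 2) ^ (n + 1)) := by
    rw [pow_succ, ← hx]; linarith
  rw [← hx, ← hb, ← hD]
  have du := I.wu.differentiable hρp
  have dp : Differentiable ℝ p := by
    have := (I.wp.add hρp.le (W.const _ y0)).differentiable hρp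
    simpa using this
  have dv := wv.differentiable hρ3p
  have dq := wq.differentiable hρ3p
  refine ⟨v, q, wv.mono hρ'' hpow, wq.mono hρ'' hpow, ⟨?_, ?_, ?_, ?_, ?_, ?_⟩⟩
  · exact ((I.wu.mono hρ' le_rfl).add hρ3 (wv.mono le_rfl hpow)).mono le_rfl hκ'
  · have := ((I.wp.mono hρ' le_rfl).add hρ3 (wq.mono le_rfl hpow)).mono le_rfl hκ'
    convert! this using 2 with θ
    abel
  · have := ((I.wu'.mono hρ' le_rfl).add hρ3 (wv'.mono le_rfl hpow)).mono le_rfl hκ'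
    convert! this using 2 with θ
    exact fderiv_fun_add (du θ) (dv θ)
  · have := ((I.wp'.mono hρ' le_rfl).add hρ3 (wq'.mono le_rfl hpow)).mono le_rfl hκ'
    convert! this using 2 with θ
    exact fderiv_fun_add (dp θ) (dq θ)
  · exact w1.mono le_rfl hpow2
  · exact w2.mono le_rfl hpow2

end iter
end KAM
end PartH

section PartI
open Real Filter Topology
open scoped InnerProductSpace
namespace KAM
section iter
variable {m : ℕ}

lemma W_limit {u : ℕ → E m → E m} {ρ D : ℝ} (hρ : 0 < ρ)
    (hv : ∀ n, W ρ (D * (1 / 2) ^ n) (fun θ => u (n + 1) θ - u n θ)) :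
    ∃ U : E m → E m, ∀ n, W ρ (2 * D * (1 / 2) ^ n) (fun θ => U θ - u n θ) := by
  have hs : ∀ θ, Summable (fun n => u (n + 1) θ - u n θ) := fun θ =>
    Summable.of_norm_bounded ((summable_geometric_of_lt_one (by norm_num) (by norm_num : (1 / 2 : ℝ) < 1)).mul_left D)
      fun n => (hv n).norm_le hρ.le θ
  refine ⟨fun θ => u 0 θ + ∑' n, (u (n + 1) θ - u n θ), fun n => ?_⟩
  have hg : HasSum (fun i => D * (1 / 2) ^ (i + n)) (2 * D * (1 / 2 : ℝ) ^ n) := by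
    have := (hasSum_geometric_of_lt_one (by norm_num) (by norm_num : (1 / 2 : ℝ) < 1)).mul_left (D * (1 / 2) ^ n)
    convert! this using 1
    · funext i; rw [pow_add]; ring
    · norm_num; ring
  refine W.hasSum (M := fun i => D * (1 / 2) ^ (i + n)) (g := fun i θ => u (i + n + 1) θ - u (i + n) θ)
    (fun i => hv (i + n)) hρ.le hg fun θ => ?_
  have h1 := (hs θ).hasSum
  have h2 := (hasSum_nat_add_iff' n).2 h1
  rw [Finset.sum_range_sub (fun n => u n θ)] at h2
  convert! h2 using 1
  simp only []
  abel

/-- Convergence of the iteration. -/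
lemma kam_limit {H : Ph m → ℝ} {Yx Yy : Ph m → E m} {ω y0 : E m} {ρ0 C a0 Λ : ℝ} {N : ℕ}
    (hω : Dio ω Λ N) (hρ0 : 0 < ρ0) (S : Sys H Yx Yy y0 ρ0 C a0) {Q : E m →L[ℝ] E m} {β : ℝ} (hβ : 0 ≤ β)
    (hQ : ∀ x, ‖x‖ ≤ β * ‖Q x‖) {η0 : ℝ}
    (hη0 : ∀ θ, ‖(fderiv ℝ Yy (θ, y0)).comp (ContinuousLinearMap.inr ℝ (E m) (E m)) - Q‖ ≤ η0)
    (hβη : β * η0 ≤ 1 / 4) {B0 μ : ℝ} (hB8 : 8 ≤ B0) (hBs : Λ * N.factorial * (12 / ρ0) ^ N ≤ B0)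
    (hBd : 24 * π / ρ0 ≤ B0) (hBC : C ≤ B0) (hBβ : 2 * β ≤ B0) (hμ : 0 ≤ μ)
    (h1 : B0 ^ 13 * μ ≤ 1 / 8) (h2 : 4 * (B0 ^ 13 * μ) ≤ a0) (h3 : β * (16 * C * (B0 ^ 13 * μ)) ≤ 1 / 4)
    (h4 : B0 ^ 28 * μ ≤ (1 / 2 ^ (N + 1)) ^ 28)
    (w1 : W ρ0 μ (fun θ => ω - Yy (θ, y0))) (w2 : W ρ0 μ (fun θ => Yx (θ, y0))) :
    ∃ u p : E m → E m, W (ρ0 / 2) (2 * (B0 ^ 13 * μ)) u ∧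
      W (ρ0 / 2) (2 * (B0 ^ 13 * μ)) (fun θ => p θ - y0) ∧
      (∀ θ, ω + fderiv ℝ u θ ω = Yy (θ + u θ, p θ)) ∧ (∀ θ, fderiv ℝ p θ ω = -Yx (θ + u θ, p θ)) := by
  obtain ⟨D, hD⟩ : ∃ D : ℝ, D = B0 ^ 13 * μ := ⟨_, rfl⟩
  have hD0 : 0 ≤ D := by rw [hD]; positivity
  let P : ℕ → (E m → E m) × (E m → E m) → Prop := fun n s =>
    Inv ω y0 Yx Yy (ρ0 / 2 * (1 + (1 / 2) ^ n)) (2 * (B0 ^ 13 * μ) * (1 - (1 / 2) ^ n))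
      (μ * ((1 / 2 ^ (N + 1)) ^ 28) ^ n) s.1 s.2
  have hstep : ∀ n s, P n s → ∃ s', P (n + 1) s' ∧ W (ρ0 / 2) (D * (1 / 2) ^ n) (fun θ => s'.1 θ - s.1 θ) ∧
      W (ρ0 / 2) (D * (1 / 2) ^ n) (fun θ => s'.2 θ - s.2 θ) := by
    intro n s hs
    obtain ⟨v, q, wv, wq, I⟩ := iter_step hω hρ0 S hβ hQ hη0 hβη hB8 hBs hBd hBC hBβ hμ h1 h2 h3 h4 n hs
    rw [← hD] at wv wq
    exact ⟨(fun θ => s.1 θ + v θ, fun θ => s.2 θ + q θ), I, by simpa using wv, by simpa using wq⟩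
  have h0 : P 0 (fun _ => 0, fun _ => y0) := by
    refine ⟨?_, ?_, ?_, ?_, ?_, ?_⟩
    · simpa using W.zero (m := m) (V := E m) (ρ0 / 2 * (1 + 1))
    · simpa using W.zero (m := m) (V := E m) (ρ0 / 2 * (1 + 1))
    · have := W.zero (m := m) (V := E m →L[ℝ] E m) (ρ0 / 2 * (1 + 1))
      simp only [fderiv_fun_const, pow_zero, sub_self, mul_zero]
      exact this
    · have := W.zero (m := m) (V := E m →L[ℝ] E m) (ρ0 / 2 * (1 + 1))
      simp only [fderiv_fun_const, pow_zero, sub_self, mul_zero]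
      exact this
    · have e : Er1 ω Yy (fun _ => 0) (fun _ => y0) = fun θ => ω - Yy (θ, y0) := by
        funext θ; simp [Er1]
      simp only [e]
      exact w1.mono (by norm_num) (by simp)
    · have e : Er2 ω Yx (fun _ => 0) (fun _ => y0) = fun θ => Yx (θ, y0) := by
        funext θ; simp [Er2]
      simp only [e]
      exact w2.mono (by norm_num) (by simp)
  choose! nx hn1 hn2 hn3 using hstep
  let s : ℕ → (E m → E m) × (E m → E m) := fun n => Nat.rec (fun _ => 0, fun _ => y0) (fun n s => nx n s) n
  have hs : ∀ n, P n (s n) := fun n => by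
    induction n with
    | zero => exact h0
    | succ n ih => exact hn1 n _ ih
  have hρ2 : 0 < ρ0 / 2 := by linarith
  obtain ⟨u, hu⟩ := W_limit (u := fun n => (s n).1) hρ2 (fun n => hn2 n _ (hs n))
  obtain ⟨p, hp⟩ := W_limit (u := fun n => (s n).2) hρ2 (fun n => hn3 n _ (hs n))
  have wu : W (ρ0 / 2) (2 * D) u := by simpa [s] using hu 0
  have wp : W (ρ0 / 2) (2 * D) (fun θ => p θ - y0) := by simpa [s] using hp 0
  have du := wu.differentiable hρ2
  have hρn : ∀ n : ℕ, 0 < ρ0 / 2 * (1 + (1 / 2) ^ n) := fun n => by positivity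
  have tg : Tendsto (fun n : ℕ => (1 / 2 : ℝ) ^ n) atTop (𝓝 0) :=
    tendsto_pow_atTop_nhds_zero_of_lt_one (by norm_num) (by norm_num)
  have lim : ∀ {g : E m → E m} {gn : ℕ → E m → E m}, Differentiable ℝ g → (∀ n, Differentiable ℝ (gn n)) →
      (∀ n, W (ρ0 / 2) (2 * D * (1 / 2) ^ n) (fun θ => g θ - gn n θ)) → ∀ θ,
      Tendsto (fun n => gn n θ) atTop (𝓝 (g θ)) ∧ Tendsto (fun n => fderiv ℝ (gn n) θ) atTop (𝓝 (fderiv ℝ g θ)) := by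
    intro g gn dg dgn hW θ
    constructor
    · rw [tendsto_iff_norm_sub_tendsto_zero]
      refine squeeze_zero (fun _ => norm_nonneg _) (fun n => ?_) (by simpa only [mul_zero] using tg.const_mul (2 * D))
      rw [norm_sub_rev]; exact (hW n).norm_le hρ2.le θ
    · rw [tendsto_iff_norm_sub_tendsto_zero]
      refine squeeze_zero (fun _ => norm_nonneg _) (fun n => ?_)
        (by simpa only [mul_zero] using tg.const_mul (2 * π / (ρ0 / 2) * (2 * D)))
      rw [norm_sub_rev]
      have := ((hW n).fderivW hρ2 le_rfl).norm_le (by simp) θ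
      rw [fderiv_fun_sub (dg θ) (dgn n θ)] at this
      linarith
  have dun : ∀ n, Differentiable ℝ (s n).1 := fun n => (hs n).wu.differentiable (hρn n)
  have dpn : ∀ n, Differentiable ℝ (s n).2 := fun n => by
    have := ((hs n).wp.add (hρn n).le (W.const _ y0)).differentiable (hρn n)
    simpa using this
  have dp : Differentiable ℝ p := by
    have := (wp.add hρ2.le (W.const _ y0)).differentiable hρ2
    simpa using this
  have lu := lim du dun hu
  have lp := lim dp dpn hp
  have tμ : Tendsto (fun n : ℕ => μ * ((1 / 2 ^ (N + 1) : ℝ) ^ 28) ^ n) atTop (𝓝 0) := by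
    have hlt : ((1 / 2 ^ (N + 1) : ℝ) ^ 28) < 1 := by
      refine pow_lt_one₀ (by positivity) ?_ (by norm_num)
      rw [div_lt_one (by positivity)]
      exact one_lt_pow₀ (by norm_num) (by omega)
    simpa using (tendsto_pow_atTop_nhds_zero_of_lt_one (by positivity) hlt).const_mul μ
  have hpa : ∀ θ, ‖p θ - y0‖ ≤ a0 := fun θ => (wp.norm_le hρ2.le θ).trans (by rw [hD]; rw [← hD] at h2 ⊢; linarith)
  have tK : ∀ θ, Tendsto (fun n => ((θ + (s n).1 θ, (s n).2 θ) : Ph m)) atTop (𝓝 (θ + u θ, p θ)) := fun θ =>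
    ((lu θ).1.const_add θ).prodMk_nhds (lp θ).1
  have happ : ∀ {A : ℕ → E m →L[ℝ] E m} {A0 : E m →L[ℝ] E m}, Tendsto A atTop (𝓝 A0) →
      Tendsto (fun n => A n ω) atTop (𝓝 (A0 ω)) := fun h =>
    ((ContinuousLinearMap.apply ℝ (E m) ω).continuous.tendsto _).comp h
  rw [← hD]
  refine ⟨u, p, wu, wp, fun θ => ?_, fun θ => ?_⟩
  · have t1 := ((happ (lu θ).2).const_add ω).sub
      (((S.hYy (θ + u θ, p θ) (hpa θ)).continuousAt.tendsto).comp (tK θ))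
    have t2 : Tendsto (fun n => Er1 ω Yy (s n).1 (s n).2 θ) atTop (𝓝 0) :=
      squeeze_zero_norm (fun n => (hs n).w1.norm_le (hρn n).le θ) tμ
    exact sub_eq_zero.1 (tendsto_nhds_unique t1 t2)
  · have t1 := (happ (lp θ).2).add
      (((S.hYx (θ + u θ, p θ) (hpa θ)).continuousAt.tendsto).comp (tK θ))
    have t2 : Tendsto (fun n => Er2 ω Yx (s n).1 (s n).2 θ) atTop (𝓝 0) :=
      squeeze_zero_norm (fun n => (hs n).w2.norm_le (hρn n).le θ) tμ
    exact eq_neg_of_add_eq_zero_left (tendsto_nhds_unique t1 t2)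

end iter
end KAM
end PartI

section PartJ
open Real Filter Topology
namespace KAM
section comp
variable {m : ℕ} 

lemma W.lin {ρ M c : ℝ} {V V₁ : Type*} [NormedAddCommGroup V] [NormedSpace ℝ V]
    [NormedAddCommGroup V₁] [NormedSpace ℝ V₁] {f : E m → V} (hf : W ρ M f) (L : V →ₗ[ℝ] V₁)
    (hL : ∀ v, ‖L v‖ ≤ c * ‖v‖) (hc : 0 ≤ c) : W ρ (c * M) (fun x => L (f x)) :=
  hf.clm_le (LinearMap.mkContinuous L c hL) (LinearMap.mkContinuous_norm_le _ hc _)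

lemma W.bil {ρ M N : ℝ} {V₁ V₂ V₃ : Type*} [NormedAddCommGroup V₁] [NormedSpace ℝ V₁]
    [NormedAddCommGroup V₂] [NormedSpace ℝ V₂] [NormedAddCommGroup V₃] [NormedSpace ℝ V₃] [CompleteSpace V₃]
    (hρ : 0 ≤ ρ) {f : E m → V₁} {g : E m → V₂} (hf : W ρ M f) (hg : W ρ N g) (L : V₁ →ₗ[ℝ] V₂ →ₗ[ℝ] V₃)
    (hL : ∀ v w, ‖L v w‖ ≤ 1 * ‖v‖ * ‖w‖) : W ρ (M * N) (fun x => L (f x) (g x)) := by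
  have := W.bilin_le hρ hf hg (LinearMap.mkContinuous₂ L 1 hL) (LinearMap.mkContinuous₂_norm_le _ zero_le_one _)
  simpa using this

/-- Evaluating the first variable, as a bilinear map. -/
noncomputable def curL (X V : Type*) [NormedAddCommGroup V] [NormedSpace ℝ V]
    [NormedAddCommGroup X] [NormedSpace ℝ X] (n : ℕ) :
    (X [×(n + 1)]→L[ℝ] V) →ₗ[ℝ] X →ₗ[ℝ] (X [×n]→L[ℝ] V) :=
  LinearMap.mk₂ ℝ (fun p x => ContinuousMultilinearMap.curryLeft p x)
    (fun p q x => by ext; simp) (fun c p x => by ext; simp) (fun p x y => by ext; simp)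
    (fun c p x => by ext; simp)

lemma curL_apply {X V : Type*} [NormedAddCommGroup V] [NormedSpace ℝ V]
    [NormedAddCommGroup X] [NormedSpace ℝ X] {n : ℕ} (p : X [×(n + 1)]→L[ℝ] V) (x : X) (v : Fin n → X) :
    curL X V n p x v = p (Fin.cons x v) := rfl

lemma norm_curL_le {X V : Type*} [NormedAddCommGroup V] [NormedSpace ℝ V]
    [NormedAddCommGroup X] [NormedSpace ℝ X] {n : ℕ} (p : X [×(n + 1)]→L[ℝ] V) (x : X) :
    ‖curL X V n p x‖ ≤ 1 * ‖p‖ * ‖x‖ := by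
  refine ContinuousMultilinearMap.opNorm_le_bound (by positivity) fun v => ?_
  rw [curL_apply, one_mul]
  exact p.norm_map_cons_le x v

/-- Currying a constant map. -/
noncomputable def cur0 (X V : Type*) [NormedAddCommGroup V] [NormedSpace ℝ V]
    [NormedAddCommGroup X] [NormedSpace ℝ X] :
    (X [×0]→L[ℝ] V) →ₗ[ℝ] V where
  toFun := fun p => p (fun _ => 0)
  map_add' := fun p q => by simp
  map_smul' := fun c p => by simp

lemma norm_cur0_le {X V : Type*} [NormedAddCommGroup V] [NormedSpace ℝ V]
    [NormedAddCommGroup X] [NormedSpace ℝ X] (p : X [×0]→L[ℝ] V) :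
    ‖cur0 X V p‖ ≤ 1 * ‖p‖ := by
  have := p.le_opNorm (fun _ => 0)
  simpa [cur0] using this

lemma W.multilinear {ρ : ℝ} (hρ : 0 ≤ ρ) {V : Type*} [NormedAddCommGroup V] [NormedSpace ℝ V] [CompleteSpace V]
    {X : Type*} [NormedAddCommGroup X] [NormedSpace ℝ X] :
    ∀ (n : ℕ) {M : ℝ} {p : E m → (X [×n]→L[ℝ] V)} {z : Fin n → ℝ} {Z : Fin n → E m → X},
    W ρ M p → (∀ i, W ρ (z i) (Z i)) → W ρ (M * ∏ i, z i) (fun θ => p θ (fun i => Z i θ)) := by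
  intro n
  induction n with
  | zero =>
    intro M p z Z hp hZ
    have := hp.lin (cur0 X V) norm_cur0_le zero_le_one
    simp only [one_mul] at this
    simp only [Finset.univ_eq_empty, Finset.prod_empty, mul_one]
    convert! this using 2 with θ
    show p θ _ = p θ _
    congr 1
    exact Subsingleton.elim _ _
  | succ n ih =>
    intro M p z Z hp hZ
    have := W.bil hρ hp (hZ 0) (curL X V n) norm_curL_le
    have h2 := ih this (fun i => hZ i.succ)
    rw [Fin.prod_univ_succ, ← mul_assoc]
    convert! h2 using 2 with θ
    rw [curL_apply]
    congr 1
    funext i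
    refine Fin.cases ?_ (fun j => ?_) i <;> simp

lemma series_deriv {ι : Type} {V : Type*} [NormedAddCommGroup V] [NormedSpace ℝ V] [CompleteSpace V]
    {T : ι → V} (c : ι → ℕ) (hT : Summable fun i => ‖T i‖) :
    HasDerivAt (fun t : ℝ => ∑' i, t ^ c i • T i) (∑' i, if c i = 1 then T i else 0) 0 := by
  have sT := hT.of_norm
  have s0 : Summable (fun i => if c i = 0 then T i else 0) := by
    refine Summable.of_norm_bounded hT fun i => ?_
    split_ifs <;> simp
  have s1 : Summable (fun i => if c i = 1 then T i else 0) := by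
    refine Summable.of_norm_bounded hT fun i => ?_
    split_ifs <;> simp
  have st : ∀ t : ℝ, |t| ≤ 1 → Summable (fun i => t ^ c i • T i) := fun t ht => by
    refine Summable.of_norm_bounded hT fun i => ?_
    rw [norm_smul, norm_pow]
    exact mul_le_of_le_one_left (norm_nonneg _) (pow_le_one₀ (norm_nonneg _) ht)
  have key : ∀ t : ℝ, |t| ≤ 1 → ‖(∑' i, t ^ c i • T i) - (∑' i, if c i = 0 then T i else 0) -
      t • (∑' i, if c i = 1 then T i else 0)‖ ≤ (∑' i, ‖T i‖) * t ^ 2 := by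
    intro t ht
    rw [← (s1).tsum_const_smul t, ← (st t ht).tsum_sub s0, ← ((st t ht).sub s0).tsum_sub (s1.const_smul t)]
    refine tsum_of_norm_bounded (hT.hasSum.mul_right (t ^ 2)) fun i => ?_
    rcases h : c i with _ | _ | n
    · simp; positivity
    · simp; positivity
    · simp only [Nat.add_eq_zero_iff, one_ne_zero, and_false, if_false, sub_zero, Nat.add_eq_right, smul_zero]
      rw [norm_smul, mul_comm, norm_pow, Real.norm_eq_abs, ← sq_abs t]
      refine mul_le_mul_of_nonneg_left ?_ (norm_nonneg _)
      rw [add_assoc, pow_add]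
      exact mul_le_of_le_one_left (by positivity) (pow_le_one₀ (abs_nonneg _) ht)
  have e0 : (∑' i, (0 : ℝ) ^ c i • T i) = ∑' i, if c i = 0 then T i else 0 := by
    congr 1; funext i
    split_ifs with h <;> simp [h]
  rw [hasDerivAt_iff_isLittleO, e0]
  have : (fun t : ℝ => t ^ 2) =o[𝓝 0] fun t => t - 0 := by
    simpa using Asymptotics.isLittleO_pow_id (𝕜 := ℝ) (by norm_num : 1 < 2)
  refine Asymptotics.IsBigO.trans_isLittleO ?_ this
  refine Asymptotics.IsBigO.of_bound (∑' i, ‖T i‖) ?_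
  filter_upwards [Metric.closedBall_mem_nhds (0 : ℝ) one_pos] with t ht
  rw [mem_closedBall_zero_iff, Real.norm_eq_abs] at ht
  rw [sub_zero, Real.norm_eq_abs, abs_of_nonneg (sq_nonneg t)]
  exact key t ht

end comp
end KAM
end PartJ

section PartK
open Real Filter Topology
namespace KAM
section comp
variable {m : ℕ} 

lemma hasSum_subsets : HasSum (fun i : Σ n : ℕ, Finset (Fin n) => ((1 : ℝ) / 4) ^ i.1) 2 := by
  have h1 : ∀ n : ℕ, HasSum (fun _ : Finset (Fin n) => ((1 : ℝ) / 4) ^ n) ((1 / 2) ^ n) := fun n => by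
    convert! hasSum_fintype (fun _ : Finset (Fin n) => ((1 : ℝ) / 4) ^ n) using 1
    simp only [Finset.sum_const, Finset.card_univ, Fintype.card_finset, Fintype.card_fin, nsmul_eq_mul]
    push_cast
    rw [← mul_pow]; norm_num
  have h2 : HasSum (fun n : ℕ => ((1 : ℝ) / 2) ^ n) 2 := by
    have := hasSum_geometric_of_lt_one (by norm_num) (by norm_num : (1 / 2 : ℝ) < 1)
    norm_num at this ⊢
    exact this
  refine h2.sigma_of_hasSum h1 ?_
  rw [summable_sigma_of_nonneg (fun p => by positivity)]
  exact ⟨fun n => (h1 n).summable, by simpa only [(h1 _).tsum_eq] using h2.summable⟩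

set_option maxHeartbeats 1000000 in
lemma compG_of_taylor {V : Type*} [NormedAddCommGroup V] [NormedSpace ℝ V] [CompleteSpace V] {y0 : E m}
    {G : Ph m → V} {p : ∀ n : ℕ, E m → (Ph m [×n]→L[ℝ] V)} {C R ρ0 : ℝ} (hR : 0 < R) (hC : 0 ≤ C)
    (hp : ∀ n, W ρ0 (C / R ^ n) (p n))
    (hG : ∀ θ x, ‖x‖ < R → HasSum (fun n => p n θ (fun _ => x)) (G ((θ, y0) + x)))
    (hd : ∀ θ x, ‖x‖ < R → DifferentiableAt ℝ G ((θ, y0) + x)) :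
    CompG G y0 ρ0 (2 * C * (1 + 4 / R) ^ 2) (R / 4) := by
  intro ρ a d X Δ hρ hρ0 wX wΔ ha hd'
  classical
  have ha0 := wX.nonneg
  have hd0 := wΔ.nonneg
  obtain ⟨r, hr⟩ : ∃ r : ℝ, r = R / 4 := ⟨_, rfl⟩
  rw [← hr] at ha hd'
  have hr0 : 0 < r := by rw [hr]; positivity
  have hdr : d / r ≤ 1 := (div_le_one hr0).2 hd'
  have hdr0 : 0 ≤ d / r := by positivity
  let ι := Σ n : ℕ, Finset (Fin n)
  obtain ⟨c, hc⟩ : ∃ c : ι → ℕ, ∀ i, c i = i.2ᶜ.card := ⟨_, fun _ => rfl⟩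
  obtain ⟨T, hT⟩ : ∃ T : ι → E m → V, ∀ i θ, T i θ = p i.1 θ (i.2.piecewise (fun _ => X θ) (fun _ => Δ θ)) :=
    ⟨_, fun _ _ => rfl⟩
  have wT : ∀ i (j : ℕ), j ≤ c i → W ρ (C * (d / r) ^ j * (1 / 4) ^ i.1) (T i) := by
    intro i j hj
    have h1 := W.multilinear hρ.le i.1 ((hp i.1).mono hρ0 le_rfl)
      (z := i.2.piecewise (fun _ => a) (fun _ => d)) (Z := i.2.piecewise (fun _ => X) (fun _ => Δ))
      (fun k => by by_cases hk : k ∈ i.2 <;> simp [hk, wX, wΔ])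
    have e : T i = fun θ => p i.1 θ (fun k => i.2.piecewise (fun _ => X) (fun _ => Δ) k θ) := by
      funext θ
      rw [hT]; congr 1; funext k
      by_cases hk : k ∈ i.2 <;> simp [hk]
    rw [e]
    refine h1.mono le_rfl ?_
    have e2 : ∏ k, i.2.piecewise (fun _ => a) (fun _ => d) k = a ^ i.2.card * d ^ c i := by
      rw [Finset.prod_piecewise]
      simp [hc, Finset.compl_eq_univ_sdiff]
    rw [e2]
    have e3 : i.1 = i.2.card + c i := by
      rw [hc, Finset.card_add_card_compl]; simp
    have e4 : d ^ c i = r ^ c i * (d / r) ^ c i := by rw [← mul_pow]; congr 1; field_simp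
    calc C / R ^ i.1 * (a ^ i.2.card * d ^ c i) ≤ C / R ^ i.1 * (r ^ i.2.card * (r ^ c i * (d / r) ^ j)) := by
          rw [e4]
          have := pow_le_pow_of_le_one hdr0 hdr hj
          gcongr
      _ = C / R ^ i.1 * (r ^ i.1 * (d / r) ^ j) := by
          have e5 : r ^ i.1 = r ^ i.2.card * r ^ c i := by
            rw [← pow_add]; exact congrArg (fun z : ℕ => r ^ z) e3
          rw [e5]; ring
      _ = C * (d / r) ^ j * (1 / 4) ^ i.1 := by
          rw [hr, div_pow R, one_div, inv_pow]; field_simp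
  have gen : ∀ (e : ι → ℝ) (j : ℕ) (F : E m → V), (∀ i, |e i| ≤ 1) → (∀ i, c i < j → e i = 0) →
      (∀ θ, HasSum (fun i => e i • T i θ) (F θ)) → W ρ (2 * C * (d / r) ^ j) F := by
    intro e j F he1 he2 hF
    have hs : HasSum (fun i : ι => C * (d / r) ^ j * (1 / 4) ^ i.1) (2 * C * (d / r) ^ j) := by
      have := hasSum_subsets.mul_left (C * (d / r) ^ j)
      convert! this using 1; ring
    refine W.hasSum (M := fun i : ι => C * (d / r) ^ j * (1 / 4) ^ i.1) (g := fun i θ => e i • T i θ) (fun i => ?_)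
      hρ.le hs hF
    by_cases hi : c i < j
    · simp only [he2 i hi, zero_smul]
      exact (W.zero ρ).mono le_rfl (by positivity)
    · refine ((wT i j (by omega)).smul (e i)).mono le_rfl ?_
      exact mul_le_of_le_one_left (by positivity) (he1 i)
  have sT : ∀ θ, Summable (fun i => ‖T i θ‖) := fun θ => by
    refine Summable.of_nonneg_of_le (fun _ => norm_nonneg _) (fun i => (wT i 0 (by omega)).norm_le hρ.le θ)
      (hasSum_subsets.summable.mul_left _)
  have hsum : ∀ θ (t : ℝ), |t| ≤ 1 → HasSum (fun i => t ^ c i • T i θ) (G ((θ, y0) + X θ + t • Δ θ)) := by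
    intro θ t ht
    have hx : ‖X θ + t • Δ θ‖ < R := by
      have h1 := wX.norm_le hρ.le θ
      have h2 := wΔ.norm_le hρ.le θ
      have h3 : ‖t • Δ θ‖ ≤ d := by
        rw [norm_smul]; exact (mul_le_of_le_one_left (norm_nonneg _) ht).trans h2
      have := norm_add_le (X θ) (t • Δ θ)
      linarith
    have := hG θ _ hx
    rw [← add_assoc] at this
    refine this.sigma_of_hasSum (γ := fun n => Finset (Fin n)) (fun n => ?_) ?_
    · have e1 := (p n θ).map_add_univ (fun _ => X θ) (fun _ => t • Δ θ)
      have e2 : (fun _ : Fin n => X θ) + (fun _ => t • Δ θ) = fun _ => X θ + t • Δ θ := rfl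
      rw [e2] at e1
      rw [e1]
      convert! hasSum_fintype _ using 1
      refine Finset.sum_congr rfl fun s _ => ?_
      have e3 := (p n θ).toMultilinearMap.map_piecewise_smul (fun _ => t) (s.piecewise (fun _ => X θ) (fun _ => Δ θ)) sᶜ
      rw [hT, hc, Finset.prod_const] at *
      refine Eq.trans ?_ e3
      show p n θ _ = p n θ _
      congr 1
      funext k
      by_cases hk : k ∈ s <;> simp [hk]
    · refine Summable.of_norm_bounded (sT θ) fun i => ?_
      rw [norm_smul, norm_pow]
      exact mul_le_of_le_one_left (norm_nonneg _) (pow_le_one₀ (norm_nonneg _) ht)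
  have hs0 : ∀ θ, HasSum (fun i => (0 : ℝ) ^ c i • T i θ) (G ((θ, y0) + X θ)) := fun θ => by
    simpa using hsum θ 0 (by simp)
  have hs1 : ∀ θ, HasSum (fun i => (1 : ℝ) • T i θ) (G ((θ, y0) + X θ + Δ θ)) := fun θ => by
    simpa using hsum θ 1 (by simp)
  have hsd : ∀ θ, HasSum (fun i => (if c i = 1 then (1 : ℝ) else 0) • T i θ) (fderiv ℝ G ((θ, y0) + X θ) (Δ θ)) := by
    intro θ
    have h1 := series_deriv c (sT θ)
    have h2 : HasDerivAt (fun t : ℝ => G ((θ, y0) + X θ + t • Δ θ)) (fderiv ℝ G ((θ, y0) + X θ) (Δ θ)) 0 := by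
      have hx : ‖X θ‖ < R := by
        have h1 := wX.norm_le hρ.le θ
        linarith
      have h3 : HasDerivAt (fun t : ℝ => (θ, y0) + X θ + t • Δ θ) (Δ θ) 0 := by
        have := ((hasDerivAt_id (0 : ℝ)).smul_const (Δ θ)).const_add ((θ, y0) + X θ)
        simpa using this
      have h4 : HasFDerivAt G (fderiv ℝ G ((θ, y0) + X θ)) ((θ, y0) + X θ + (0 : ℝ) • Δ θ) := by
        rw [zero_smul, add_zero]; exact (hd θ _ hx).hasFDerivAt
      exact h4.comp_hasDerivAt 0 h3
    have h5 := h1.congr_of_eventuallyEq (f₁ := fun t : ℝ => G ((θ, y0) + X θ + t • Δ θ)) (by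
      filter_upwards [Metric.closedBall_mem_nhds (0 : ℝ) one_pos] with t ht
      rw [mem_closedBall_zero_iff, Real.norm_eq_abs] at ht
      exact (hsum θ t ht).tsum_eq.symm)
    rw [h2.unique h5]
    have : Summable (fun i => if c i = 1 then T i θ else 0) := by
      refine Summable.of_norm_bounded (sT θ) fun i => ?_
      split_ifs <;> simp
    convert! this.hasSum using 2 with i
    split_ifs <;> simp
  have hRr : ∀ j : ℕ, j ≤ 2 → 2 * C * (d / r) ^ j ≤ 2 * C * (1 + 4 / R) ^ 2 * d ^ j := by
    intro j hj
    have h1 : 0 < 4 / R := by positivity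
    have : (d / r) ^ j = (4 / R) ^ j * d ^ j := by rw [hr, ← mul_pow]; congr 1; field_simp
    rw [this, mul_assoc (2 * C) _ (d ^ j)]
    gcongr
    calc (4 / R) ^ j ≤ (1 + 4 / R) ^ j := by gcongr; linarith
      _ ≤ (1 + 4 / R) ^ 2 := pow_le_pow_right₀ (by linarith) hj
  refine ⟨?_, ?_, ?_⟩
  · refine (gen _ 0 _ (fun i => ?_) (fun i hi => by omega) hs0).mono le_rfl (by simpa using hRr 0 (by norm_num))
    rw [abs_pow, abs_zero]; exact pow_le_one₀ le_rfl zero_le_one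
  · refine (gen (fun i => 1 - 0 ^ c i) 1 _ (fun i => ?_) (fun i hi => ?_) (fun θ => ?_)).mono le_rfl
      (by simpa using hRr 1 (by norm_num))
    · rcases h : c i with _ | n <;> simp
    · have : c i = 0 := by omega
      simp [this]
    · simpa only [sub_smul] using (hs1 θ).sub (hs0 θ)
  · refine (gen (fun i => 1 - 0 ^ c i - (if c i = 1 then (1 : ℝ) else 0)) 2 _ (fun i => ?_) (fun i hi => ?_)
      (fun θ => ?_)).mono le_rfl (hRr 2 le_rfl)
    · rcases h : c i with _ | _ | n <;> simp
    · have : c i = 0 ∨ c i = 1 := by omega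
      rcases this with h | h <;> simp [h]
    · simpa only [sub_smul] using ((hs1 θ).sub (hs0 θ)).sub (hsd θ)

end comp
end KAM
end PartK

section PartL
open Real Filter Topology
namespace KAM
section bd
variable {m : ℕ} 

/-- Cauchy-type bounds and Taylor expansion at a point. -/
structure Bd {X V : Type*} [NormedAddCommGroup X] [NormedSpace ℝ X] [NormedAddCommGroup V] [NormedSpace ℝ V]
    (G : X → V) (R C : ℝ) (z : X) : Prop where
  bound : ∀ N, ‖iteratedFDeriv ℝ N G z‖ ≤ C * N.factorial / R ^ N
  sum : ∀ x, ‖x‖ < R → HasSum (fun N : ℕ => (N.factorial : ℝ)⁻¹ • iteratedFDeriv ℝ N G z (fun _ => x)) (G (z + x))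
  ana : ∀ x, ‖x‖ < R → AnalyticAt ℝ G (z + x)

variable {X V : Type*} [NormedAddCommGroup X] [NormedSpace ℝ X] [NormedAddCommGroup V] [NormedSpace ℝ V]

lemma Bd.mono {G : X → V} {R C R' C' : ℝ} {z : X} (h : Bd G R C z) (hR' : 0 < R') (hR : R' ≤ R) (hC : C ≤ C') :
    Bd G R' C' z := by
  refine ⟨fun N => (h.bound N).trans ?_, fun x hx => h.sum x (hx.trans_le hR), fun x hx => h.ana x (hx.trans_le hR)⟩
  have hC0 : 0 ≤ C := by simpa using (norm_nonneg _).trans (h.bound 0)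
  have := hC0.trans hC
  gcongr

set_option maxHeartbeats 1000000 in
lemma bd_local [CompleteSpace V] {G : X → V} {z0 : X} (hG : AnalyticAt ℝ G z0) :
    ∃ R C : ℝ, 0 < R ∧ ∀ z, ‖z - z0‖ ≤ R → Bd G R C z := by
  obtain ⟨p, r0, hp⟩ := hG
  obtain ⟨s, hs0, hs⟩ := ENNReal.lt_iff_exists_nnreal_btwn.1 hp.r_pos
  have hs0' : 0 < s := by exact_mod_cast hs0
  obtain ⟨r, hr⟩ : ∃ r : NNReal, r = s / 2 := ⟨_, rfl⟩
  have hr0 : 0 < r := by rw [hr]; positivity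
  have hrr : (r + r : ENNReal) < r0 := by
    refine lt_of_eq_of_lt ?_ hs
    rw [← ENNReal.coe_add, hr, add_halves]
  have hrr' : (r + r : ENNReal) < p.radius := hrr.trans_le hp.r_le
  have hr1 : (r : ENNReal) < r0 := lt_of_le_of_lt le_self_add hrr
  have S := p.changeOriginSeries_summable_aux₁ hrr'
  refine ⟨r, ((∑' s : Σ k l : ℕ, { s : Finset (Fin (k + l)) // s.card = l },
      ‖p (s.1 + s.2.1)‖₊ * r ^ s.2.1 * r ^ s.1 : NNReal) : ℝ), hr0, fun z hz => ?_⟩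
  obtain ⟨x, rfl⟩ : ∃ x, z = z0 + x := ⟨z - z0, by abel⟩
  rw [add_sub_cancel_left] at hz
  have hx : ‖x‖₊ ≤ r := hz
  have hx' : (‖x‖₊ : ENNReal) ≤ r := by exact_mod_cast hx
  have hq := hp.changeOrigin (y := x) (hx'.trans_lt hr1)
  have hrad : (r : ENNReal) ≤ r0 - ‖x‖₊ := by
    refine ENNReal.le_sub_of_add_le_right (by simp) ?_
    exact (add_le_add_right hx' _).trans hrr.le
  have hball : ∀ y : X, ‖y‖ < r → y ∈ Metric.eball (0 : X) (r0 - ‖x‖₊) := fun y hy => by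
    rw [Metric.mem_eball, edist_zero_right]
    refine lt_of_lt_of_le ?_ hrad
    have : ‖y‖₊ < r := hy
    exact_mod_cast this
  refine ⟨fun N => ?_, fun y hy => hq.hasSum_iteratedFDeriv (hball y hy), fun y hy => ?_⟩
  · have h1 : ‖p.changeOrigin x N‖₊ * r ^ N ≤ ∑' s : Σ k l : ℕ, { s : Finset (Fin (k + l)) // s.card = l },
      ‖p (s.1 + s.2.1)‖₊ * r ^ s.2.1 * r ^ s.1 := by
      have h2 := p.nnnorm_changeOrigin_le N (hx'.trans_lt (hr1.trans_le hp.r_le))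
      have h3 := p.changeOriginSeries_summable_aux₂ (hr1.trans_le hp.r_le) N
      have h4 : ‖p.changeOrigin x N‖₊ ≤
          ∑' s : Σ l : ℕ, { s : Finset (Fin (N + l)) // s.card = l }, ‖p (N + s.1)‖₊ * r ^ s.1 := by
        refine h2.trans (Summable.tsum_le_tsum (fun s => by gcongr)
          (p.changeOriginSeries_summable_aux₂ (hx'.trans_lt (hr1.trans_le hp.r_le)) N) h3)
      have h5 := NNReal.tsum_comp_le_tsum_of_inj S (i := fun t => ⟨N, t⟩)
        (fun a b hab => eq_of_heq (Sigma.mk.inj hab).2)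
      refine le_trans ?_ h5
      have h6 := NNReal.tsum_mul_right (L := SummationFilter.unconditional _) (fun s : Σ l : ℕ, { s : Finset (Fin (N + l)) // s.card = l } =>
        ‖p (N + s.1)‖₊ * r ^ s.1) (r ^ N)
      exact (mul_le_mul_left h4 _).trans_eq h6.symm
    have h2 : ‖iteratedFDeriv ℝ N G (z0 + x)‖ ≤ N.factorial * ‖p.changeOrigin x N‖ := by
      refine ContinuousMultilinearMap.opNorm_le_bound (by positivity) fun v => ?_
      rw [hq.iteratedFDeriv_eq_sum_of_completeSpace]
      refine (norm_sum_le _ _).trans ?_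
      have : ∀ σ ∈ (Finset.univ : Finset (Equiv.Perm (Fin N))),
          ‖p.changeOrigin x N (fun i => v (σ i))‖ ≤ ‖p.changeOrigin x N‖ * ∏ i, ‖v i‖ := fun σ _ => by
        refine (ContinuousMultilinearMap.le_opNorm _ _).trans_eq ?_
        rw [Equiv.prod_comp σ (fun i => ‖v i‖)]
      refine (Finset.sum_le_sum this).trans_eq ?_
      simp [Fintype.card_perm]; ring
    have h1' : ‖p.changeOrigin x N‖ * (r : ℝ) ^ N ≤ _ := NNReal.coe_le_coe.2 h1
    rw [le_div_iff₀ (by positivity)]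
    calc _ ≤ N.factorial * ‖p.changeOrigin x N‖ * (r : ℝ) ^ N := by gcongr
      _ = N.factorial * (‖p.changeOrigin x N‖ * (r : ℝ) ^ N) := by ring
      _ ≤ N.factorial * _ := mul_le_mul_of_nonneg_left h1' (by positivity)
      _ = _ := mul_comm _ _
  · refine hq.analyticAt_of_mem ?_
    have := hball y hy
    simpa [Metric.mem_eball, edist_eq_enorm_sub] using this

lemma bd_unif [CompleteSpace V] {G : Ph m → V} {y0 : E m} (hG : ∀ θ, AnalyticAt ℝ G (θ, y0))
    (hper : ∀ (θ : E m) (l : Fin m → ℤ) (y : E m), G (θ + WithLp.toLp 2 (fun i => (l i : ℝ)), y) = G (θ, y)) :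
    ∃ R C : ℝ, 0 < R ∧ 0 ≤ C ∧ ∀ θ : E m, Bd G R C (θ, y0) := by
  have hK : IsCompact ((WithLp.toLp 2) '' (Set.Icc (0 : Fin m → ℝ) 1) : Set (E m)) :=
    isCompact_Icc.image (PiLp.continuous_toLp 2 _)
  have main : ∃ R C : ℝ, 0 < R ∧ 0 ≤ C ∧ ∀ θ ∈ ((WithLp.toLp 2) '' (Set.Icc (0 : Fin m → ℝ) 1) : Set (E m)),
      Bd G R C (θ, y0) := by
    refine hK.induction_on (p := fun s => ∃ R C : ℝ, 0 < R ∧ 0 ≤ C ∧ ∀ θ ∈ s, Bd G R C (θ, y0)) ?_ ?_ ?_ ?_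
    · exact ⟨1, 0, one_pos, le_rfl, by simp⟩
    · rintro s t hst ⟨R, C, h1, h2, h3⟩
      exact ⟨R, C, h1, h2, fun θ hθ => h3 θ (hst hθ)⟩
    · rintro s t ⟨R, C, h1, h2, h3⟩ ⟨R', C', h1', h2', h3'⟩
      have hm : 0 < min R R' := lt_min h1 h1'
      refine ⟨min R R', max C C', hm, h2.trans (le_max_left _ _), ?_⟩
      rintro θ (hθ | hθ)
      · exact (h3 θ hθ).mono hm (min_le_left _ _) (le_max_left _ _)
      · exact (h3' θ hθ).mono hm (min_le_right _ _) (le_max_right _ _)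
    · intro θ _
      obtain ⟨R, C, hR, h⟩ := bd_local (hG θ)
      refine ⟨Metric.closedBall θ R, mem_nhdsWithin_of_mem_nhds (Metric.closedBall_mem_nhds θ hR), R, C, hR, ?_, ?_⟩
      · simpa using (norm_nonneg _).trans ((h (θ, y0) (by simpa using hR.le)).bound 0)
      · intro θ' hθ'
        refine h _ ?_
        rw [Metric.mem_closedBall, dist_eq_norm] at hθ'
        simpa [Prod.norm_def, hR.le] using hθ'
  obtain ⟨R, C, hR, hC, h⟩ := main
  refine ⟨R, C, hR, hC, fun θ => ?_⟩
  obtain ⟨a, ha⟩ : ∃ a : E m, a = WithLp.toLp 2 (fun i => ((-⌊θ i⌋ : ℤ) : ℝ)) := ⟨_, rfl⟩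
  have hGa : (fun z : Ph m => G (z + (a, 0))) = G := by
    funext z
    have := hper z.1 (fun i => -⌊θ i⌋) z.2
    rw [← ha] at this
    simpa [Prod.add_def] using this
  have hθ : θ + a ∈ ((WithLp.toLp 2) '' (Set.Icc (0 : Fin m → ℝ) 1) : Set (E m)) := by
    refine ⟨fun i => Int.fract (θ i), ⟨fun i => Int.fract_nonneg _, fun i => (Int.fract_lt_one _).le⟩, ?_⟩
    ext i
    rw [ha]
    show Int.fract (θ i) = θ i + ((-⌊θ i⌋ : ℤ) : ℝ)
    push_cast
    rw [← Int.self_sub_floor, sub_eq_add_neg]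
  have hb := h _ hθ
  have e0 : ∀ z : Ph m, G (z + (a, 0)) = G z := fun z => congrFun hGa z
  have e1 : ((θ + a, y0) : Ph m) = (θ, y0) + (a, 0) := by simp
  have e2 : ∀ N, iteratedFDeriv ℝ N G (θ + a, y0) = iteratedFDeriv ℝ N G (θ, y0) := fun N => by
    rw [e1, ← iteratedFDeriv_comp_add_right, hGa]
  refine ⟨fun N => ?_, fun x hx => ?_, fun x hx => ?_⟩
  · rw [← e2]; exact hb.bound N
  · have := hb.sum x hx
    simp only [e2] at this
    rw [e1, add_right_comm, e0] at this
    exact this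
  · have := hb.ana x hx
    have h3 : AnalyticAt ℝ (fun z : Ph m => G (z + (a, 0))) ((θ, y0) + x) := by
      rw [e1, add_right_comm] at this
      exact this.comp_of_eq (analyticAt_id.add analyticAt_const) rfl
    rwa [hGa] at h3

end bd
end KAM
end PartL

section PartM
open Real Filter Topology MeasureTheory
namespace KAM
section fourier
variable {m : ℕ} {V : Type*} [NormedAddCommGroup V] [NormedSpace ℝ V]

/-- The unit cube based at `a`. -/
def cube (a : Fin m → ℝ) : Set (Fin m → ℝ) := {x | ∀ i, x i ∈ Set.Ioc (a i) (a i + 1)}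

lemma cube_eq (a : Fin m → ℝ) : cube a = Set.univ.pi fun i => Set.Ioc (a i) (a i + 1) := by
  ext x; simp [cube]

lemma cube_meas (a : Fin m → ℝ) : MeasurableSet (cube a) := by
  rw [cube_eq]; exact MeasurableSet.univ_pi fun i => measurableSet_Ioc

lemma cube_vol (a : Fin m → ℝ) : volume (cube a) = 1 := by
  rw [cube_eq, Real.volume_pi_Ioc]; simp

instance cube_prob : IsProbabilityMeasure (volume.restrict (cube (0 : Fin m → ℝ))) :=
  ⟨by rw [Measure.restrict_apply_univ, cube_vol]⟩

/-- Periodicity. -/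
def Per {β : Type*} (F : (Fin m → ℝ) → β) : Prop := ∀ (x : Fin m → ℝ) (l : Fin m → ℤ), F (x + fun i => (l i : ℝ)) = F x

/-- The induced function on the torus. -/
noncomputable def tor {β : Type*} (F : (Fin m → ℝ) → β) (z : UnitAddTorus (Fin m)) : β :=
  F fun i => (AddCircle.equivIoc 1 0 (z i)).1

lemma tor_coe {β : Type*} {F : (Fin m → ℝ) → β} (hF : Per F) (x : Fin m → ℝ) :
    tor F (fun i => (x i : UnitAddCircle)) = F x := by
  unfold tor
  have : ∀ i, ∃ l : ℤ, (AddCircle.equivIoc 1 0 (x i : UnitAddCircle)).1 = x i + l := fun i => by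
    have h := (AddCircle.equivIoc (1 : ℝ) 0).symm_apply_apply (x i : UnitAddCircle)
    have h2 : (((AddCircle.equivIoc (1 : ℝ) 0 (x i : UnitAddCircle)).1 : ℝ) : UnitAddCircle) = (x i : UnitAddCircle) := h
    rw [← sub_eq_zero, ← AddCircle.coe_sub, AddCircle.coe_eq_zero_iff] at h2
    obtain ⟨n, hn⟩ := h2
    refine ⟨n, ?_⟩
    rw [zsmul_eq_mul, mul_one] at hn
    rw [hn]; ring
  choose l hl using this
  rw [← hF x l]
  congr 1; funext i; simpa using hl i

lemma cube_shift {F : (Fin m → ℝ) → V} (hF : Per F) (a : Fin m → ℝ) :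
    ∫ x in cube (0 : Fin m → ℝ), F (x + a) = ∫ x in cube (0 : Fin m → ℝ), F x := by
  have h1 := UnitAddTorus.integral_preimage (tor F) a
  have h2 := UnitAddTorus.integral_preimage (tor F) (0 : Fin m → ℝ)
  rw [h1] at h2
  simp only [tor_coe hF] at h2
  refine Eq.trans ?_ h2
  have := (measurePreserving_add_right (volume : Measure (Fin m → ℝ)) a).setIntegral_preimage_emb
    (measurableEmbedding_addRight a) F (cube a)
  refine Eq.trans ?_ this
  congr 2
  ext x
  simp only [cube, Set.mem_ofPred_eq, Set.mem_preimage, Set.mem_Ioc, Pi.add_apply, Pi.zero_apply]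
  refine forall_congr' fun i => and_congr ⟨fun h => by linarith, fun h => by linarith⟩
    ⟨fun h => by linarith, fun h => by linarith⟩

lemma cube_sub : cube (0 : Fin m → ℝ) ⊆ Set.Icc 0 1 := fun x hx =>
  ⟨fun i => (hx i).1.le, fun i => by simpa using (hx i).2⟩

lemma cube_int {F : (Fin m → ℝ) → V} (hF : Continuous F) : IntegrableOn F (cube (0 : Fin m → ℝ)) :=
  (hF.integrableOn_Icc (a := 0) (b := 1)).mono_set cube_sub

lemma cube_norm {F : (Fin m → ℝ) → V} {B : ℝ} (hB : ∀ x, ‖F x‖ ≤ B) :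
    ‖∫ x in cube (0 : Fin m → ℝ), F x‖ ≤ B := by
  have := norm_integral_le_of_norm_le_const (μ := volume.restrict (cube (0 : Fin m → ℝ))) (f := F) (C := B)
    (Eventually.of_forall hB)
  simpa using this

lemma cube_deriv {F : (Fin m → ℝ) → V} (hF : Per F) (hd : ContDiff ℝ 1 F) (e : Fin m → ℝ) :
    ∫ x in cube (0 : Fin m → ℝ), fderiv ℝ F x e = 0 := by
  have hc : Continuous (fderiv ℝ F) := hd.continuous_fderiv (by norm_num)
  have hdiff : Differentiable ℝ F := hd.differentiable (by norm_num)
  obtain ⟨B, hB⟩ := (isCompact_closedBall (0 : Fin m → ℝ) (1 + ‖e‖)).exists_bound_of_continuousOn hc.continuousOn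
  have key := hasDerivAt_integral_of_dominated_loc_of_deriv_le (μ := volume.restrict (cube (0 : Fin m → ℝ)))
    (F := fun (t : ℝ) x => F (x + t • e)) (F' := fun t x => fderiv ℝ F (x + t • e) e) (x₀ := 0)
    (s := Metric.ball (0 : ℝ) 1) (bound := fun _ => B * ‖e‖) (Metric.ball_mem_nhds _ one_pos)
    (Eventually.of_forall fun t => (hd.continuous.comp (by fun_prop)).aestronglyMeasurable)
    (by simpa using (cube_int hd.continuous).integrable)
    (by
      have : Continuous fun x : Fin m → ℝ => fderiv ℝ F (x + (0 : ℝ) • e) e :=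
        (hc.comp (by fun_prop)).clm_apply continuous_const
      exact this.aestronglyMeasurable)
    (by
      refine (ae_restrict_iff' (cube_meas 0)).2 (Eventually.of_forall fun x hx t ht => ?_)
      refine (ContinuousLinearMap.le_opNorm _ _).trans ?_
      gcongr
      refine hB _ ?_
      rw [mem_closedBall_zero_iff]
      rw [mem_ball_zero_iff] at ht
      refine (norm_add_le _ _).trans (add_le_add ?_ ?_)
      · rw [pi_norm_le_iff_of_nonneg zero_le_one]
        intro i
        have := hx i
        simp only [Pi.zero_apply, zero_add, Set.mem_Ioc] at this
        rw [Real.norm_eq_abs, abs_of_pos this.1]; exact this.2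
      · rw [norm_smul]; exact mul_le_of_le_one_left (norm_nonneg _) ht.le)
    (integrable_const _)
    (Eventually.of_forall fun x t _ => by
      have h3 : HasDerivAt (fun t : ℝ => x + t • e) e t := by
        have := ((hasDerivAt_id t).smul_const e).const_add x
        simpa using this
      exact (hdiff (x + t • e)).hasFDerivAt.comp_hasDerivAt t h3)
  have h1 := key.2
  simp only [cube_shift hF] at h1
  have h2 := h1.unique (hasDerivAt_const _ _)
  simpa using h2

/-- Fourier coefficients with a phase. -/
noncomputable def cf (k : Fin m → ℤ) (φ : ℝ) (g : E m → V) : V :=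
  ∫ x in cube (0 : Fin m → ℝ), Real.cos (kd k (WithLp.toLp 2 x) + φ) • g (WithLp.toLp 2 x)

lemma cf_deriv {g : E m → V} (hg : ContDiff ℝ 1 g)
    (hper : ∀ (θ : E m) (l : Fin m → ℤ), g (θ + WithLp.toLp 2 (fun i => (l i : ℝ))) = g θ)
    (k : Fin m → ℤ) (φ : ℝ) (e : E m) :
    cf k φ (fun θ => fderiv ℝ g θ e) = kd k e • cf k (φ - π / 2) g := by
  let ι : (Fin m → ℝ) →L[ℝ] E m := (EuclideanSpace.equiv (Fin m) ℝ).symm.toContinuousLinearMap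
  have hι : ∀ x, ι x = WithLp.toLp 2 x := fun _ => rfl
  obtain ⟨F, hF⟩ : ∃ F : (Fin m → ℝ) → V, ∀ x, F x = Real.cos (kd k (ι x) + φ) • g (ι x) := ⟨_, fun _ => rfl⟩
  have hF' : F = fun x => Real.cos (kd k (ι x) + φ) • g (ι x) := funext hF
  have hFd : ContDiff ℝ 1 F := by
    rw [hF']
    exact (Real.contDiff_cos.comp (((kd k).contDiff.comp ι.contDiff).add contDiff_const)).smul (hg.comp ι.contDiff)
  have hFp : Per F := by
    intro x l
    have e1 : ι (x + fun i => (l i : ℝ)) = ι x + WithLp.toLp 2 (fun i => (l i : ℝ)) := by rw [map_add]; rfl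
    obtain ⟨N, hN⟩ := kd_period k l
    rw [hF, hF, e1, hper, map_add, hN, add_right_comm, Real.cos_add_int_mul_two_pi]
  have hder : ∀ x, fderiv ℝ F x (WithLp.ofLp e) =
      Real.cos (kd k (ι x) + φ) • fderiv ℝ g (ι x) e - kd k e • (Real.cos (kd k (ι x) + (φ - π / 2)) • g (ι x)) := by
    intro x
    have h1 : HasFDerivAt (fun x => kd k (ι x) + φ) ((kd k).comp ι) x := ((kd k).comp ι).hasFDerivAt.add_const φ
    have h2 := h1.cos
    have h3 : HasFDerivAt (fun x => g (ι x)) ((fderiv ℝ g (ι x)).comp ι) x :=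
      (hg.differentiable (by norm_num) (ι x)).hasFDerivAt.comp x ι.hasFDerivAt
    have h4 : HasFDerivAt (fun x => Real.cos (kd k (ι x) + φ) • g (ι x)) _ x := h2.smul h3
    rw [hF', h4.fderiv]
    have e1 : Real.cos (kd k (ι x) + (φ - π / 2)) = Real.sin (kd k (ι x) + φ) := by
      rw [← Real.cos_sub_pi_div_two]; ring_nf
    have e2 : ι (WithLp.ofLp e) = e := rfl
    rw [e1]
    simp only [add_apply, smul_apply, ContinuousLinearMap.comp_apply, ContinuousLinearMap.smulRight_apply, e2]
    rw [smul_smul, smul_eq_mul, sub_eq_add_neg, ← neg_smul]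
    congr 2; ring
  have h0 := cube_deriv hFp hFd (WithLp.ofLp e)
  simp only [hder] at h0
  have c1 : Continuous fun x => Real.cos (kd k (ι x) + φ) • fderiv ℝ g (ι x) e :=
    (Real.continuous_cos.comp (by fun_prop)).smul
      (((hg.continuous_fderiv (by norm_num)).comp ι.continuous).clm_apply continuous_const)
  have c2 : Continuous fun x => kd k e • (Real.cos (kd k (ι x) + (φ - π / 2)) • g (ι x)) :=
    ((Real.continuous_cos.comp (by fun_prop)).smul (hg.continuous.comp ι.continuous)).const_smul _
  rw [integral_sub (cube_int c1) (cube_int c2), sub_eq_zero, integral_smul] at h0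
  exact h0

lemma cf_decay {g : ℕ → E m → V} (hg : ∀ l, ContDiff ℝ 1 (g l))
    (hper : ∀ l (θ : E m) (n : Fin m → ℤ), g l (θ + WithLp.toLp 2 (fun i => (n i : ℝ))) = g l θ)
    {B : ℕ → ℝ} (hB : ∀ l θ, ‖g l θ‖ ≤ B l) (e : E m) (hd : ∀ l θ, fderiv ℝ (g l) θ e = g (l + 1) θ)
    (k : Fin m → ℤ) (l n : ℕ) (φ : ℝ) : |kd k e| ^ l * ‖cf k φ (g n)‖ ≤ B (n + l) := by
  induction l generalizing n φ with
  | zero =>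
    rw [pow_zero, one_mul]
    refine cube_norm fun x => ?_
    rw [norm_smul]
    exact (mul_le_of_le_one_left (norm_nonneg _) (Real.abs_cos_le_one _)).trans (hB _ _)
  | succ l ih =>
    have h1 := cf_deriv (hg n) (hper n) k (φ + π / 2) e
    simp only [hd, add_sub_cancel_right] at h1
    have h2 := ih (n + 1) (φ + π / 2)
    rw [show n + (l + 1) = n + 1 + l by ring]
    refine le_trans (le_of_eq ?_) h2
    have : (fun θ => g (n + 1) θ) = g (n + 1) := rfl
    rw [this] at h1
    rw [h1, norm_smul, pow_succ, Real.norm_eq_abs]; ring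

end fourier
end KAM
end PartM

section PartN
open Real Filter Topology MeasureTheory
namespace KAM
section inv
variable {m : ℕ} {V : Type*} [NormedAddCommGroup V] [NormedSpace ℝ V]

lemma summable_int {σ : ℝ} (hσ : 0 < σ) : Summable fun n : ℤ => Real.exp (-(σ * |(n : ℝ)|)) := by
  have h : Summable fun n : ℕ => Real.exp (-(σ * (n : ℝ))) := by
    have := Real.summable_exp_nat_mul_iff.2 (show -σ < 0 by linarith)
    refine this.congr fun n => ?_
    congr 1; ring
  refine Summable.of_nat_of_neg ?_ ?_
  · simpa using h
  · simpa using h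

lemma summable_kn {σ : ℝ} (hσ : 0 < σ) : ∀ m : ℕ, Summable fun k : Fin m → ℤ => Real.exp (-(σ * kn k)) := by
  intro m
  induction m with
  | zero => exact (hasSum_fintype _).summable
  | succ m ih =>
    have h1 := (summable_int hσ).mul_of_nonneg ih (fun _ => (Real.exp_pos _).le) (fun _ => (Real.exp_pos _).le)
    rw [← (Fin.consEquiv (fun _ : Fin (m + 1) => ℤ)).summable_iff]
    refine h1.congr fun p => ?_
    rw [← Real.exp_add]
    congr 1
    simp [kn, Fin.sum_univ_succ, Fin.consEquiv]
    ring

lemma mF_coe (n : Fin m → ℤ) (x : Fin m → ℝ) :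
    UnitAddTorus.mFourier n (fun i => (x i : UnitAddCircle)) =
      Complex.cos (kd n (WithLp.toLp 2 x) : ℝ) + Complex.sin (kd n (WithLp.toLp 2 x) : ℝ) * Complex.I := by
  rw [← Complex.exp_mul_I, kd_apply]
  simp only [UnitAddTorus.mFourier, ContinuousMap.coe_mk, fourier_coe_apply]
  rw [← Complex.exp_sum]
  congr 1
  push_cast
  rw [Finset.sum_mul]
  refine Finset.sum_congr rfl fun i _ => ?_
  simp; ring

lemma tor_cont {β : Type*} [TopologicalSpace β] {F : (Fin m → ℝ) → β} (hF : Per F) (hc : Continuous F) : Continuous (tor F) := by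
  have q : IsOpenQuotientMap (Pi.map fun (i : Fin m) (x : ℝ) => (x : UnitAddCircle)) :=
    IsOpenQuotientMap.piMap fun i => QuotientAddGroup.isOpenQuotientMap_mk
  rw [q.isQuotientMap.continuous_iff]
  convert! hc using 1
  funext x
  exact tor_coe hF x

lemma real_inv {g : (Fin m → ℝ) → ℝ} (hg : Continuous g) (hper : Per g) {A B : (Fin m → ℤ) → ℝ}
    (hA : ∀ k, A k = ∫ x in cube (0 : Fin m → ℝ), Real.cos (kd k (WithLp.toLp 2 x)) * g x)
    (hB : ∀ k, B k = ∫ x in cube (0 : Fin m → ℝ), Real.sin (kd k (WithLp.toLp 2 x)) * g x)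
    (sA : Summable A) (sB : Summable B) (x : Fin m → ℝ) :
    HasSum (fun k => Real.cos (kd k (WithLp.toLp 2 x)) * A k + Real.sin (kd k (WithLp.toLp 2 x)) * B k) (g x) := by
  let gc : (Fin m → ℝ) → ℂ := fun x => (g x : ℂ)
  have hgc : Per gc := fun x l => by simp only [gc, hper x l]
  have hc : Continuous gc := Complex.continuous_ofReal.comp hg
  let F : C(UnitAddTorus (Fin m), ℂ) := ⟨tor gc, tor_cont hgc hc⟩
  have hcL : ∀ k : Fin m → ℤ, Continuous fun x : Fin m → ℝ => kd k (WithLp.toLp 2 x) := fun k =>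
    (kd k).continuous.comp (PiLp.continuous_toLp 2 _)
  have hco : ∀ k, UnitAddTorus.mFourierCoeff F k = (A k : ℂ) - (B k : ℂ) * Complex.I := by
    intro k
    rw [UnitAddTorus.mFourierCoeff_eq_integral F k 0]
    have e1 : ∀ x : Fin m → ℝ, UnitAddTorus.mFourier (-k) (fun i => (x i : UnitAddCircle)) • F (fun i => (x i : UnitAddCircle))
        = ((Real.cos (kd k (WithLp.toLp 2 x)) * g x : ℝ) : ℂ) -
          ((Real.sin (kd k (WithLp.toLp 2 x)) * g x : ℝ) : ℂ) * Complex.I := by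
      intro x
      have e2 : F (fun i => (x i : UnitAddCircle)) = (g x : ℂ) := tor_coe hgc x
      have e3 : kd (-k) (WithLp.toLp 2 x) = - kd k (WithLp.toLp 2 x) := by
        simp [kd_apply]
      rw [e2, mF_coe, e3]
      push_cast
      rw [Complex.cos_neg, Complex.sin_neg, smul_eq_mul]; ring
    simp only [e1]
    have c1 : Continuous fun x : Fin m → ℝ => ((Real.cos (kd k (WithLp.toLp 2 x)) * g x : ℝ) : ℂ) :=
      Complex.continuous_ofReal.comp ((Real.continuous_cos.comp (hcL k)).mul hg)
    have c2 : Continuous fun x : Fin m → ℝ => ((Real.sin (kd k (WithLp.toLp 2 x)) * g x : ℝ) : ℂ) :=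
      Complex.continuous_ofReal.comp ((Real.continuous_sin.comp (hcL k)).mul hg)
    have h3 := integral_sub (cube_int c1).integrable (cube_int (c2.mul_const Complex.I)).integrable
    refine Eq.trans h3 ?_
    rw [integral_mul_const, integral_complex_ofReal, integral_complex_ofReal, ← hA, ← hB]
  have hs : Summable (UnitAddTorus.mFourierCoeff F) := by
    have h1 : Summable fun k => (A k : ℂ) := Complex.summable_ofReal.2 sA
    have h2 : Summable fun k => (B k : ℂ) := Complex.summable_ofReal.2 sB
    refine (h1.sub (h2.mul_right Complex.I)).congr fun k => ?_
    rw [hco]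
  have h := UnitAddTorus.hasSum_mFourier_series_apply_of_summable hs (fun i => (x i : UnitAddCircle))
  have h' := Complex.hasSum_re h
  have e2 : F (fun i => (x i : UnitAddCircle)) = (g x : ℂ) := tor_coe hgc x
  rw [e2, Complex.ofReal_re] at h'
  refine h'.congr_fun fun k => ?_
  rw [hco, mF_coe, ← Complex.ofReal_cos, ← Complex.ofReal_sin]
  simp [Complex.cos_ofReal_re, Complex.sin_ofReal_re, Complex.cos_ofReal_im, Complex.sin_ofReal_im]
  try ring

lemma W_of_decay [CompleteSpace V] {g : E m → V} (hg : Continuous g)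
    (hper : ∀ (θ : E m) (l : Fin m → ℤ), g (θ + WithLp.toLp 2 (fun i => (l i : ℝ))) = g θ)
    {A σ K : ℝ} (hσ : 0 < σ) (hK : HasSum (fun k : Fin m → ℤ => Real.exp (-(σ * kn k))) K)
    (hd : ∀ k φ, ‖cf k φ g‖ ≤ A * Real.exp (-((2 * σ) * kn k))) : W σ (2 * A * K) g := by
  have hA : 0 ≤ A := by
    have := (norm_nonneg _).trans (hd 0 0)
    exact nonneg_of_mul_nonneg_left this (Real.exp_pos _)
  have hb : ∀ k : Fin m → ℤ, A * Real.exp (-((2 * σ) * kn k)) * Real.exp (σ * kn k) = A * Real.exp (-(σ * kn k)) := fun k => by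
    rw [mul_assoc, ← Real.exp_add]; congr 2; ring
  have sb : Summable fun k : Fin m → ℤ => A * Real.exp (-((2 * σ) * kn k)) := (summable_kn (by linarith) m).mul_left A
  have sn : ∀ φ, Summable fun k => cf k φ g := fun φ => Summable.of_norm_bounded sb fun k => hd k φ
  have part : ∀ (φ ψ : ℝ), ∃ G : E m → V, W σ (A * K) G ∧
      ∀ x, HasSum (fun k => Real.cos (kd k x + ψ) • cf k φ g) (G x) := by
    intro φ ψ
    have s1 : ∀ x, Summable fun k => Real.cos (kd k x + ψ) • cf k φ g := fun x =>
      Summable.of_norm_bounded sb fun k => by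
        rw [norm_smul]
        exact (mul_le_of_le_one_left (norm_nonneg _) (Real.abs_cos_le_one _)).trans (hd k φ)
    refine ⟨fun x => ∑' k, Real.cos (kd k x + ψ) • cf k φ g, ?_, fun x => (s1 x).hasSum⟩
    have hle : ∀ k, ‖cf k φ g‖ * Real.exp (σ * kn k) ≤ A * Real.exp (-(σ * kn k)) := fun k => by
      rw [← hb]; gcongr; exact hd k φ
    have s2 : Summable fun k => ‖cf k φ g‖ * Real.exp (σ * kn k) :=
      Summable.of_nonneg_of_le (fun k => by positivity) hle (hK.summable.mul_left A)
    exact ⟨Fin m → ℤ, fun k => cf k φ g, id, fun _ => ψ, _, s2.hasSum,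
      hasSum_le hle s2.hasSum (hK.mul_left A), fun x => (s1 x).hasSum⟩
  obtain ⟨G1, w1, h1⟩ := part 0 0
  obtain ⟨G2, w2, h2⟩ := part (-(π / 2)) (-(π / 2))
  have w := w1.add hσ.le w2
  have e : (fun x => G1 x + G2 x) = g := by
    funext x
    refine (SeparatingDual.eq_iff_forall_dual_eq (R := ℝ)).2 fun L => ?_
    have hs := ((h1 x).add (h2 x)).mapL L
    have hgc : Continuous fun y : Fin m → ℝ => g (WithLp.toLp 2 y) := hg.comp (PiLp.continuous_toLp 2 _)
    have hcL : ∀ k : Fin m → ℤ, Continuous fun x : Fin m → ℝ => kd k (WithLp.toLp 2 x) := fun k =>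
      (kd k).continuous.comp (PiLp.continuous_toLp 2 _)
    have hL : ∀ k φ, L (cf k φ g) = ∫ x in cube (0 : Fin m → ℝ), Real.cos (kd k (WithLp.toLp 2 x) + φ) * L (g (WithLp.toLp 2 x)) := by
      intro k φ
      have c1 : Continuous fun y : Fin m → ℝ => Real.cos (kd k (WithLp.toLp 2 y) + φ) • g (WithLp.toLp 2 y) :=
        (Real.continuous_cos.comp ((hcL k).add_const φ)).smul hgc
      rw [cf, ← L.integral_comp_comm (cube_int c1).integrable]
      simp
    have hr := real_inv (g := fun y => L (g (WithLp.toLp 2 y))) (L.continuous.comp hgc)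
      (fun x l => by
        have := hper (WithLp.toLp 2 x) l
        rw [← WithLp.toLp_add] at this
        simp only [this])
      (A := fun k => L (cf k 0 g)) (B := fun k => L (cf k (-(π / 2)) g))
      (fun k => by simp only [hL, add_zero])
      (fun k => by simp only [hL, ← sub_eq_add_neg, Real.cos_sub_pi_div_two])
      ((sn 0).mapL L) ((sn _).mapL L) (WithLp.ofLp x)
    refine hs.unique ?_
    convert! hr using 2 with k
    simp only [map_add, map_smul, add_zero, ← sub_eq_add_neg, Real.cos_sub_pi_div_two, smul_eq_mul]
  rw [e] at w
  exact w.mono le_rfl (by linarith)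

end inv
end KAM
end PartN

section PartO
open Real Filter Topology MeasureTheory
namespace KAM
section ana
variable {m : ℕ}

lemma iter_iter {X : Type} [NormedAddCommGroup X] [NormedSpace ℝ X] (N : ℕ) :
    ∀ {V : Type} [NormedAddCommGroup V] [NormedSpace ℝ V] (f : X → V) (l : ℕ) (z : X),
    ‖iteratedFDeriv ℝ l (iteratedFDeriv ℝ N f) z‖ = ‖iteratedFDeriv ℝ (N + l) f z‖ := by
  induction N with
  | zero =>
    intro V _ _ f l z
    rw [iteratedFDeriv_zero_eq_comp, LinearIsometryEquiv.norm_iteratedFDeriv_comp_left, zero_add]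
  | succ N ih =>
    intro V _ _ f l z
    have e : iteratedFDeriv ℝ (N + 1) f =
      ((continuousMultilinearCurryRightEquiv' ℝ N X V).symm ∘
          iteratedFDeriv ℝ N (fderiv ℝ f)) := funext fun z => iteratedFDeriv_succ_eq_comp_right
    have h1 := LinearIsometryEquiv.norm_iteratedFDeriv_comp_left
      (continuousMultilinearCurryRightEquiv' ℝ N X V).symm (iteratedFDeriv ℝ N (fderiv ℝ f)) z l
    rw [e]
    refine Eq.trans h1 ?_
    rw [ih, norm_iteratedFDeriv_fderiv]
    have e3 : N + l + 1 = N + 1 + l := by ring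
    rw [e3]

lemma dir_deriv {X V : Type*} [NormedAddCommGroup X] [NormedSpace ℝ X] [NormedAddCommGroup V] [NormedSpace ℝ V]
    [CompleteSpace V] {F : X → V} {z : X} (h : AnalyticAt ℝ F z) (v : X) (l : ℕ) :
    ContDiffAt ℝ 1 (fun z => iteratedFDeriv ℝ l F z (fun _ => v)) z ∧
    fderiv ℝ (fun z => iteratedFDeriv ℝ l F z (fun _ => v)) z v = iteratedFDeriv ℝ (l + 1) F z (fun _ => v) := by
  have h1 : ContDiffAt ℝ 1 (iteratedFDeriv ℝ l F) z :=
    (h.contDiffAt (n := (1 : ℕ) + l)).iteratedFDeriv_right (le_refl _)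
  let A := ContinuousMultilinearMap.apply ℝ (fun _ : Fin l => X) V (fun _ => v)
  refine ⟨A.contDiff.contDiffAt.comp z h1, ?_⟩
  have h2 := (A.hasFDerivAt (x := iteratedFDeriv ℝ l F z)).comp z (h1.differentiableAt (by norm_num)).hasFDerivAt
  have h3 : HasFDerivAt (fun z => iteratedFDeriv ℝ l F z (fun _ => v)) _ z := h2
  rw [h3.fderiv]
  rfl

lemma cf_gen {V : Type*} [NormedAddCommGroup V] [NormedSpace ℝ V] [CompleteSpace V] {F : Ph m → V} {y0 : E m}
    (hF : ∀ θ, AnalyticAt ℝ F (θ, y0))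
    (hper : ∀ (θ : E m) (l : Fin m → ℤ) (y : E m), F (θ + WithLp.toLp 2 (fun i => (l i : ℝ)), y) = F (θ, y))
    {B : ℕ → ℝ} (hB : ∀ l θ, ‖iteratedFDeriv ℝ l F (θ, y0)‖ ≤ B l) (j : Fin m) (k : Fin m → ℤ) (l : ℕ) (φ : ℝ) :
    (2 * π * |(k j : ℝ)|) ^ l * ‖cf k φ (fun θ => F (θ, y0))‖ ≤ B l := by
  let v : Ph m := (EuclideanSpace.single j 1, 0)
  have hv : ‖v‖ = 1 := by simp [v, Prod.norm_def]
  let g : ℕ → E m → V := fun l θ => iteratedFDeriv ℝ l F (θ, y0) (fun _ => v)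
  have hin : ∀ θ : E m, HasFDerivAt (fun θ : E m => ((θ, y0) : Ph m)) (ContinuousLinearMap.inl ℝ (E m) (E m)) θ :=
    fun θ => (hasFDerivAt_id θ).prodMk (hasFDerivAt_const y0 θ)
  have h := cf_decay (g := g) (B := B) ?_ ?_ ?_ (EuclideanSpace.single j 1) ?_ k l 0 φ
  · rw [zero_add] at h
    have e1 : |kd k (EuclideanSpace.single j 1)| = 2 * π * |(k j : ℝ)| := by
      rw [kd_apply, Finset.sum_eq_single j (fun i _ hi => by simp [hi]) (by simp)]
      simp [abs_mul, abs_of_pos pi_pos]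
    have e2 : g 0 = fun θ => F (θ, y0) := by funext θ; simp [g]
    rw [e1, e2] at h
    exact h
  · intro l
    rw [contDiff_iff_contDiffAt]
    intro θ
    have := (dir_deriv (hF θ) v l).1
    exact ContDiffAt.comp θ (f := fun θ : E m => ((θ, y0) : Ph m)) this (contDiff_id.prodMk contDiff_const).contDiffAt
  · intro l θ n
    obtain ⟨a, ha⟩ : ∃ a : E m, a = WithLp.toLp 2 (fun i => (n i : ℝ)) := ⟨_, rfl⟩
    have hGa : (fun z : Ph m => F (z + (a, 0))) = F := by
      funext z
      have := hper z.1 n z.2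
      rw [← ha] at this
      simpa [Prod.add_def] using this
    have e1 : ((θ + a, y0) : Ph m) = (θ, y0) + (a, 0) := by simp
    show iteratedFDeriv ℝ l F (θ + WithLp.toLp 2 _, y0) _ = iteratedFDeriv ℝ l F (θ, y0) _
    rw [← ha, e1, ← iteratedFDeriv_comp_add_right, hGa]
  · intro l θ
    refine (ContinuousMultilinearMap.le_opNorm _ _).trans ?_
    simpa [hv] using hB l θ
  · intro l θ
    have h1 := (dir_deriv (hF θ) v l)
    have h2 := (h1.1.differentiableAt (by norm_num)).hasFDerivAt.comp θ (hin θ)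
    have h3 : HasFDerivAt (g l) _ θ := h2
    rw [h3.fderiv]
    exact h1.2

lemma exp_sum {x A B q : ℝ} (hq : 0 < q)
    (h : ∀ l : ℕ, x ^ l * A ≤ B * l.factorial * q ^ l) : A * Real.exp (x / (2 * q)) ≤ 2 * B := by
  have h1 : HasSum (fun l : ℕ => (x / (2 * q)) ^ l / l.factorial) (Real.exp (x / (2 * q))) := by
    rw [Real.exp_eq_exp_ℝ]
    exact NormedSpace.expSeries_div_hasSum_exp (x / (2 * q))
  have h2 := hasSum_geometric_two.mul_left B
  rw [mul_comm 2 B]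
  refine hasSum_le (fun l => ?_) (h1.mul_left A) h2
  have h3 := h l
  have hf : (0 : ℝ) < l.factorial := by positivity
  rw [div_pow, mul_pow, one_div_pow, mul_one_div, div_div, ← mul_div_assoc,
    div_le_div_iff₀ (by positivity) (by positivity)]
  calc A * x ^ l * 2 ^ l = (x ^ l * A) * 2 ^ l := by ring
    _ ≤ (B * l.factorial * q ^ l) * 2 ^ l := by gcongr
    _ = _ := by ring

lemma compG_of_analytic (hm : 0 < m) {V : Type} [NormedAddCommGroup V] [NormedSpace ℝ V] [CompleteSpace V] {G : Ph m → V} {y0 : E m}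
    (hG : ∀ θ, AnalyticAt ℝ G (θ, y0))
    (hper : ∀ (θ : E m) (l : Fin m → ℤ) (y : E m), G (θ + WithLp.toLp 2 (fun i => (l i : ℝ)), y) = G (θ, y)) :
    ∃ ρ0 C a0 : ℝ, 0 < ρ0 ∧ 0 ≤ C ∧ 0 < a0 ∧ CompG G y0 ρ0 C a0 := by
  obtain ⟨R, C, hR, hC, hb⟩ := bd_unif hG hper
  obtain ⟨σ, hσ⟩ : ∃ σ : ℝ, σ = π * R / (4 * m) := ⟨_, rfl⟩
  have hm' : (0 : ℝ) < m := by exact_mod_cast hm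
  have hσ0 : 0 < σ := by rw [hσ]; positivity
  obtain ⟨K, hK⟩ := summable_kn hσ0 m
  have hK0 : 0 ≤ K := hK.nonneg fun k => (Real.exp_pos _).le
  have key : ∀ N, W σ (2 * (2 * (C * N.factorial * (2 / R) ^ N)) * K) (fun θ => iteratedFDeriv ℝ N G (θ, y0)) := by
    intro N
    have hFa : ∀ θ, AnalyticAt ℝ (iteratedFDeriv ℝ N G) (θ, y0) := fun θ =>
      (AnalyticOnNhd.iteratedFDeriv (s := {(θ, y0)}) (fun z hz => by rw [Set.mem_singleton_iff.1 hz]; exact hG θ) N) _ rfl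
    have hFp : ∀ (θ : E m) (l : Fin m → ℤ) (y : E m),
        iteratedFDeriv ℝ N G (θ + WithLp.toLp 2 (fun i => (l i : ℝ)), y) = iteratedFDeriv ℝ N G (θ, y) := by
      intro θ n y
      obtain ⟨a, ha⟩ : ∃ a : E m, a = WithLp.toLp 2 (fun i => (n i : ℝ)) := ⟨_, rfl⟩
      have hGa : (fun z : Ph m => G (z + (a, 0))) = G := by
        funext z
        have := hper z.1 n z.2
        rw [← ha] at this
        simpa [Prod.add_def] using this
      have e1 : ((θ + a, y) : Ph m) = (θ, y) + (a, 0) := by simp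
      rw [← ha, e1, ← iteratedFDeriv_comp_add_right, hGa]
    refine W_of_decay ?_ (fun θ l => hFp θ l y0) hσ0 hK ?_
    · rw [continuous_iff_continuousAt]
      intro θ
      exact ContinuousAt.comp (f := fun θ : E m => ((θ, y0) : Ph m)) (hFa θ).continuousAt (by fun_prop)
    · intro k φ
      obtain ⟨j, -, hj⟩ := Finset.exists_max_image (Finset.univ : Finset (Fin m)) (fun i => |(k i : ℝ)|) ⟨⟨0, hm⟩, Finset.mem_univ _⟩
      have hkn : kn k ≤ m * |(k j : ℝ)| := by
        have := Finset.sum_le_card_nsmul Finset.univ (fun i => |(k i : ℝ)|) _ hj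
        simpa [kn] using this
      have h1 := fun l => cf_gen hFa hFp (B := fun l => C * N.factorial * (2 / R) ^ N * l.factorial * (2 / R) ^ l) (fun l θ => by
        rw [iter_iter]
        refine ((hb θ).bound (N + l)).trans ?_
        have h3 : ((N + l).factorial : ℝ) ≤ 2 ^ (N + l) * N.factorial * l.factorial := by
          rw [← Nat.add_choose_mul_factorial_mul_factorial]
          push_cast
          have : ((N + l).choose l : ℝ) ≤ 2 ^ (N + l) := by exact_mod_cast Nat.choose_le_two_pow (N + l) l
          gcongr
        calc C * (N + l).factorial / R ^ (N + l) ≤ C * (2 ^ (N + l) * N.factorial * l.factorial) / R ^ (N + l) := by gcongr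
          _ = _ := by rw [div_pow, div_pow, pow_add, pow_add]; field_simp) j k l φ
      have h2 := exp_sum (by positivity) h1
      rw [Real.exp_neg, ← div_eq_mul_inv, le_div_iff₀ (Real.exp_pos _)]
      refine le_trans ?_ h2
      gcongr
      rw [hσ]
      calc 2 * (π * R / (4 * m)) * kn k ≤ 2 * (π * R / (4 * m)) * (m * |(k j : ℝ)|) := by gcongr
        _ = _ := by field_simp; ring
  have hT := compG_of_taylor (G := G) (y0 := y0) (p := fun N θ => (N.factorial : ℝ)⁻¹ • iteratedFDeriv ℝ N G (θ, y0))
    (C := 4 * C * K) (R := R / 2) (ρ0 := σ) (by positivity) (by positivity) (fun N => by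
      have := (key N).smul ((N.factorial : ℝ)⁻¹)
      refine this.mono le_rfl (le_of_eq ?_)
      have hf : (0 : ℝ) < N.factorial := by positivity
      rw [abs_of_pos (by positivity), div_pow, div_pow]
      field_simp
      ring)
    (fun θ x hx => by simpa using (hb θ).sum x (by linarith))
    (fun θ x hx => ((hb θ).ana x (by linarith)).differentiableAt)
  exact ⟨σ, _, _, hσ0, by positivity, by positivity, hT⟩

lemma CompG.mono {V : Type*} [NormedAddCommGroup V] [NormedSpace ℝ V] {G : Ph m → V} {y0 : E m} {ρ C a ρ' C' a' : ℝ}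
    (h : CompG G y0 ρ C a) (hρ : ρ' ≤ ρ) (hC : C ≤ C') (ha : a' ≤ a) : CompG G y0 ρ' C' a' := by
  intro r α d X Δ h1 h2 wX wΔ h3 h4
  obtain ⟨q1, q2, q3⟩ := h r α d X Δ h1 (h2.trans hρ) wX wΔ (h3.trans ha) (h4.trans ha)
  have := wΔ.nonneg
  exact ⟨q1.mono le_rfl hC, q2.mono le_rfl (by gcongr), q3.mono le_rfl (by gcongr)⟩

end ana
end KAM
end PartO

section PartP
open Real Filter Topology
open scoped InnerProductSpace
namespace KAM
section grad
variable {m : ℕ}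

/-- `x`-part of the gradient, as a linear map on covectors. -/
noncomputable def Lx (m : ℕ) : (Ph m →L[ℝ] ℝ) →L[ℝ] E m :=
  ∑ i : Fin m, (ContinuousLinearMap.apply ℝ ℝ ((EuclideanSpace.single i 1, 0) : Ph m)).smulRight
    (EuclideanSpace.single i (1 : ℝ) : E m)

/-- `y`-part of the gradient, as a linear map on covectors. -/
noncomputable def Ly (m : ℕ) : (Ph m →L[ℝ] ℝ) →L[ℝ] E m :=
  ∑ i : Fin m, (ContinuousLinearMap.apply ℝ ℝ ((0, EuclideanSpace.single i 1) : Ph m)).smulRight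
    (EuclideanSpace.single i (1 : ℝ) : E m)

lemma E_sum (v : E m) : v = ∑ i, v i • (EuclideanSpace.single i (1 : ℝ) : E m) := by
  ext j
  simp [Finset.sum_apply, Pi.single_apply]

lemma Lx_apply (A : Ph m →L[ℝ] ℝ) (i : Fin m) : Lx m A i = A (EuclideanSpace.single i 1, 0) := by
  simp [Lx, Finset.sum_apply, sum_apply, Pi.single_apply]

lemma Ly_apply (A : Ph m →L[ℝ] ℝ) (i : Fin m) : Ly m A i = A (0, EuclideanSpace.single i 1) := by
  simp [Ly, Finset.sum_apply, sum_apply, Pi.single_apply]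

lemma L_inner (A : Ph m →L[ℝ] ℝ) (v : Ph m) : ⟪Lx m A, v.1⟫_ℝ + ⟪Ly m A, v.2⟫_ℝ = A v := by
  have e : v = ∑ i, (v.1 i • ((EuclideanSpace.single i 1, 0) : Ph m) + v.2 i • ((0, EuclideanSpace.single i 1) : Ph m)) := by
    refine Prod.ext ?_ ?_
    · rw [Prod.fst_sum]; simpa using E_sum v.1
    · rw [Prod.snd_sum]; simpa using E_sum v.2
  conv_rhs => rw [e, map_sum]
  rw [PiLp.inner_apply, PiLp.inner_apply, ← Finset.sum_add_distrib]
  refine Finset.sum_congr rfl fun i _ => ?_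
  rw [Lx_apply, Ly_apply, map_add, map_smul, map_smul]
  simp

/-- Gradients. -/
noncomputable def gx (H : Ph m → ℝ) (p : Ph m) : E m := Lx m (fderiv ℝ H p)
noncomputable def gy (H : Ph m → ℝ) (p : Ph m) : E m := Ly m (fderiv ℝ H p)
noncomputable def gyy (H : Ph m → ℝ) (p : Ph m) : E m →L[ℝ] E m :=
  (fderiv ℝ (gy H) p).comp (ContinuousLinearMap.inr ℝ (E m) (E m))

lemma gx_ana {H : Ph m → ℝ} {p : Ph m} (h : AnalyticAt ℝ H p) : AnalyticAt ℝ (gx H) p :=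
  AnalyticAt.comp ((Lx m).analyticAt _) h.fderiv

lemma gy_ana {H : Ph m → ℝ} {p : Ph m} (h : AnalyticAt ℝ H p) : AnalyticAt ℝ (gy H) p :=
  AnalyticAt.comp ((Ly m).analyticAt _) h.fderiv

lemma gyy_ana {H : Ph m → ℝ} {p : Ph m} (h : AnalyticAt ℝ H p) : AnalyticAt ℝ (gyy H) p :=
  AnalyticAt.comp (((ContinuousLinearMap.compL ℝ (E m) (Ph m) (E m)).flip
    (ContinuousLinearMap.inr ℝ (E m) (E m))).analyticAt _) (gy_ana h).fderiv

/-- Periodicity in the angles. -/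
def PerX {V : Type*} (G : Ph m → V) : Prop :=
  ∀ (θ : E m) (l : Fin m → ℤ) (y : E m), G (θ + WithLp.toLp 2 (fun i => (l i : ℝ)), y) = G (θ, y)

lemma PerX.fderiv {V : Type*} [NormedAddCommGroup V] [NormedSpace ℝ V] {G : Ph m → V} (h : PerX G) :
    PerX (fderiv ℝ G) := by
  intro θ n y
  obtain ⟨a, ha⟩ : ∃ a : E m, a = WithLp.toLp 2 (fun i => (n i : ℝ)) := ⟨_, rfl⟩
  have hGa : (fun z : Ph m => G (z + (a, 0))) = G := by
    funext z
    have := h z.1 n z.2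
    rw [← ha] at this
    simpa [Prod.add_def] using this
  have e1 : ((θ + a, y) : Ph m) = (θ, y) + (a, 0) := by simp
  rw [← ha, e1, ← fderiv_comp_add_right, hGa]

lemma PerX.gx {H : Ph m → ℝ} (h : PerX H) : PerX (gx H) := fun θ l y => by
  simp only [KAM.gx, h.fderiv θ l y]
lemma PerX.gy {H : Ph m → ℝ} (h : PerX H) : PerX (gy H) := fun θ l y => by
  simp only [KAM.gy, h.fderiv θ l y]
lemma PerX.gyy {H : Ph m → ℝ} (h : PerX H) : PerX (gyy H) := fun θ l y => by
  simp only [KAM.gyy, h.gy.fderiv θ l y]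

lemma nbd_eq {V : Type*} {G1 G2 : Ph m → V} {y0 : E m} {R : ℝ}
    (h : ∀ p : Ph m, ‖p.2 - y0‖ < R → G1 p = G2 p) {p : Ph m} (hp : ‖p.2 - y0‖ < R) : G1 =ᶠ[𝓝 p] G2 := by
  have ho : IsOpen {p : Ph m | ‖p.2 - y0‖ < R} := isOpen_lt (by fun_prop) continuous_const
  filter_upwards [ho.mem_nhds hp] with q hq using h q hq

lemma CompG.lin {V : Type*} [NormedAddCommGroup V] [NormedSpace ℝ V] [CompleteSpace V] {G G1 G2 : Ph m → V}
    {y0 : E m} {ρ C a R ε : ℝ} (hC : 0 ≤ C)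
    (h1 : CompG G1 y0 ρ C a) (h2 : CompG G2 y0 ρ C a)
    (d1 : ∀ p : Ph m, ‖p.2 - y0‖ < R → DifferentiableAt ℝ G1 p)
    (d2 : ∀ p : Ph m, ‖p.2 - y0‖ < R → DifferentiableAt ℝ G2 p)
    (hG : ∀ p : Ph m, ‖p.2 - y0‖ < R → G p = G1 p + ε • G2 p)
    (hε : 0 ≤ ε) (hε1 : ε ≤ 1) (haR : 2 * a < R) : CompG G y0 ρ (2 * C) a := by
  intro r α d X Δ hr hr' wX wΔ hα hd
  obtain ⟨p1, p2, p3⟩ := h1 r α d X Δ hr hr' wX wΔ hα hd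
  obtain ⟨q1, q2, q3⟩ := h2 r α d X Δ hr hr' wX wΔ hα hd
  have hd0 := wΔ.nonneg
  have hα0 := wX.nonneg
  have nX : ∀ θ, ‖(X θ).2‖ ≤ α := fun θ => (norm_snd_le _).trans (wX.norm_le hr.le θ)
  have nΔ : ∀ θ, ‖(Δ θ).2‖ ≤ d := fun θ => (norm_snd_le _).trans (wΔ.norm_le hr.le θ)
  have m1 : ∀ θ, ‖(((θ, y0) : Ph m) + X θ).2 - y0‖ < R := fun θ => by
    have := nX θ
    have e : (((θ, y0) : Ph m) + X θ).2 - y0 = (X θ).2 := by simp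
    rw [e]; linarith
  have m2 : ∀ θ, ‖(((θ, y0) : Ph m) + X θ + Δ θ).2 - y0‖ < R := fun θ => by
    have := nX θ
    have := nΔ θ
    have e : (((θ, y0) : Ph m) + X θ + Δ θ).2 - y0 = (X θ).2 + (Δ θ).2 := by simp; abel
    rw [e]
    refine (norm_add_le _ _).trans_lt ?_
    linarith
  have cε : ∀ x, 0 ≤ x → |ε| * x ≤ x := fun x hx => by
    rw [abs_of_nonneg hε]; exact mul_le_of_le_one_left hx hε1
  refine ⟨?_, ?_, ?_⟩
  · have w := (p1.add hr.le (q1.smul ε)).mono (le_refl r) (M' := 2 * C) (by have := cε C hC; linarith)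
    convert! w using 2 with θ
    rw [hG _ (m1 θ)]
  · have w := (p2.add hr.le (q2.smul ε)).mono (le_refl r) (M' := 2 * C * d) (by have := cε (C * d) (by positivity); linarith)
    convert! w using 2 with θ
    rw [hG _ (m1 θ), hG _ (m2 θ), smul_sub]; abel
  · have w := (p3.add hr.le (q3.smul ε)).mono (le_refl r) (M' := 2 * C * d ^ 2) (by have := cε (C * d ^ 2) (by positivity); linarith)
    convert! w using 2 with θ
    have hf : HasFDerivAt (fun p => G1 p + ε • G2 p) _ ((θ, y0) + X θ) :=
      (d1 _ (m1 θ)).hasFDerivAt.add ((d2 _ (m1 θ)).hasFDerivAt.const_smul ε)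
    rw [(nbd_eq hG (m1 θ)).fderiv_eq, hf.fderiv, hG _ (m1 θ), hG _ (m2 θ)]
    simp only [add_apply, smul_apply, smul_sub]; abel

/-- Data of a uniformly analytic Hamiltonian near a torus. -/
structure Nice (H : Ph m → ℝ) (y0 : E m) (ρ0 C a0 R : ℝ) : Prop where
  ana : ∀ p : Ph m, ‖p.2 - y0‖ < R → AnalyticAt ℝ H p
  cH : CompG H y0 ρ0 C a0
  cx : CompG (gx H) y0 ρ0 C a0
  cy : CompG (gy H) y0 ρ0 C a0
  cyy : CompG (gyy H) y0 ρ0 C a0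

lemma Nice.mono {H : Ph m → ℝ} {y0 : E m} {ρ0 C a0 R ρ' C' a' R' : ℝ} (h : Nice H y0 ρ0 C a0 R)
    (h1 : ρ' ≤ ρ0) (h2 : C ≤ C') (h3 : a' ≤ a0) (h4 : R' ≤ R) : Nice H y0 ρ' C' a' R' :=
  ⟨fun p hp => h.ana p (hp.trans_le h4), h.cH.mono h1 h2 h3, h.cx.mono h1 h2 h3, h.cy.mono h1 h2 h3, h.cyy.mono h1 h2 h3⟩

lemma nice_of_analytic (hm : 0 < m) {H : Ph m → ℝ} {y0 : E m} (hH : ∀ θ, AnalyticAt ℝ H (θ, y0)) (hper : PerX H) :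
    ∃ ρ0 C a0 R : ℝ, 0 < ρ0 ∧ 0 ≤ C ∧ 0 < a0 ∧ 0 < R ∧ Nice H y0 ρ0 C a0 R := by
  obtain ⟨R, _, hR, -, hb⟩ := bd_unif hH hper
  obtain ⟨ρ1, C1, a1, hρ1, hC1, ha1, c1⟩ := compG_of_analytic hm hH hper
  obtain ⟨ρ2, C2, a2, hρ2, hC2, ha2, c2⟩ := compG_of_analytic hm (fun θ => gx_ana (hH θ)) hper.gx
  obtain ⟨ρ3, C3, a3, hρ3, hC3, ha3, c3⟩ := compG_of_analytic hm (fun θ => gy_ana (hH θ)) hper.gy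
  obtain ⟨ρ4, C4, a4, hρ4, hC4, ha4, c4⟩ := compG_of_analytic hm (fun θ => gyy_ana (hH θ)) hper.gyy
  refine ⟨min (min ρ1 ρ2) (min ρ3 ρ4), C1 + C2 + C3 + C4, min (min a1 a2) (min a3 a4), R, by positivity, by positivity,
    by positivity, hR, ?_, ?_, ?_, ?_, ?_⟩
  · intro p hp
    have := (hb p.1).ana (0, p.2 - y0) (by simpa [Prod.norm_def, hR] using hp)
    simpa using this
  · exact c1.mono (by simp) (by linarith) (by simp)
  · exact c2.mono (by simp) (by linarith) (by simp)
  · exact c3.mono (by simp) (by linarith) (by simp)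
  · exact c4.mono (by simp) (by linarith) (by simp)

section combine
variable {H F : Ph m → ℝ} {y0 : E m} {R ε : ℝ}

lemma fd_comb (hH : ∀ p : Ph m, ‖p.2 - y0‖ < R → AnalyticAt ℝ H p)
    (hF : ∀ p : Ph m, ‖p.2 - y0‖ < R → AnalyticAt ℝ F p)
    (p : Ph m) (hp : ‖p.2 - y0‖ < R) :
    fderiv ℝ (fun p => H p + ε * F p) p = fderiv ℝ H p + ε • fderiv ℝ F p := by
  have : HasFDerivAt (fun p => H p + ε * F p) _ p :=
    (hH p hp).differentiableAt.hasFDerivAt.add ((hF p hp).differentiableAt.hasFDerivAt.const_smul ε)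
  exact this.fderiv

lemma gx_comb (hH : ∀ p : Ph m, ‖p.2 - y0‖ < R → AnalyticAt ℝ H p)
    (hF : ∀ p : Ph m, ‖p.2 - y0‖ < R → AnalyticAt ℝ F p)
    (p : Ph m) (hp : ‖p.2 - y0‖ < R) : gx (fun p => H p + ε * F p) p = gx H p + ε • gx F p := by
  simp only [gx, fd_comb hH hF p hp, map_add, map_smul]

lemma gy_comb (hH : ∀ p : Ph m, ‖p.2 - y0‖ < R → AnalyticAt ℝ H p)
    (hF : ∀ p : Ph m, ‖p.2 - y0‖ < R → AnalyticAt ℝ F p)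
    (p : Ph m) (hp : ‖p.2 - y0‖ < R) : gy (fun p => H p + ε * F p) p = gy H p + ε • gy F p := by
  simp only [gy, fd_comb hH hF p hp, map_add, map_smul]

lemma gyy_comb (hH : ∀ p : Ph m, ‖p.2 - y0‖ < R → AnalyticAt ℝ H p)
    (hF : ∀ p : Ph m, ‖p.2 - y0‖ < R → AnalyticAt ℝ F p)
    (p : Ph m) (hp : ‖p.2 - y0‖ < R) : gyy (fun p => H p + ε * F p) p = gyy H p + ε • gyy F p := by
  have : HasFDerivAt (fun p => gy H p + ε • gy F p) _ p :=
    (gy_ana (hH p hp)).differentiableAt.hasFDerivAt.add ((gy_ana (hF p hp)).differentiableAt.hasFDerivAt.const_smul ε)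
  simp only [gyy, (nbd_eq (gy_comb (ε := ε) hH hF) hp).fderiv_eq, this.fderiv]
  ext v
  simp

end combine

lemma sys_of_nice {H F : Ph m → ℝ} {y0 : E m} {ρ0 C a0 R ε : ℝ} (nH : Nice H y0 ρ0 C a0 R) (nF : Nice F y0 ρ0 C a0 R)
    (hC : 0 ≤ C) (ha0 : 0 ≤ a0) (haR : 2 * a0 < R) (hε : 0 ≤ ε) (hε1 : ε ≤ 1) :
    Sys (fun p => H p + ε * F p) (gx (fun p => H p + ε * F p)) (gy (fun p => H p + ε * F p)) y0 ρ0 (2 * C) a0 := by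
  have hA : ∀ p : Ph m, ‖p.2 - y0‖ ≤ a0 → AnalyticAt ℝ (fun p => H p + ε * F p) p := fun p hp => by
    have hp' : ‖p.2 - y0‖ < R := by linarith
    exact (nH.ana p hp').add (analyticAt_const.mul (nF.ana p hp'))
  refine ⟨by positivity, fun p hp => (hA p hp).differentiableAt, fun p _ v => (L_inner _ v).symm,
    fun p hp => (gx_ana (hA p hp)).differentiableAt, fun p hp => (gy_ana (hA p hp)).differentiableAt, ?_, ?_, ?_, ?_, ?_⟩
  · intro p hp a b
    have hd := (hA p hp).fderiv.differentiableAt.hasFDerivAt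
    have h1 : HasFDerivAt (gx (fun p => H p + ε * F p)) _ p := (Lx m).hasFDerivAt.comp p hd
    have h2 : HasFDerivAt (gy (fun p => H p + ε * F p)) _ p := (Ly m).hasFDerivAt.comp p hd
    have hs := ((hA p hp).contDiffAt (n := 2)).isSymmSndFDerivAt (by simp)
    rw [h1.fderiv, h2.fderiv]
    simp only [ContinuousLinearMap.comp_apply]
    rw [L_inner, L_inner]
    exact hs a b
  · exact nH.cH.lin hC nF.cH (fun p hp => (nH.ana p hp).differentiableAt) (fun p hp => (nF.ana p hp).differentiableAt)
      (fun p _ => rfl) hε hε1 haR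
  · exact nH.cx.lin hC nF.cx (fun p hp => (gx_ana (nH.ana p hp)).differentiableAt)
      (fun p hp => (gx_ana (nF.ana p hp)).differentiableAt) (gx_comb nH.ana nF.ana) hε hε1 haR
  · exact nH.cy.lin hC nF.cy (fun p hp => (gy_ana (nH.ana p hp)).differentiableAt)
      (fun p hp => (gy_ana (nF.ana p hp)).differentiableAt) (gy_comb nH.ana nF.ana) hε hε1 haR
  · exact nH.cyy.lin hC nF.cyy (fun p hp => (gyy_ana (nH.ana p hp)).differentiableAt)
      (fun p hp => (gyy_ana (nF.ana p hp)).differentiableAt) (gyy_comb nH.ana nF.ana) hε hε1 haR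

lemma small_ev (c : ℝ) {d : ℝ} (hd : 0 < d) : ∀ᶠ ε in 𝓝 (0 : ℝ), c * ε ≤ d := by
  have : Tendsto (fun ε : ℝ => c * ε) (𝓝 0) (𝓝 0) := by
    have h := (show Continuous fun ε : ℝ => c * ε by fun_prop).tendsto 0
    rwa [mul_zero] at h
  exact this.eventually_le_const hd

theorem kam_main (hm : 0 < m) {H F : Ph m → ℝ} {ω y0 : E m} (hH : ∀ θ, AnalyticAt ℝ H (θ, y0)) (pH : PerX H)
    (hF : ∀ θ, AnalyticAt ℝ F (θ, y0)) (pF : PerX F) {Λ : ℝ} {N : ℕ} (hω : Dio ω Λ N)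
    (hx0 : ∀ θ, gx H (θ, y0) = 0) (hy0 : ∀ θ, gy H (θ, y0) = ω)
    {Q : E m →L[ℝ] E m} {β : ℝ} (hβ : 0 ≤ β) (hQ : ∀ x, ‖x‖ ≤ β * ‖Q x‖) (hyy : ∀ θ, gyy H (θ, y0) = Q) :
    ∃ ε0 ρ C : ℝ, 0 < ε0 ∧ 0 < ρ ∧ 0 < C ∧ ∀ ε, 0 < ε → ε < ε0 → ∃ u p : E m → E m,
      W ρ (C * ε) u ∧ W ρ (C * ε) (fun θ => p θ - y0) ∧
      (∀ θ, ω + fderiv ℝ u θ ω = gy H (θ + u θ, p θ) + ε • gy F (θ + u θ, p θ)) ∧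
      (∀ θ, fderiv ℝ p θ ω = -(gx H (θ + u θ, p θ) + ε • gx F (θ + u θ, p θ))) := by
  obtain ⟨ρ1, C1, a1, R1, hρ1, hC1, ha1, hR1, n1⟩ := nice_of_analytic hm hH pH
  obtain ⟨ρ2, C2, a2, R2, hρ2, hC2, ha2, hR2, n2⟩ := nice_of_analytic hm hF pF
  obtain ⟨ρ0, hρ⟩ : ∃ x, x = min ρ1 ρ2 := ⟨_, rfl⟩
  obtain ⟨R, hR⟩ : ∃ x, x = min R1 R2 := ⟨_, rfl⟩
  obtain ⟨C, hC⟩ : ∃ x, x = C1 + C2 := ⟨_, rfl⟩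
  obtain ⟨a0, ha⟩ : ∃ x, x = min (min a1 a2) (R / 3) := ⟨_, rfl⟩
  have hρ0 : 0 < ρ0 := by rw [hρ]; positivity
  have hR0 : 0 < R := by rw [hR]; positivity
  have hC0 : 0 ≤ C := by rw [hC]; positivity
  have ha0 : 0 < a0 := by rw [ha]; positivity
  have haR : 2 * a0 < R := by
    have : a0 ≤ R / 3 := by rw [ha]; exact min_le_right _ _
    linarith
  have nH : Nice H y0 ρ0 C a0 R := n1.mono (by rw [hρ]; exact min_le_left _ _) (by linarith)
    (by rw [ha]; exact (min_le_left _ _).trans (min_le_left _ _)) (by rw [hR]; exact min_le_left _ _)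
  have nF : Nice F y0 ρ0 C a0 R := n2.mono (by rw [hρ]; exact min_le_right _ _) (by linarith)
    (by rw [ha]; exact (min_le_left _ _).trans (min_le_right _ _)) (by rw [hR]; exact min_le_right _ _)
  clear n1 n2
  have hΛ := hω.1
  obtain ⟨B, hB⟩ : ∃ x, x = 8 + Λ * N.factorial * (12 / ρ0) ^ N + 24 * π / ρ0 + 2 * C + 2 * β := ⟨_, rfl⟩
  have b1 : 0 ≤ Λ * N.factorial * (12 / ρ0) ^ N := by positivity
  have b2 : 0 ≤ 24 * π / ρ0 := by positivity
  have hB0 : 0 < B := by linarith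
  have ev := ((((((small_ev (B ^ 13 * C) (d := 1 / 8) (by norm_num)).and
    (small_ev (4 * (B ^ 13 * C)) (d := a0) ha0)).and
    (small_ev (β * (16 * (2 * C) * (B ^ 13 * C))) (d := 1 / 4) (by norm_num))).and
    (small_ev (B ^ 28 * C) (d := (1 / 2 ^ (N + 1)) ^ 28) (by positivity))).and
    (small_ev (β * C) (d := 1 / 4) (by norm_num))).and (small_ev 1 (d := 1) one_pos))
  obtain ⟨ε0, hε0, hev⟩ := Metric.eventually_nhds_iff.1 ev
  refine ⟨ε0, ρ0 / 2, 2 * (B ^ 13 * C) + 1, hε0, by positivity, by positivity, fun ε hε hεε => ?_⟩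
  obtain ⟨⟨⟨⟨⟨e1, e2⟩, e3⟩, e4⟩, e5⟩, e6⟩ := hev (y := ε) (by rwa [Real.dist_eq, sub_zero, abs_of_pos hε])
  have S := sys_of_nice nH nF hC0 ha0.le haR hε.le (by linarith)
  have hin : ∀ θ : E m, ‖((θ, y0) : Ph m).2 - y0‖ < R := fun θ => by simpa using hR0
  have z0 : W ρ0 0 (fun _ : E m => (0 : Ph m)) := W.zero ρ0
  have fy : W ρ0 C (fun θ => gy F (θ, y0)) := by
    simpa using (nF.cy ρ0 0 0 _ _ hρ0 le_rfl z0 z0 ha0.le ha0.le).1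
  have fx : W ρ0 C (fun θ => gx F (θ, y0)) := by
    simpa using (nF.cx ρ0 0 0 _ _ hρ0 le_rfl z0 z0 ha0.le ha0.le).1
  have fyy : W ρ0 C (fun θ => gyy F (θ, y0)) := by
    simpa using (nF.cyy ρ0 0 0 _ _ hρ0 le_rfl z0 z0 ha0.le ha0.le).1
  obtain ⟨u, p, wu, wp, q1, q2⟩ := kam_limit hω hρ0 S hβ hQ (η0 := C * ε) (B0 := B) (μ := C * ε) (fun θ => by
      have h := gyy_comb (ε := ε) nH.ana nF.ana (θ, y0) (hin θ)
      have h' : (fderiv ℝ (gy fun p => H p + ε * F p) (θ, y0)).comp (ContinuousLinearMap.inr ℝ (E m) (E m)) = _ := h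
      rw [h', hyy, add_sub_cancel_left, norm_smul, Real.norm_eq_abs, abs_of_pos hε, mul_comm]
      exact mul_le_mul_of_nonneg_right (fyy.norm_le hρ0.le θ) hε.le)
    (by linarith) (by linarith) (by linarith) (by linarith) (by linarith) (by linarith) (by positivity)
    (by linarith) (by linarith) (by linarith) (by linarith)
    (by
      have := (fy.smul ε).neg.mono le_rfl (M' := C * ε) (by rw [abs_of_pos hε, mul_comm])
      convert! this using 2 with θ
      rw [gy_comb nH.ana nF.ana _ (hin θ), hy0]; abel)
    (by
      have := (fx.smul ε).mono le_rfl (M' := C * ε) (by rw [abs_of_pos hε, mul_comm])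
      convert! this using 2 with θ
      rw [gx_comb nH.ana nF.ana _ (hin θ), hx0, zero_add])
  have hp : ∀ θ, ‖((θ + u θ, p θ) : Ph m).2 - y0‖ < R := fun θ => by
    refine (wp.norm_le (by positivity) θ).trans_lt ?_
    linarith
  refine ⟨u, p, wu.mono le_rfl (by nlinarith), wp.mono le_rfl (by nlinarith), fun θ => ?_, fun θ => ?_⟩
  · rw [q1, gy_comb nH.ana nF.ana _ (hp θ)]
  · rw [q2, gx_comb nH.ana nF.ana _ (hp θ)]

end grad
end KAM
end PartP

section PartQ
open Real Filter Topology
open scoped InnerProductSpace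
namespace KAM
section fin
variable {m : ℕ}

lemma diffeo {u : E m → E m} (hu : ContDiff ℝ (⊤ : ℕ∞) u) (hd : ∀ θ, ‖fderiv ℝ u θ‖ ≤ 1 / 2) :
    ∃ v : E m → E m, Function.LeftInverse v (fun x => x + u x) ∧ Function.RightInverse v (fun x => x + u x) ∧
      ContDiff ℝ (⊤ : ℕ∞) v := by
  have hdu : Differentiable ℝ u := hu.differentiable (by simp)
  have hl : LipschitzWith (1 / 2) u := lipschitzWith_of_nnnorm_fderiv_le hdu fun x => by
    rw [← NNReal.coe_le_coe]; simpa using hd x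
  have ha : ApproximatesLinearOn (fun x => x + u x) ((ContinuousLinearEquiv.refl ℝ (E m) : E m ≃L[ℝ] E m) : E m →L[ℝ] E m)
      Set.univ (1 / 2) := by
    rw [ApproximatesLinearOn.approximatesLinearOn_iff_lipschitzOnWith, lipschitzOnWith_univ]
    convert! hl using 1
    funext x; simp
  have hc : Subsingleton (E m) ∨ (1 / 2 : NNReal) <
      ‖((ContinuousLinearEquiv.refl ℝ (E m)).symm : E m →L[ℝ] E m)‖₊⁻¹ := by
    rcases subsingleton_or_nontrivial (E m) with h | h
    · exact Or.inl h
    · right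
      have : ‖((ContinuousLinearEquiv.refl ℝ (E m)).symm : E m →L[ℝ] E m)‖₊ = 1 := by
        rw [← NNReal.coe_inj]
        exact ContinuousLinearMap.norm_id
      rw [this, ← NNReal.coe_lt_coe]; norm_num
  let Φ := ha.toHomeomorph _ hc
  have hΦ : ∀ x, Φ x = x + u x := fun x => rfl
  refine ⟨Φ.symm, fun x => Φ.symm_apply_apply x, fun x => Φ.apply_symm_apply x, ?_⟩
  have hn : ∀ a, ‖-fderiv ℝ u a‖ < 1 := fun a => by rw [norm_neg]; have := hd a; linarith
  refine Φ.contDiff_symm (f₀' := fun a => ContinuousLinearEquiv.ofUnit (Units.oneSub (-fderiv ℝ u a) (hn a))) (fun a => ?_) ?_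
  · have h1 : HasFDerivAt Φ _ a := (hasFDerivAt_id a).add (hdu a).hasFDerivAt
    refine h1.congr_fderiv ?_
    ext x
    have : (ContinuousLinearEquiv.ofUnit (Units.oneSub (-fderiv ℝ u a) (hn a))) x = ((1 : E m →L[ℝ] E m) - (-fderiv ℝ u a)) x := rfl
    simp [this]
  · exact contDiff_id.add hu

lemma dio_of {ωt : Fin m → ℝ} {L γ : ℝ} (hL : 0 < L) (h : ∀ κ : Fin m → ℤ, κ ≠ 0 →
      L / (∑ i, |(κ i : ℝ)|) ^ γ ≤ |∑ i, ωt i * (κ i : ℝ)|) : Dio (WithLp.toLp 2 ωt) (1 / L) ⌈γ⌉₊ := by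
  refine ⟨by positivity, fun k hk => ?_⟩
  have h1 := h k hk
  have hkn : 1 ≤ kn k := by
    obtain ⟨j, hj⟩ := Function.ne_iff.1 hk
    have h2 : (1 : ℝ) ≤ |(k j : ℝ)| := by
      rw [← Int.cast_abs]; exact_mod_cast Int.one_le_abs hj
    exact h2.trans (Finset.single_le_sum (f := fun i => |(k i : ℝ)|) (fun i _ => abs_nonneg _) (Finset.mem_univ j))
  have hkn' : (∑ i, |(k i : ℝ)|) = kn k := rfl
  rw [hkn'] at h1
  have h2 : kn k ^ γ ≤ kn k ^ ⌈γ⌉₊ := by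
    rw [← Real.rpow_natCast]
    exact Real.rpow_le_rpow_of_exponent_le hkn (Nat.le_ceil γ)
  have hp : 0 < kn k ^ γ := Real.rpow_pos_of_pos (by linarith) γ
  have e : kd k (WithLp.toLp 2 ωt) = 2 * π * ∑ i, ωt i * (k i : ℝ) := by
    rw [kd_apply, Finset.mul_sum]
    refine Finset.sum_congr rfl fun i _ => ?_
    show 2 * π * (k i : ℝ) * ωt i = _
    ring
  rw [e, abs_mul, abs_of_pos (by positivity : 0 < 2 * π)]
  have h3 : L ≤ |∑ i, ωt i * (k i : ℝ)| * kn k ^ ⌈γ⌉₊ := by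
    rw [div_le_iff₀ hp] at h1
    exact h1.trans (by gcongr)
  have h4 : 1 ≤ 2 * π := by have := pi_gt_three; linarith
  have h5 : 0 ≤ |∑ i, ωt i * (k i : ℝ)| * kn k ^ ⌈γ⌉₊ := by positivity
  rw [show 1 / L * kn k ^ ⌈γ⌉₊ * (2 * π * |∑ i, ωt i * (k i : ℝ)|) =
    (2 * π * (|∑ i, ωt i * (k i : ℝ)| * kn k ^ ⌈γ⌉₊)) / L by ring, le_div_iff₀ hL]
  nlinarith

lemma anti_of_inj {Q : E m →L[ℝ] E m} (h : ∀ v, Q v = 0 → v = 0) : ∃ β : ℝ, 0 ≤ β ∧ ∀ x, ‖x‖ ≤ β * ‖Q x‖ := by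
  obtain ⟨K, -, hK⟩ := LinearMap.exists_antilipschitzWith (Q : E m →ₗ[ℝ] E m) (LinearMap.ker_eq_bot'.2 h)
  refine ⟨K, K.2, fun x => ?_⟩
  have := hK.le_mul_dist x 0
  simpa using this

/-- Invariance of the second derivatives under translations of the angles. -/
lemma gyy_transl {H : Ph m → ℝ} (h : ∀ x x' y, H (x, y) = H (x', y)) (θ y0 : E m) : gyy H (θ, y0) = gyy H (0, y0) := by
  have hGa : (fun z : Ph m => H (z + (θ, 0))) = H := by
    funext z
    have := h (z.1 + θ) z.1 z.2
    simpa [Prod.add_def] using this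
  have e1 : ∀ z : Ph m, fderiv ℝ H (z + (θ, 0)) = fderiv ℝ H z := fun z => by
    rw [← fderiv_comp_add_right, hGa]
  have hGb : (fun z : Ph m => gy H (z + (θ, 0))) = gy H := by
    funext z
    simp only [gy, e1]
  have e2 : ((θ, y0) : Ph m) = (0, y0) + (θ, 0) := by simp
  simp only [gyy]
  rw [e2, ← fderiv_comp_add_right, hGb]

/-- The coordinate isomorphism. -/
noncomputable def eqv (m : ℕ) : E m →L[ℝ] (Fin m → ℝ) := (EuclideanSpace.equiv (Fin m) ℝ : E m →L[ℝ] (Fin m → ℝ))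
noncomputable def eqi (m : ℕ) : (Fin m → ℝ) →L[ℝ] E m := ((EuclideanSpace.equiv (Fin m) ℝ).symm : (Fin m → ℝ) →L[ℝ] E m)

lemma eqv_apply (x : E m) : eqv m x = WithLp.ofLp x := rfl
lemma eqi_apply (x : Fin m → ℝ) : eqi m x = WithLp.toLp 2 x := rfl
lemma eqv_eqi (x : Fin m → ℝ) : eqv m (eqi m x) = x := rfl
lemma eqi_eqv (x : E m) : eqi m (eqv m x) = x := rfl
lemma eqv_single (i : Fin m) : eqv m (EuclideanSpace.single i 1) = Pi.single i 1 := rfl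

lemma eqv_norm (x : E m) : ‖eqv m x‖ ≤ ‖x‖ := by
  rw [pi_norm_le_iff_of_nonneg (norm_nonneg _)]
  exact fun i => PiLp.norm_apply_le x i

/-- Embeddings of the reduced phase space. -/
noncomputable def AH (m : ℕ) : Ph m →L[ℝ] ℝ × (Fin m → ℝ) :=
  (0 : Ph m →L[ℝ] ℝ).prod ((eqv m).comp (ContinuousLinearMap.snd ℝ (E m) (E m)))
noncomputable def AF (m : ℕ) : Ph m →L[ℝ] (Fin m → ℝ) × (ℝ × (Fin m → ℝ)) :=
  ((eqv m).comp (ContinuousLinearMap.fst ℝ (E m) (E m))).prod (AH m)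

lemma AH_apply (p : Ph m) : AH m p = (0, eqv m p.2) := rfl
lemma AF_apply (p : Ph m) : AF m p = (eqv m p.1, (0, eqv m p.2)) := rfl

lemma gxH {h : ℝ × (Fin m → ℝ) → ℝ} {p : Ph m} (hd : DifferentiableAt ℝ h (AH m p)) :
    gx (fun p => h (AH m p)) p = 0 := by
  have h1 : HasFDerivAt (fun p => h (AH m p)) _ p := hd.hasFDerivAt.comp p (AH m).hasFDerivAt
  ext i
  rw [gx, Lx_apply, h1.fderiv]
  have e : AH m (EuclideanSpace.single i 1, 0) = 0 := by rw [AH_apply]; simp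
  simp [e]

lemma gyH {h : ℝ × (Fin m → ℝ) → ℝ} {p : Ph m} (hd : DifferentiableAt ℝ h (AH m p)) (i : Fin m) :
    gy (fun p => h (AH m p)) p i = fderiv ℝ h (AH m p) (0, Pi.single i 1) := by
  have h1 : HasFDerivAt (fun p => h (AH m p)) _ p := hd.hasFDerivAt.comp p (AH m).hasFDerivAt
  rw [gy, Ly_apply, h1.fderiv]
  rfl

lemma gxF {f : (Fin m → ℝ) × (ℝ × (Fin m → ℝ)) → ℝ} {p : Ph m} (hd : DifferentiableAt ℝ f (AF m p)) (i : Fin m) :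
    gx (fun p => f (AF m p)) p i = fderiv ℝ f (AF m p) (Pi.single i 1, 0) := by
  have h1 : HasFDerivAt (fun p => f (AF m p)) _ p := hd.hasFDerivAt.comp p (AF m).hasFDerivAt
  rw [gx, Lx_apply, h1.fderiv]
  have e : AF m (EuclideanSpace.single i 1, 0) = (Pi.single i 1, 0) := by rw [AF_apply, eqv_single]; simp
  simp [e]

lemma gyF {f : (Fin m → ℝ) × (ℝ × (Fin m → ℝ)) → ℝ} {p : Ph m} (hd : DifferentiableAt ℝ f (AF m p)) (i : Fin m) :
    gy (fun p => f (AF m p)) p i = fderiv ℝ f (AF m p) (0, (0, Pi.single i 1)) := by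
  have h1 : HasFDerivAt (fun p => f (AF m p)) _ p := hd.hasFDerivAt.comp p (AF m).hasFDerivAt
  rw [gy, Ly_apply, h1.fderiv]
  have e : AF m (0, EuclideanSpace.single i 1) = (0, (0, Pi.single i 1)) := by rw [AF_apply, eqv_single]; simp
  simp [e]

lemma gyyH {h : ℝ × (Fin m → ℝ) → ℝ} {p : Ph m} (hd : AnalyticAt ℝ h (AH m p)) (i j : Fin m) :
    gyy (fun p => h (AH m p)) p (EuclideanSpace.single i 1) j =
      fderiv ℝ (fun y => fderiv ℝ h y (0, Pi.single j 1)) (AH m p) (0, Pi.single i 1) := by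
  have hH : AnalyticAt ℝ (fun p => h (AH m p)) p := AnalyticAt.comp hd ((AH m).analyticAt p)
  have h1 : HasFDerivAt (fun q => gy (fun p => h (AH m p)) q j) _ p :=
    (EuclideanSpace.proj j : E m →L[ℝ] ℝ).hasFDerivAt.comp p (gy_ana hH).differentiableAt.hasFDerivAt
  have hev : (fun q => gy (fun p => h (AH m p)) q j) =ᶠ[𝓝 p] fun q => fderiv ℝ h (AH m q) (0, Pi.single j 1) := by
    have h2 := (AH m).continuous.continuousAt.eventually hd.eventually_analyticAt
    filter_upwards [h2] with q hq using gyH hq.differentiableAt j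
  have hd2 : DifferentiableAt ℝ (fun y => fderiv ℝ h y (0, Pi.single j 1)) (AH m p) :=
    hd.fderiv.differentiableAt.clm_apply (differentiableAt_const _)
  have h3 : HasFDerivAt (fun q => fderiv ℝ h (AH m q) (0, Pi.single j 1)) _ p :=
    hd2.hasFDerivAt.comp p (AH m).hasFDerivAt
  have h4 := h1.unique (h3.congr_of_eventuallyEq hev)
  have h5 := congrArg (fun A : Ph m →L[ℝ] ℝ => A (0, EuclideanSpace.single i 1)) h4
  exact h5

end fin
end KAM
end PartQ

section PartR
open Real Filter Topology
namespace KAM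
section fin2
variable {m : ℕ}

/-- Derivative of the perturbation on the exceptional hypersurface. -/
lemma fd_f {r : ℝ} (hr : 0 < r) {f₁ : (Fin m → ℝ) × (ℝ × (Fin m → ℝ)) → ℝ}
    (hf₁ : AnalyticOnNhd ℝ f₁ (Set.univ ×ˢ Metric.ball (0 : ℝ × (Fin m → ℝ)) r)) {f₂ : Pt m → ℝ}
    (hf₂ : ContDiffOn ℝ (⊤ : ℕ∞) f₂ (Set.univ ×ˢ Metric.ball (0 : ℝ × (Fin m → ℝ)) r)) {f₃ : ℝ × ℝ → ℝ}
    (hf₃ : ContDiffOn ℝ (⊤ : ℕ∞) f₃ (Set.univ ×ˢ Set.Ioo (-r) r)) {f : Pt m → ℝ}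
    (hf : ∀ p : Pt m, f p = f₁ (p.1.2, p.2) + p.2.1 * f₂ p + f₃ (p.1.1, p.2.1))
    (p : Pt m) (hp : p.2 ∈ Metric.ball (0 : ℝ × (Fin m → ℝ)) r) (hp1 : p.2.1 = 0) (a b : Fin m → ℝ) :
    fderiv ℝ f p ((0, a), (0, b)) = fderiv ℝ f₁ (p.1.2, p.2) (a, (0, b)) := by
  have e : f = fun p => f₁ (p.1.2, p.2) + p.2.1 * f₂ p + f₃ (p.1.1, p.2.1) := funext hf
  have d1 : HasFDerivAt f₁ _ (p.1.2, p.2) := (hf₁ (p.1.2, p.2) ⟨trivial, hp⟩).differentiableAt.hasFDerivAt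
  have o2 : IsOpen (Set.univ ×ˢ Metric.ball (0 : ℝ × (Fin m → ℝ)) r : Set (Pt m)) :=
    isOpen_univ.prod Metric.isOpen_ball
  have d2 : HasFDerivAt f₂ _ p := ((hf₂.contDiffAt (o2.mem_nhds ⟨trivial, hp⟩)).differentiableAt (by simp)).hasFDerivAt
  have o3 : IsOpen (Set.univ ×ˢ Set.Ioo (-r) r : Set (ℝ × ℝ)) := isOpen_univ.prod isOpen_Ioo
  have d3 : HasFDerivAt f₃ _ (p.1.1, p.2.1) := ((hf₃.contDiffAt (o3.mem_nhds ⟨trivial, by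
    rw [hp1]; exact ⟨by linarith, hr⟩⟩)).differentiableAt (by simp)).hasFDerivAt
  let P1 : Pt m →L[ℝ] (Fin m → ℝ) × (ℝ × (Fin m → ℝ)) :=
    ((ContinuousLinearMap.snd ℝ ℝ (Fin m → ℝ)).comp (ContinuousLinearMap.fst ℝ (ℝ × (Fin m → ℝ)) (ℝ × (Fin m → ℝ)))).prod
      (ContinuousLinearMap.snd ℝ (ℝ × (Fin m → ℝ)) (ℝ × (Fin m → ℝ)))
  let P2 : Pt m →L[ℝ] ℝ :=
    ((ContinuousLinearMap.fst ℝ ℝ (Fin m → ℝ)).comp (ContinuousLinearMap.snd ℝ (ℝ × (Fin m → ℝ)) (ℝ × (Fin m → ℝ))))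
  let P3 : Pt m →L[ℝ] ℝ × ℝ :=
    ((ContinuousLinearMap.fst ℝ ℝ (Fin m → ℝ)).comp (ContinuousLinearMap.fst ℝ (ℝ × (Fin m → ℝ)) (ℝ × (Fin m → ℝ)))).prod P2
  have c1 : HasFDerivAt (fun p : Pt m => f₁ (p.1.2, p.2)) _ p := HasFDerivAt.comp p (f := P1) d1 P1.hasFDerivAt
  have c2 : HasFDerivAt (fun p : Pt m => p.2.1 * f₂ p) _ p := P2.hasFDerivAt.mul d2
  have c3 : HasFDerivAt (fun p : Pt m => f₃ (p.1.1, p.2.1)) _ p := HasFDerivAt.comp p (f := P3) d3 P3.hasFDerivAt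
  have c : HasFDerivAt (fun p : Pt m => f₁ (p.1.2, p.2) + p.2.1 * f₂ p + f₃ (p.1.1, p.2.1)) _ p := (c1.add c2).add c3
  rw [e, c.fderiv]
  have q1 : P1 ((0, a), (0, b)) = (a, (0, b)) := rfl
  have q2 : P2 ((0, a), (0, b)) = 0 := rfl
  have q3 : P3 ((0, a), (0, b)) = 0 := rfl
  have q4 : P2 p = 0 := hp1
  simp only [add_apply, smul_apply, ContinuousLinearMap.comp_apply, q1, q2, q3, q4, smul_eq_mul, zero_mul, mul_zero,
    add_zero, map_zero]

end fin2
end KAM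
end PartR


/-- (KAM theorem for b-Poisson manifolds, Theorem 5.1, stated in action-angle
coordinates.)  With `H_ε = (k+εk')·log|y₁| + h(y) + ε·f(φ,y)` on `𝕋ⁿ × B_r` for the
b-symplectic structure `(c/y₁) dφ₁∧dy₁ + Σᵢ₌₂ⁿ dφᵢ∧dyᵢ`, `h` analytic, `f₁` analytic and
periodic, `f₂, f₃` smooth and periodic, `f = f₁ + y₁·f₂ + f₃`, `y₀ ∈ B_r ∩ {y₁ = 0}`,
`ωt = ∂h/∂ỹ(y₀)` Diophantine and `∂²h/∂ỹ²(y₀)` invertible, the torus `𝕋ⁿ × {y₀} ⊆ Z`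
persists: for small `ε > 0` there are smooth `ℤⁿ`-periodic `u, w` of size `O(ε)` such
that `t ↦ (x + tΩ + u(x+tΩ), (0, w(x+tΩ)))` with `Ω = ((k+εk')/c, ωt)` solves the
perturbed system for every `x`, and `x ↦ x + u(x)` is a diffeomorphism of `ℝⁿ`; the
invariant torus `𝒯 = {(x + u(x), (0, w(x)))}` lies in `Z = {y₁ = 0}` and the flow on it
is conjugate to the linear flow with frequency vector `Ω`. -/
theorem stmt0 (m : ℕ) (hm : 1 ≤ m) (c : ℝ) (hc : c ≠ 0) (k k' r : ℝ) (hr : 0 < r)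
    (h : ℝ × (Fin m → ℝ) → ℝ)
    (hh : AnalyticOnNhd ℝ h (Metric.ball (0 : ℝ × (Fin m → ℝ)) r))
    (f₁ : (Fin m → ℝ) × (ℝ × (Fin m → ℝ)) → ℝ)
    (hf₁ : AnalyticOnNhd ℝ f₁ (Set.univ ×ˢ Metric.ball (0 : ℝ × (Fin m → ℝ)) r))
    (hf₁per : ∀ (φ : Fin m → ℝ) (ℓ : Fin m → ℤ) (y : ℝ × (Fin m → ℝ)),
      f₁ (φ + (fun i => (ℓ i : ℝ)), y) = f₁ (φ, y))
    (f₂ : Pt m → ℝ)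
    (hf₂ : ContDiffOn ℝ (⊤ : ℕ∞) f₂ (Set.univ ×ˢ Metric.ball (0 : ℝ × (Fin m → ℝ)) r))
    (hf₂per : ∀ (φ : ℝ × (Fin m → ℝ)) (ℓ : ℤ × (Fin m → ℤ)) (y : ℝ × (Fin m → ℝ)),
      f₂ ((φ.1 + (ℓ.1 : ℝ), φ.2 + (fun i => (ℓ.2 i : ℝ))), y) = f₂ (φ, y))
    (f₃ : ℝ × ℝ → ℝ)
    (hf₃ : ContDiffOn ℝ (⊤ : ℕ∞) f₃ (Set.univ ×ˢ Set.Ioo (-r) r))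
    (hf₃per : ∀ s u : ℝ, f₃ (s + 1, u) = f₃ (s, u))
    (f : Pt m → ℝ)
    (hf : ∀ p : Pt m, f p = f₁ (p.1.2, p.2) + p.2.1 * f₂ p + f₃ (p.1.1, p.2.1))
    (y₀ : ℝ × (Fin m → ℝ)) (hy₀ : y₀ ∈ Metric.ball (0 : ℝ × (Fin m → ℝ)) r)
    (hy₀1 : y₀.1 = 0)
    (ωt : Fin m → ℝ) (hωt : ∀ i, ωt i = fderiv ℝ h y₀ (0, Pi.single i 1))
    (hdioph : ∃ L γ : ℝ, 0 < L ∧ 0 < γ ∧ ∀ κ : Fin m → ℤ, κ ≠ 0 →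
      L / (∑ i, |(κ i : ℝ)|) ^ γ ≤ |∑ i, ωt i * (κ i : ℝ)|)
    (hnondeg : (Matrix.of fun i j : Fin m =>
      fderiv ℝ (fun y => fderiv ℝ h y (0, Pi.single j 1)) y₀ (0, Pi.single i 1)).det ≠ 0) :
    ∃ ε₀ C : ℝ, 0 < ε₀ ∧ 0 < C ∧
      ∀ ε : ℝ, 0 < ε → ε < ε₀ →
        ∃ (u uinv : ℝ × (Fin m → ℝ) → ℝ × (Fin m → ℝ))
          (w : ℝ × (Fin m → ℝ) → Fin m → ℝ),
          ContDiff ℝ (⊤ : ℕ∞) u ∧ ContDiff ℝ (⊤ : ℕ∞) w ∧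
          -- `u` and `w` are ℤⁿ-periodic
          (∀ (x : ℝ × (Fin m → ℝ)) (ℓ : ℤ × (Fin m → ℤ)),
            u (x + ((ℓ.1 : ℝ), fun i => (ℓ.2 i : ℝ))) = u x) ∧
          (∀ (x : ℝ × (Fin m → ℝ)) (ℓ : ℤ × (Fin m → ℤ)),
            w (x + ((ℓ.1 : ℝ), fun i => (ℓ.2 i : ℝ))) = w x) ∧
          -- `u` and `w − ỹ₀` are of size `O(ε)`
          (∀ x, ‖u x‖ ≤ C * ε) ∧
          (∀ x, ‖w x - y₀.2‖ ≤ C * ε) ∧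
          -- the invariant torus stays in the coordinate chart (and in `Z = {y₁ = 0}`)
          (∀ x, ((0 : ℝ), w x) ∈ Metric.ball (0 : ℝ × (Fin m → ℝ)) r) ∧
          -- `x ↦ x + u x` is a diffeomorphism of `ℝⁿ`
          Function.LeftInverse uinv (fun x => x + u x) ∧
          Function.RightInverse uinv (fun x => x + u x) ∧
          ContDiff ℝ (⊤ : ℕ∞) uinv ∧
          -- the parametrized curves solve the perturbed b-Hamiltonian system:
          -- the flow on the invariant torus is conjugate, via `x ↦ (x + u x, (0, w x))`,
          -- to the linear flow with frequency vector `Ω = ((k+εk')/c, ωt)`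
          (∀ (x : ℝ × (Fin m → ℝ)) (t : ℝ),
            let Ω : ℝ × (Fin m → ℝ) := ((k + ε * k') / c, ωt)
            let θ : ℝ → ℝ × (Fin m → ℝ) := fun s => x + s • Ω
            let φc : ℝ → ℝ × (Fin m → ℝ) := fun s => θ s + u (θ s)
            let yc : ℝ → ℝ × (Fin m → ℝ) := fun s => ((0 : ℝ), w (θ s))
            HasDerivAt (fun s => (φc s).1)
              ((k + ε * k') / c + ((yc t).1 / c) *
                (fderiv ℝ h (yc t) (1, 0) + ε * pdY1 f (φc t, yc t))) t ∧
            (∀ i : Fin m, HasDerivAt (fun s => (φc s).2 i)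
              (fderiv ℝ h (yc t) (0, Pi.single i 1) + ε * pdY f (φc t, yc t) i) t) ∧
            HasDerivAt (fun s => (yc s).1)
              (-(ε * ((yc t).1 / c) * pdPhi1 f (φc t, yc t))) t ∧
            (∀ i : Fin m, HasDerivAt (fun s => (yc s).2 i)
              (-(ε * pdPhi f (φc t, yc t) i)) t)) := by
  classical
  have hm0 : 0 < m := hm
  have hy₀e : y₀ = (0, y₀.2) := Prod.ext hy₀1 rfl
  obtain ⟨L, γ, hL, -, hdi⟩ := hdioph
  have hω := KAM.dio_of hL hdi
  have hAH : ∀ θ : KAM.E m, KAM.AH m (θ, KAM.eqi m y₀.2) = y₀ := fun θ => by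
    rw [KAM.AH_apply, hy₀e]; rfl
  have hAF : ∀ θ : KAM.E m, KAM.AF m (θ, KAM.eqi m y₀.2) = (KAM.eqv m θ, y₀) := fun θ => by
    rw [KAM.AF_apply, hy₀e]; rfl
  have hhy : AnalyticAt ℝ h y₀ := hh y₀ hy₀
  have aH : ∀ θ, AnalyticAt ℝ (fun p => h (KAM.AH m p)) (θ, KAM.eqi m y₀.2) := fun θ =>
    AnalyticAt.comp (by rw [hAH]; exact hhy) ((KAM.AH m).analyticAt _)
  have aF : ∀ θ, AnalyticAt ℝ (fun p => f₁ (KAM.AF m p)) (θ, KAM.eqi m y₀.2) := fun θ =>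
    AnalyticAt.comp (by rw [hAF]; exact hf₁ _ ⟨trivial, hy₀⟩) ((KAM.AF m).analyticAt _)
  have pH : KAM.PerX (fun p => h (KAM.AH m p)) := fun θ l y => rfl
  have pF : KAM.PerX (fun p => f₁ (KAM.AF m p)) := fun θ l y => hf₁per (KAM.eqv m θ) l (0, KAM.eqv m y)
  have hx0 : ∀ θ, KAM.gx (fun p => h (KAM.AH m p)) (θ, KAM.eqi m y₀.2) = 0 := fun θ =>
    KAM.gxH (by rw [hAH]; exact hhy.differentiableAt)
  have hy0 : ∀ θ, KAM.gy (fun p => h (KAM.AH m p)) (θ, KAM.eqi m y₀.2) = WithLp.toLp 2 ωt := fun θ => by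
    ext i
    rw [KAM.gyH (by rw [hAH]; exact hhy.differentiableAt), hAH, ← hωt]
  obtain ⟨Q, hQdef⟩ : ∃ Q, Q = KAM.gyy (fun p => h (KAM.AH m p)) (0, KAM.eqi m y₀.2) := ⟨_, rfl⟩
  have hyy : ∀ θ, KAM.gyy (fun p => h (KAM.AH m p)) (θ, KAM.eqi m y₀.2) = Q := fun θ => by
    rw [hQdef]; exact KAM.gyy_transl (fun x x' y => rfl) θ _
  have hQinj : ∀ v, Q v = 0 → v = 0 := by
    intro v hv
    have hvec : Matrix.vecMul (KAM.eqv m v) (Matrix.of fun i j : Fin m =>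
      fderiv ℝ (fun y => fderiv ℝ h y (0, Pi.single j 1)) y₀ (0, Pi.single i 1)) = 0 := by
      funext j
      have h1 : Q v j = 0 := by rw [hv]; rfl
      rw [KAM.E_sum v, map_sum] at h1
      simp only [map_smul] at h1
      have h2 : ∀ i, Q (EuclideanSpace.single i 1) j =
          fderiv ℝ (fun y => fderiv ℝ h y (0, Pi.single j 1)) y₀ (0, Pi.single i 1) := fun i => by
        rw [hQdef, KAM.gyyH (by rw [hAH]; exact hhy), hAH]
      rw [Pi.zero_apply]
      refine Eq.trans ?_ h1
      simp [Matrix.vecMul, dotProduct, h2, Finset.sum_apply, KAM.eqv_apply]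
    have := Matrix.eq_zero_of_vecMul_eq_zero hnondeg hvec
    rw [← KAM.eqi_eqv v, this, map_zero]
  obtain ⟨β, hβ, hQ⟩ := KAM.anti_of_inj hQinj
  obtain ⟨ε0, ρ, C, hε0, hρ, hC, key⟩ := KAM.kam_main hm0 aH pH aF pF hω hx0 hy0 hβ hQ hyy
  have hmarg : 0 < r - ‖y₀‖ := by
    have := mem_ball_zero_iff.1 hy₀; linarith
  obtain ⟨ε1, hε1, hev⟩ := Metric.eventually_nhds_iff.1 ((KAM.small_ev C (d := (r - ‖y₀‖) / 2) (by positivity)).and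
    (KAM.small_ev (2 * Real.pi / ρ * C) (d := 1 / 2) (by norm_num)))
  refine ⟨min ε0 ε1, C, lt_min hε0 hε1, hC, fun ε hε hεε => ?_⟩
  obtain ⟨s1, s2⟩ := hev (y := ε) (by
    rw [Real.dist_eq, sub_zero, abs_of_pos hε]; exact hεε.trans_le (min_le_right _ _))
  obtain ⟨u, p, wu, wp, q1, q2⟩ := key ε hε (hεε.trans_le (min_le_left _ _))
  have hu : ContDiff ℝ (⊤ : ℕ∞) u := wu.contDiff hρ
  have hp : ContDiff ℝ (⊤ : ℕ∞) p := by
    have := (wp.contDiff hρ).add (contDiff_const (c := KAM.eqi m y₀.2))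
    simpa using this
  have hdu : Differentiable ℝ u := hu.differentiable (by simp)
  have hdp : Differentiable ℝ p := hp.differentiable (by simp)
  obtain ⟨v, v1, v2, v3⟩ := KAM.diffeo hu (fun θ => by
    refine ((wu.fderivW hρ le_rfl).norm_le (by simp) θ).trans ?_
    linarith)
  have hpn : ∀ θ, ‖KAM.eqv m (p θ) - y₀.2‖ ≤ C * ε := fun θ => by
    have := wp.norm_le hρ.le θ
    refine le_trans ?_ this
    have h1 := KAM.eqv_norm (p θ - KAM.eqi m y₀.2)
    rwa [map_sub, KAM.eqv_eqi] at h1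
  have hball : ∀ θ, ((0 : ℝ), KAM.eqv m (p θ)) ∈ Metric.ball (0 : ℝ × (Fin m → ℝ)) r := fun θ => by
    rw [mem_ball_zero_iff]
    have h1 : ‖((0 : ℝ), KAM.eqv m (p θ))‖ = ‖KAM.eqv m (p θ)‖ := by simp [Prod.norm_def]
    have h2 : ‖KAM.eqv m (p θ)‖ ≤ ‖KAM.eqv m (p θ) - y₀.2‖ + ‖y₀.2‖ := by
      simpa using norm_add_le (KAM.eqv m (p θ) - y₀.2) y₀.2
    have h3 := norm_snd_le y₀
    have h4 := hpn θ
    rw [h1]; linarith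
  let pr : ℝ × (Fin m → ℝ) →L[ℝ] KAM.E m := (KAM.eqi m).comp (ContinuousLinearMap.snd ℝ ℝ (Fin m → ℝ))
  have hpr : ∀ x, pr x = KAM.eqi m x.2 := fun x => rfl
  refine ⟨fun x => (0, KAM.eqv m (u (pr x))), fun x => (x.1, KAM.eqv m (v (pr x))), fun x => KAM.eqv m (p (pr x)),
    ?_, ?_, ?_, ?_, ?_, ?_, ?_, ?_, ?_, ?_, ?_⟩
  · exact contDiff_const.prodMk ((KAM.eqv m).contDiff.comp (hu.comp pr.contDiff))
  · exact (KAM.eqv m).contDiff.comp (hp.comp pr.contDiff)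
  · intro x ℓ
    have := wu.periodic (pr x) ℓ.2
    show ((0 : ℝ), KAM.eqv m (u (pr (x + _)))) = _
    rw [map_add]
    exact congrArg (fun z => ((0 : ℝ), KAM.eqv m z)) this
  · intro x ℓ
    have := wp.periodic (pr x) ℓ.2
    have h2 := sub_left_injective this
    show KAM.eqv m (p (pr (x + _))) = _
    rw [map_add]
    exact congrArg (fun z => KAM.eqv m z) h2
  · intro x
    have h1 : ‖((0 : ℝ), KAM.eqv m (u (pr x)))‖ = ‖KAM.eqv m (u (pr x))‖ := by simp [Prod.norm_def]
    refine h1.le.trans ((KAM.eqv_norm _).trans (wu.norm_le hρ.le _))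
  · exact fun x => hpn _
  · exact fun x => hball _
  · intro x
    have h1 := v1 (pr x)
    have h2 : pr (x + (0, KAM.eqv m (u (pr x)))) = pr x + u (pr x) := by rw [map_add]; rfl
    refine Prod.ext (by simp) ?_
    show KAM.eqv m (v (pr (x + (0, KAM.eqv m (u (pr x)))))) = x.2
    rw [h2]
    exact congrArg (KAM.eqv m) h1
  · intro x
    have h1 := v2 (pr x)
    refine Prod.ext (by simp) ?_
    exact congrArg (KAM.eqv m) h1
  · exact contDiff_fst.prodMk ((KAM.eqv m).contDiff.comp (v3.comp pr.contDiff))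
  · intro x t Ω θ φc yc
    have hyc : (yc t).1 = 0 := rfl
    have hb : yc t ∈ Metric.ball (0 : ℝ × (Fin m → ℝ)) r := hball _
    obtain ⟨ϑ, hϑ⟩ : ∃ ϑ : KAM.E m, ϑ = pr (θ t) := ⟨_, rfl⟩
    have hline : HasDerivAt (fun s => pr (θ s)) (WithLp.toLp 2 ωt) t := by
      have h1 : HasDerivAt θ Ω t := by
        have := ((hasDerivAt_id t).smul_const Ω).const_add x
        rw [one_smul] at this
        exact this
      exact pr.hasFDerivAt.comp_hasDerivAt t h1
    have hAHt : KAM.AH m (ϑ + u ϑ, p ϑ) = yc t := by rw [hϑ]; rfl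
    have hAFt : KAM.AF m (ϑ + u ϑ, p ϑ) = ((φc t).2, yc t) := by rw [hϑ]; rfl
    have dh : DifferentiableAt ℝ h (KAM.AH m (ϑ + u ϑ, p ϑ)) := by rw [hAHt]; exact (hh _ hb).differentiableAt
    have df : DifferentiableAt ℝ f₁ (KAM.AF m (ϑ + u ϑ, p ϑ)) := by
      rw [hAFt]; exact (hf₁ _ ⟨trivial, hb⟩).differentiableAt
    refine ⟨?_, fun i => ?_, ?_, fun i => ?_⟩
    · have h1 : HasDerivAt (fun s : ℝ => x.1 + s * ((k + ε * k') / c) + 0) ((k + ε * k') / c) t := by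
        have := (((hasDerivAt_id t).mul_const ((k + ε * k') / c)).const_add x.1).add_const 0
        simpa using this
      rw [hyc, zero_div, zero_mul, add_zero]
      exact h1
    · have h1 : HasDerivAt (fun s => pr (θ s) + u (pr (θ s))) (WithLp.toLp 2 ωt + fderiv ℝ u ϑ (WithLp.toLp 2 ωt)) t := by
        have := (hdu (pr (θ t))).hasFDerivAt.comp_hasDerivAt t hline
        rw [hϑ]
        exact hline.add this
      rw [q1] at h1
      have h2 := (EuclideanSpace.proj i : KAM.E m →L[ℝ] ℝ).hasFDerivAt.comp_hasDerivAt t h1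
      have h3 : pdY f (φc t, yc t) i = KAM.gy (fun p => f₁ (KAM.AF m p)) (ϑ + u ϑ, p ϑ) i := by
        rw [pdY, KAM.gyF df, hAFt]
        exact KAM.fd_f hr hf₁ hf₂ hf₃ hf (φc t, yc t) hb hyc 0 (Pi.single i 1)
      have h4 : fderiv ℝ h (yc t) (0, Pi.single i 1) = KAM.gy (fun p => h (KAM.AH m p)) (ϑ + u ϑ, p ϑ) i := by
        rw [KAM.gyH dh, hAHt]
      rw [h3, h4]
      exact h2
    · rw [hyc, zero_div, mul_zero, zero_mul, neg_zero]
      exact hasDerivAt_const t (0 : ℝ)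
    · have h1 : HasDerivAt (fun s => p (pr (θ s))) (fderiv ℝ p ϑ (WithLp.toLp 2 ωt)) t := by
        rw [hϑ]
        exact (hdp (pr (θ t))).hasFDerivAt.comp_hasDerivAt t hline
      rw [q2] at h1
      have h2 := (EuclideanSpace.proj i : KAM.E m →L[ℝ] ℝ).hasFDerivAt.comp_hasDerivAt t h1
      have h3 : pdPhi f (φc t, yc t) i = KAM.gx (fun p => f₁ (KAM.AF m p)) (ϑ + u ϑ, p ϑ) i := by
        rw [pdPhi, KAM.gxF df, hAFt]
        exact KAM.fd_f hr hf₁ hf₂ hf₃ hf (φc t, yc t) hb hyc (Pi.single i 1) 0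
      rw [h3]
      rw [KAM.gxH dh, zero_add] at h2
      exact h2
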